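/- Let 1 ≤ p < ∞, m ∈ ℕ, a ∈ ℝ and ℓ = 0, i.e. ℝ⁰_* = {0} and ρ(x) = min(1,|x|). Then 𝒦^m_{a,p}(ℝ^d,ℝ⁰_*) is an algebra with respect to pointwise multiplication (i.e. the product of any two elements lies in the space and the norm of the product is bounded by a constant times the product of the norms) if, and only if, a ≥ d/p and either 1 < p < ∞ and m > d/p, or p = 1 and m ≥ d. -/

import Mathlib

open MeasureTheory Metric Set Filter
open scoped Topology ENNReal NNReal

noncomputable section

/-- `d`-dimensional Euclidean space. -/
abbrev Ed (d : ℕ) : Type := EuclideanSpace ℝ (Fin d)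

/-- The finite set of all multi-indices `α : Fin d → ℕ` with `|α| = ∑ i, α i ≤ m`. -/
def multiIdx (d m : ℕ) : Finset (Fin d → ℕ) :=
  (Fintype.piFinset fun _ : Fin d => Finset.range (m + 1)).filter fun α => ∑ i, α i ≤ m

/-- First-order partial derivative in the `i`-th coordinate direction. -/
def pderivI (d : ℕ) (i : Fin d) (f : Ed d → ℝ) : Ed d → ℝ :=
  fun x => fderiv ℝ f x (EuclideanSpace.single i 1)

/-- Iterated partial derivative `∂^α`. -/
def pderivA (d : ℕ) (α : Fin d → ℕ) (f : Ed d → ℝ) : Ed d → ℝ :=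
  ((List.finRange d).foldr (fun i g => (pderivI d i)^[α i] ∘ g) id) f

/-- Smooth compactly supported test functions with support inside `Ω`. -/
def IsTestFun (d : ℕ) (Ω : Set (Ed d)) (φ : Ed d → ℝ) : Prop :=
  ContDiff ℝ (⊤ : ℕ∞) φ ∧ HasCompactSupport φ ∧ tsupport φ ⊆ Ω

/-- `v` is the `α`-th weak (distributional) derivative of `u` on `Ω`. -/
def HasWeakDerivOn (d : ℕ) (Ω : Set (Ed d)) (α : Fin d → ℕ) (u v : Ed d → ℝ) : Prop :=
  LocallyIntegrableOn u Ω volume ∧ LocallyIntegrableOn v Ω volume ∧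
    ∀ φ : Ed d → ℝ, IsTestFun d Ω φ →
      ∫ x in Ω, u x * pderivA d α φ x = (-1 : ℝ) ^ (∑ i, α i) * ∫ x in Ω, v x * φ x

/-- `D` is a family of weak derivatives of `u` on `Ω` for all multi-indices of order `≤ m`. -/
def IsWeakDerivFamily (d : ℕ) (Ω : Set (Ed d)) (m : ℕ) (u : Ed d → ℝ)
    (D : (Fin d → ℕ) → Ed d → ℝ) : Prop :=
  ∀ α ∈ multiIdx d m, HasWeakDerivOn d Ω α u (D α)

/-- `x ↦ (ρ(x)^(|α|-a) |v(x)|)^p`, the integrand in the Kondratiev norm. -/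
def kIntegrand (d : ℕ) (ρ : Ed d → ℝ) (a p : ℝ) (α : Fin d → ℕ) (v : Ed d → ℝ) : Ed d → ℝ :=
  fun x => (ρ x ^ (((∑ i, α i : ℕ) : ℝ) - a) * |v x|) ^ p

/-- The Kondratiev norm computed from a family `D` of weak derivatives. -/
def KnormP (d : ℕ) (Ω : Set (Ed d)) (ρ : Ed d → ℝ) (m : ℕ) (a p : ℝ)
    (D : (Fin d → ℕ) → Ed d → ℝ) : ℝ :=
  (∑ α ∈ multiIdx d m, ∫ x in Ω, kIntegrand d ρ a p α (D α) x) ^ (1 / p)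

/-- `D` witnesses membership of `u` in the Kondratiev space `𝒦^m_{a,p}(Ω, M)`
    (with weight function `ρ`). -/
def KMemData (d : ℕ) (Ω : Set (Ed d)) (ρ : Ed d → ℝ) (m : ℕ) (a p : ℝ)
    (u : Ed d → ℝ) (D : (Fin d → ℕ) → Ed d → ℝ) : Prop :=
  IsWeakDerivFamily d Ω m u D ∧
    ∀ α ∈ multiIdx d m, IntegrableOn (kIntegrand d ρ a p α (D α)) Ω volume

/-- Membership in the Kondratiev space `𝒦^m_{a,p}(Ω, M)` with weight `ρ`, `p < ∞`. -/
def MemK (d : ℕ) (Ω : Set (Ed d)) (ρ : Ed d → ℝ) (m : ℕ) (a p : ℝ) (u : Ed d → ℝ) : Prop :=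
  ∃ D, KMemData d Ω ρ m a p u D

open Classical in
/-- The Kondratiev norm of `u` (computed from a choice of weak derivative family;
    it is a.e. independent of this choice). -/
def Knorm (d : ℕ) (Ω : Set (Ed d)) (ρ : Ed d → ℝ) (m : ℕ) (a p : ℝ) (u : Ed d → ℝ) : ℝ :=
  if h : MemK d Ω ρ m a p u then KnormP d Ω ρ m a p h.choose else 0

/-- `x ↦ ρ(x)^(|α|-a) v(x)`, the function whose `L_∞` norm enters the norm for `p = ∞`. -/
def kIntegrandInf (d : ℕ) (ρ : Ed d → ℝ) (a : ℝ) (α : Fin d → ℕ) (v : Ed d → ℝ) : Ed d → ℝ :=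
  fun x => ρ x ^ (((∑ i, α i : ℕ) : ℝ) - a) * v x

/-- `D` witnesses membership of `u` in `𝒦^m_{a,∞}(Ω, M)`. -/
def KMemDataInf (d : ℕ) (Ω : Set (Ed d)) (ρ : Ed d → ℝ) (m : ℕ) (a : ℝ)
    (u : Ed d → ℝ) (D : (Fin d → ℕ) → Ed d → ℝ) : Prop :=
  IsWeakDerivFamily d Ω m u D ∧
    ∀ α ∈ multiIdx d m,
      eLpNorm (kIntegrandInf d ρ a α (D α)) ⊤ (volume.restrict Ω) < ⊤

/-- Membership in `𝒦^m_{a,∞}(Ω, M)`. -/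
def MemKInf (d : ℕ) (Ω : Set (Ed d)) (ρ : Ed d → ℝ) (m : ℕ) (a : ℝ) (u : Ed d → ℝ) : Prop :=
  ∃ D, KMemDataInf d Ω ρ m a u D

/-- The `𝒦^m_{a,∞}` norm computed from a family `D` of weak derivatives. -/
def KnormInfP (d : ℕ) (Ω : Set (Ed d)) (ρ : Ed d → ℝ) (m : ℕ) (a : ℝ)
    (D : (Fin d → ℕ) → Ed d → ℝ) : ℝ :=
  ∑ α ∈ multiIdx d m, (eLpNorm (kIntegrandInf d ρ a α (D α)) ⊤ (volume.restrict Ω)).toReal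

open Classical in
/-- The `𝒦^m_{a,∞}(Ω, M)` norm of `u`. -/
def KnormInf (d : ℕ) (Ω : Set (Ed d)) (ρ : Ed d → ℝ) (m : ℕ) (a : ℝ) (u : Ed d → ℝ) : ℝ :=
  if h : MemKInf d Ω ρ m a u then KnormInfP d Ω ρ m a h.choose else 0

/-- The subspace `ℝ^ℓ_* = {x : x₁ = ⋯ = x_{d-ℓ} = 0}` of `ℝ^d`. -/
def RStar (d ℓ : ℕ) : Set (Ed d) := {x | ∀ i : Fin d, (i : ℕ) < d - ℓ → x i = 0}

/-- The weight `ρ(x) = min(1, |x'|)` for the model case `(ℝ^d, ℝ^ℓ_*)`. -/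
def rhoModel (d ℓ : ℕ) (x : Ed d) : ℝ :=
  min 1 (Real.sqrt (∑ i ∈ Finset.univ.filter (fun i : Fin d => (i : ℕ) < d - ℓ), (x i) ^ 2))

/-- The model domain `ℝ^d ∖ ℝ^ℓ_*`. -/
def ModelDomain (d ℓ : ℕ) : Set (Ed d) := (RStar d ℓ)ᶜ

/-- Membership in the model Kondratiev space `𝒦^m_{a,p}(ℝ^d, ℝ^ℓ_*)`, `p < ∞`. -/
def MemKM (d ℓ m : ℕ) (a p : ℝ) (u : Ed d → ℝ) : Prop :=
  MemK d (ModelDomain d ℓ) (rhoModel d ℓ) m a p u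

/-- The norm of the model Kondratiev space `𝒦^m_{a,p}(ℝ^d, ℝ^ℓ_*)`, `p < ∞`. -/
def KnormM (d ℓ m : ℕ) (a p : ℝ) (u : Ed d → ℝ) : ℝ :=
  Knorm d (ModelDomain d ℓ) (rhoModel d ℓ) m a p u

/-- Membership in the model Kondratiev space `𝒦^m_{a,∞}(ℝ^d, ℝ^ℓ_*)`. -/
def MemKMInf (d ℓ m : ℕ) (a : ℝ) (u : Ed d → ℝ) : Prop :=
  MemKInf d (ModelDomain d ℓ) (rhoModel d ℓ) m a u

/-- The norm of the model Kondratiev space `𝒦^m_{a,∞}(ℝ^d, ℝ^ℓ_*)`. -/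
def KnormMInf (d ℓ m : ℕ) (a : ℝ) (u : Ed d → ℝ) : ℝ :=
  KnormInf d (ModelDomain d ℓ) (rhoModel d ℓ) m a u

/-- Ordered composition of iterates of a family of maps, as in `pderivA`. -/
def foldOp {d : ℕ} {X : Type*} (T : Fin d → X → X) (α : Fin d → ℕ) (l : List (Fin d)) : X → X :=
  l.foldr (fun i g => (T i)^[α i] ∘ g) id

section foldOp
variable {d : ℕ} {X : Type*} {T : Fin d → X → X} {P : X → Prop}

lemma foldOp_cons (α : Fin d → ℕ) (i : Fin d) (l : List (Fin d)) (x : X) :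
    foldOp T α (i :: l) x = (T i)^[α i] (foldOp T α l x) := rfl

lemma foldOp_zero (l : List (Fin d)) (x : X) : foldOp T 0 l x = x := by
  induction l with
  | nil => rfl
  | cons i l ih => rw [foldOp_cons, ih]; rfl

lemma iter_mem (hP : ∀ i x, P x → P (T i x)) (i : Fin d) (n : ℕ) (x : X) (hx : P x) :
    P ((T i)^[n] x) := by
  induction n with
  | zero => exact hx
  | succ n ih => rw [Function.iterate_succ_apply']; exact hP _ _ ih

lemma foldOp_mem (hP : ∀ i x, P x → P (T i x)) (α : Fin d → ℕ) (l : List (Fin d)) (x : X)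
    (hx : P x) : P (foldOp T α l x) := by
  induction l with
  | nil => exact hx
  | cons i l ih => rw [foldOp_cons]; exact iter_mem hP _ _ _ ih

lemma iter_comm (hP : ∀ i x, P x → P (T i x)) (hc : ∀ i j x, P x → T i (T j x) = T j (T i x))
    (i j : Fin d) (n : ℕ) (x : X) (hx : P x) : (T i)^[n] (T j x) = T j ((T i)^[n] x) := by
  induction n with
  | zero => rfl
  | succ n ih =>
    rw [Function.iterate_succ_apply', ih, Function.iterate_succ_apply', hc _ _ _ (iter_mem hP _ _ _ hx)]

lemma foldOp_comm (hP : ∀ i x, P x → P (T i x)) (hc : ∀ i j x, P x → T i (T j x) = T j (T i x))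
    (α : Fin d → ℕ) (l : List (Fin d)) (j : Fin d) (x : X) (hx : P x) :
    foldOp T α l (T j x) = T j (foldOp T α l x) := by
  induction l with
  | nil => rfl
  | cons i l ih =>
    rw [foldOp_cons, foldOp_cons, ih, iter_comm hP hc _ _ _ _ (foldOp_mem hP _ _ _ hx)]

lemma foldOp_add_single_notMem (α : Fin d → ℕ) (l : List (Fin d)) (i : Fin d) (h : i ∉ l) (x : X) :
    foldOp T (α + Pi.single i 1) l x = foldOp T α l x := by
  induction l with
  | nil => rfl
  | cons j l ih =>
    rw [List.mem_cons, not_or] at h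
    rw [foldOp_cons, foldOp_cons, ih h.2]
    simp [Ne.symm h.1]

lemma foldOp_add_single (hP : ∀ i x, P x → P (T i x))
    (hc : ∀ i j x, P x → T i (T j x) = T j (T i x))
    (α : Fin d → ℕ) (l : List (Fin d)) (hl : l.Nodup) (i : Fin d) (h : i ∈ l) (x : X) (hx : P x) :
    foldOp T (α + Pi.single i 1) l x = T i (foldOp T α l x) := by
  induction l with
  | nil => simp at h
  | cons j l ih =>
    rw [List.nodup_cons] at hl
    rw [foldOp_cons, foldOp_cons]
    by_cases hij : i = j
    · subst hij
      rw [foldOp_add_single_notMem _ _ _ hl.1]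
      simp only [Pi.add_apply, Pi.single_eq_same, Function.iterate_succ_apply']
    · have : i ∈ l := by simpa [hij] using h
      rw [ih hl.2 this, iter_comm hP hc _ _ _ _ (foldOp_mem hP _ _ _ hx)]
      simp [Ne.symm hij]

end foldOp

lemma mem_multiIdx {d m : ℕ} {α : Fin d → ℕ} : α ∈ multiIdx d m ↔ ∑ i, α i ≤ m := by
  unfold multiIdx
  simp only [Finset.mem_filter, Fintype.mem_piFinset, Finset.mem_range, and_iff_right_iff_imp]
  intro h i
  have := Finset.single_le_sum (f := α) (fun j _ => Nat.zero_le _) (Finset.mem_univ i)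
  omega

lemma sum_add_single {d : ℕ} (α : Fin d → ℕ) (i : Fin d) :
    ∑ j, (α + Pi.single i 1 : Fin d → ℕ) j = ∑ j, α j + 1 := by
  simp [Finset.sum_add_distrib]

lemma exists_pred {d : ℕ} (α : Fin d → ℕ) (n : ℕ) (h : ∑ j, α j = n + 1) :
    ∃ (β : Fin d → ℕ) (i : Fin d), α = β + Pi.single i 1 ∧ ∑ j, β j = n := by
  have : ∃ i, α i ≠ 0 := by
    by_contra hc
    push Not at hc
    simp [hc] at h
  obtain ⟨i, hi⟩ := this
  refine ⟨Function.update α i (α i - 1), i, ?_, ?_⟩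
  · ext j
    by_cases hj : j = i
    · subst hj; simp; omega
    · simp [hj]
  · have : α = Function.update α i (α i - 1) + Pi.single i 1 := by
      ext j
      by_cases hj : j = i
      · subst hj; simp; omega
      · simp [hj]
    rw [this, sum_add_single] at h
    omega

/-- Smoothness. -/
abbrev Smth {d : ℕ} (f : Ed d → ℝ) : Prop := ContDiff ℝ (⊤ : ℕ∞) f

lemma pderivI_smooth {d : ℕ} (i : Fin d) (f : Ed d → ℝ) (hf : Smth f) : Smth (pderivI d i f) := by
  unfold pderivI Smth
  exact (hf.fderiv_right (m := (⊤ : ℕ∞)) (by simp)).clm_apply contDiff_const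

lemma pderivI_comm {d : ℕ} (i j : Fin d) (f : Ed d → ℝ) (hf : Smth f) :
    pderivI d i (pderivI d j f) = pderivI d j (pderivI d i f) := by
  ext x
  have h1 : DifferentiableAt ℝ (fderiv ℝ f) x :=
    ((hf.fderiv_right (m := (⊤ : ℕ∞)) (by simp)).differentiable (by simp)) x
  have hs : IsSymmSndFDerivAt ℝ f x := (hf.contDiffAt).isSymmSndFDerivAt (by
    rw [minSmoothness_of_isRCLikeNormedField]
    exact WithTop.coe_le_coe.2 (le_top (a := (2 : ℕ∞))))
  unfold pderivI
  rw [fderiv_clm_apply h1 (differentiableAt_const _), fderiv_clm_apply h1 (differentiableAt_const _)]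
  simp
  exact hs _ _

lemma pderivA_zero {d : ℕ} (f : Ed d → ℝ) : pderivA d 0 f = f := foldOp_zero (T := pderivI d) _ f

lemma pderivA_smooth {d : ℕ} (α : Fin d → ℕ) (f : Ed d → ℝ) (hf : Smth f) :
    Smth (pderivA d α f) :=
  foldOp_mem (T := pderivI d) (P := Smth) pderivI_smooth α _ f hf

lemma pderivA_succ {d : ℕ} (α : Fin d → ℕ) (i : Fin d) (f : Ed d → ℝ) (hf : Smth f) :
    pderivA d (α + Pi.single i 1) f = pderivI d i (pderivA d α f) :=
  foldOp_add_single (T := pderivI d) (P := Smth) pderivI_smooth pderivI_comm α _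
    (List.nodup_finRange d) i (List.mem_finRange i) f hf

lemma pderivA_succ' {d : ℕ} (α : Fin d → ℕ) (i : Fin d) (f : Ed d → ℝ) (hf : Smth f) :
    pderivA d (α + Pi.single i 1) f = pderivA d α (pderivI d i f) := by
  rw [pderivA_succ _ _ _ hf]
  exact (foldOp_comm (T := pderivI d) (P := Smth) pderivI_smooth pderivI_comm α _ i f hf).symm

lemma pderivI_tsupport {d : ℕ} (i : Fin d) (f : Ed d → ℝ) :
    tsupport (pderivI d i f) ⊆ tsupport f := by
  refine closure_minimal ?_ (isClosed_tsupport f)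
  intro x hx
  by_contra h
  apply hx
  have := (notMem_tsupport_iff_eventuallyEq.1 h).fderiv_eq (𝕜 := ℝ)
  simp [pderivI, this]

lemma pderivA_tsupport {d : ℕ} (α : Fin d → ℕ) (f : Ed d → ℝ) :
    tsupport (pderivA d α f) ⊆ tsupport f :=
  foldOp_mem (T := pderivI d) (P := fun g => tsupport g ⊆ tsupport f)
    (fun i g hg => (pderivI_tsupport i g).trans hg) α _ f subset_rfl

lemma IsTestFun.pderivI {d : ℕ} {Ω : Set (Ed d)} {φ : Ed d → ℝ} (h : IsTestFun d Ω φ) (i : Fin d) :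
    IsTestFun d Ω (pderivI d i φ) :=
  ⟨pderivI_smooth i φ h.1, h.2.1.of_isClosed_subset (isClosed_tsupport _) (pderivI_tsupport i φ),
    (pderivI_tsupport i φ).trans h.2.2⟩

lemma IsTestFun.pderivA {d : ℕ} {Ω : Set (Ed d)} {φ : Ed d → ℝ} (h : IsTestFun d Ω φ)
    (α : Fin d → ℕ) : IsTestFun d Ω (pderivA d α φ) :=
  ⟨pderivA_smooth α φ h.1, h.2.1.of_isClosed_subset (isClosed_tsupport _) (pderivA_tsupport α φ),
    (pderivA_tsupport α φ).trans h.2.2⟩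

/-- First order chain of weak derivatives. -/
def WChain (d : ℕ) (Ω : Set (Ed d)) (m : ℕ) (D : (Fin d → ℕ) → Ed d → ℝ) : Prop :=
  (∀ α, ∑ i, α i ≤ m → LocallyIntegrableOn (D α) Ω volume) ∧
  ∀ α, ∑ i, α i < m → ∀ i, ∀ φ, IsTestFun d Ω φ →
    ∫ x in Ω, D α x * pderivI d i φ x = - ∫ x in Ω, D (α + Pi.single i 1) x * φ x

lemma loc_mul_test {d : ℕ} {Ω : Set (Ed d)} {w g : Ed d → ℝ}
    (hw : LocallyIntegrableOn w Ω volume) (hg : Continuous g) (hg1 : HasCompactSupport g)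
    (hg2 : tsupport g ⊆ Ω) : Integrable (fun x => w x * g x) volume := by
  have h1 : IntegrableOn w (tsupport g) volume := hw.integrableOn_compact_subset hg2 hg1
  have h2 : IntegrableOn (fun x => w x * g x) (tsupport g) volume :=
    h1.mul_continuousOn hg.continuousOn hg1
  rwa [integrableOn_iff_integrable_of_support_subset] at h2
  intro x hx
  apply subset_tsupport
  intro h
  apply hx
  simp [h]

lemma weak_unique {d : ℕ} {Ω : Set (Ed d)} (hΩ : IsOpen Ω) {u v : Ed d → ℝ}
    (hu : LocallyIntegrableOn u Ω volume) (hv : LocallyIntegrableOn v Ω volume)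
    (h : ∀ φ, IsTestFun d Ω φ → ∫ x in Ω, u x * φ x = ∫ x in Ω, v x * φ x) :
    u =ᵐ[volume.restrict Ω] v := by
  have key := hΩ.ae_eq_zero_of_integral_contDiff_smul_eq_zero (hu.sub hv) (μ := volume) (by
    intro g hg hg1 hg2
    have hintg : ∀ w : Ed d → ℝ, LocallyIntegrableOn w Ω volume →
        Integrable (fun x => w x * g x) (volume.restrict Ω) := by
      intro w hw
      exact (loc_mul_test hw hg.continuous hg1 hg2).integrableOn
    have h1 := h g ⟨hg, hg1, hg2⟩
    have h2 : ∫ x in Ω, (u x - v x) * g x = 0 := by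
      simp_rw [sub_mul]
      rw [integral_sub (hintg u hu) (hintg v hv), h1, sub_self]
    have h3 : ∫ x, (u x - v x) * g x = 0 := by
      rw [← h2, setIntegral_eq_integral_of_forall_compl_eq_zero]
      intro x hx
      have : g x = 0 := image_eq_zero_of_notMem_tsupport fun hh => hx (hg2 hh)
      simp [this]
    rw [← h3]
    congr 1; ext x; simp [mul_comm])
  rw [Filter.EventuallyEq, ae_restrict_iff' hΩ.measurableSet]
  filter_upwards [key] with x hx hxΩ
  have := hx hxΩ
  simpa [sub_eq_zero] using this

lemma setInt_test {d : ℕ} {Ω : Set (Ed d)} {φ : Ed d → ℝ} (h : tsupport φ ⊆ Ω) (w : Ed d → ℝ) :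
    ∫ x in Ω, w x * φ x = ∫ x, w x * φ x := by
  rw [setIntegral_eq_integral_of_forall_compl_eq_zero]
  intro x hx
  have : φ x = 0 := image_eq_zero_of_notMem_tsupport fun hh => hx (h hh)
  simp [this]

lemma wchain_of_family {d m : ℕ} {Ω : Set (Ed d)} (hΩ : IsOpen Ω) {u : Ed d → ℝ}
    {D : (Fin d → ℕ) → Ed d → ℝ} (h : IsWeakDerivFamily d Ω m u D) :
    WChain d Ω m D ∧ D 0 =ᵐ[volume.restrict Ω] u := by
  refine ⟨⟨fun α hα => (h α (mem_multiIdx.2 hα)).2.1, ?_⟩, ?_⟩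
  · intro α hα i φ hφ
    have h1 := (h α (mem_multiIdx.2 hα.le)).2.2 _ (hφ.pderivI i)
    have h2 := (h (α + Pi.single i 1) (mem_multiIdx.2 (by rw [sum_add_single]; omega))).2.2 _ hφ
    rw [pderivA_succ' _ _ _ hφ.1, h1, sum_add_single, pow_succ] at h2
    have h3 : ((-1 : ℝ) ^ (∑ i, α i)) ≠ 0 := by positivity
    have h4 : (-1 : ℝ) ^ (∑ i, α i) * (∫ x in Ω, D α x * pderivI d i φ x) =
      (-1 : ℝ) ^ (∑ i, α i) * (- ∫ x in Ω, D (α + Pi.single i 1) x * φ x) := by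
      rw [h2]; ring
    exact mul_left_cancel₀ h3 h4
  · have h0 := h 0 (mem_multiIdx.2 (by simp))
    refine weak_unique hΩ h0.2.1 h0.1 fun φ hφ => ?_
    have := h0.2.2 φ hφ
    rw [pderivA_zero] at this
    simpa using this.symm

lemma family_of_wchain {d m : ℕ} {Ω : Set (Ed d)} {u : Ed d → ℝ}
    {D : (Fin d → ℕ) → Ed d → ℝ} (h : WChain d Ω m D) (h0 : D 0 =ᵐ[volume.restrict Ω] u)
    (hu : LocallyIntegrableOn u Ω volume) : IsWeakDerivFamily d Ω m u D := by
  have key : ∀ n, ∀ α : Fin d → ℕ, ∑ i, α i = n → n ≤ m → ∀ φ, IsTestFun d Ω φ →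
      ∫ x in Ω, u x * pderivA d α φ x = (-1 : ℝ) ^ n * ∫ x in Ω, D α x * φ x := by
    intro n
    induction n with
    | zero =>
      intro α hα _ φ hφ
      have : α = 0 := by
        ext i
        have := Finset.single_le_sum (f := α) (fun j _ => Nat.zero_le _) (Finset.mem_univ i)
        simp; omega
      subst this
      rw [pderivA_zero]
      simp only [pow_zero, one_mul]
      apply integral_congr_ae
      filter_upwards [h0] with x hx
      rw [hx]
    | succ n ih =>
      intro α hα hn φ hφ
      obtain ⟨β, i, rfl, hβ⟩ := exists_pred α n hα
      rw [pderivA_succ' _ _ _ hφ.1, ih β hβ (by omega) _ (hφ.pderivI i), h.2 β (by omega) i φ hφ]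
      ring
  intro α hα
  have hα := mem_multiIdx.1 hα
  exact ⟨hu, h.1 α hα, fun φ hφ => key _ α rfl hα φ hφ⟩

lemma Knorm_eq {d m : ℕ} {Ω : Set (Ed d)} (hΩ : IsOpen Ω) {ρ : Ed d → ℝ} {a p : ℝ} {u : Ed d → ℝ}
    {D : (Fin d → ℕ) → Ed d → ℝ} (h : KMemData d Ω ρ m a p u D) :
    Knorm d Ω ρ m a p u = KnormP d Ω ρ m a p D := by
  have hM : MemK d Ω ρ m a p u := ⟨D, h⟩
  unfold Knorm
  rw [dif_pos hM]
  have h2 : KMemData d Ω ρ m a p u hM.choose := hM.choose_spec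
  unfold KnormP
  congr 1
  refine Finset.sum_congr rfl fun α hα => ?_
  apply integral_congr_ae
  have := weak_unique hΩ (h2.1 α hα).2.1 (h.1 α hα).2.1 (fun φ hφ => by
    have e1 := (h2.1 α hα).2.2 φ hφ
    have e2 := (h.1 α hα).2.2 φ hφ
    rw [e1] at e2
    exact mul_left_cancel₀ (by positivity) e2)
  filter_upwards [this] with x hx
  simp [kIntegrand, hx]

/-- A classical family of derivatives on `U`. -/
def IsJet (d m : ℕ) (U : Set (Ed d)) (W : (Fin d → ℕ) → Ed d → ℝ) : Prop :=
  (∀ α, ∑ i, α i ≤ m → Continuous (W α)) ∧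
  ∀ α, ∑ i, α i < m → ∀ x ∈ U, HasFDerivAt (W α)
    (∑ i, W (α + Pi.single i 1) x • (EuclideanSpace.proj i : Ed d →L[ℝ] ℝ)) x

lemma jet_clm_single {d : ℕ} (c : Fin d → ℝ) (i : Fin d) :
    (∑ j, c j • (EuclideanSpace.proj j : Ed d →L[ℝ] ℝ)) (EuclideanSpace.single i 1) = c i := by
  simp [ContinuousLinearMap.sum_apply, Pi.single_apply]

lemma ibp {d : ℕ} {f : Ed d → ℝ} {f' : Ed d → Ed d →L[ℝ] ℝ} {φ : Ed d → ℝ} {Ω : Set (Ed d)}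
    (i : Fin d)
    (hφ : IsTestFun d Ω φ) (hf : Continuous f)
    (hf' : Continuous fun x => f' x (EuclideanSpace.single i 1))
    (hd : ∀ x ∈ tsupport φ, HasFDerivAt f (f' x) x) :
    ∫ x, f x * pderivI d i φ x = - ∫ x, f' x (EuclideanSpace.single i 1) * φ x := by
  have hφi := hφ.pderivI i
  have := integral_bilinear_hasFDerivAt_right_eq_neg_left_of_integrable (μ := (volume : Measure (Ed d)))
    (f := f) (f' := f') (g := φ) (g' := fderiv ℝ φ) (v := EuclideanSpace.single i 1)
    (B := ContinuousLinearMap.mul ℝ ℝ)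
    (loc_mul_test (Ω := univ) (hf'.locallyIntegrable.locallyIntegrableOn _) hφ.1.continuous hφ.2.1 (subset_univ _))
    (loc_mul_test (Ω := univ) (hf.locallyIntegrable.locallyIntegrableOn _) hφi.1.continuous hφi.2.1 (subset_univ _))
    (loc_mul_test (Ω := univ) (hf.locallyIntegrable.locallyIntegrableOn _) hφ.1.continuous hφ.2.1 (subset_univ _))
    hd (fun x _ => (hφ.1.differentiable (by simp) x).hasFDerivAt)
  exact this

lemma wchain_of_jet {d m : ℕ} {Ω : Set (Ed d)} {W : (Fin d → ℕ) → Ed d → ℝ}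
    (h : IsJet d m Ω W) : WChain d Ω m W := by
  refine ⟨fun α hα => (h.1 α hα).locallyIntegrable.locallyIntegrableOn _, ?_⟩
  intro α hα i φ hφ
  rw [setInt_test (hφ.pderivI i).2.2, setInt_test hφ.2.2]
  have := ibp i hφ (h.1 α hα.le) (f' := fun x => ∑ i, W (α + Pi.single i 1) x • (EuclideanSpace.proj i : Ed d →L[ℝ] ℝ))
    (by
      simp_rw [jet_clm_single]
      exact h.1 _ (by rw [sum_add_single]; omega))
    (fun x hx => h.2 α hα x (hφ.2.2 hx))
  simp_rw [jet_clm_single] at this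
  exact this

/-- The model domain for `ℓ = 0`. -/
lemma modelDomain_eq {d : ℕ} : ModelDomain d 0 = ({0}ᶜ : Set (Ed d)) := by
  ext x
  simp only [ModelDomain, RStar, mem_compl_iff, mem_setOf_eq, mem_singleton_iff, not_iff_not]
  constructor
  · intro h; ext i; simpa using h i (by simp)
  · rintro rfl i _; simp

lemma rhoModel_eq {d : ℕ} : rhoModel d 0 = fun x : Ed d => min 1 ‖x‖ := by
  ext x
  unfold rhoModel
  rw [EuclideanSpace.norm_eq]
  congr 2
  have : (Finset.univ.filter fun i : Fin d => (i : ℕ) < d - 0) = Finset.univ := by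
    ext i; simp
  rw [this]
  simp

lemma isOpen_model {d : ℕ} : IsOpen (ModelDomain d 0) := by
  rw [modelDomain_eq]; exact isOpen_compl_singleton

lemma kIntegrand_nonneg {d : ℕ} {ρ : Ed d → ℝ} (hρ : ∀ x, 0 ≤ ρ x) (a p : ℝ) (α : Fin d → ℕ)
    (v : Ed d → ℝ) (x : Ed d) : 0 ≤ kIntegrand d ρ a p α v x := by
  unfold kIntegrand
  have := hρ x
  positivity

lemma rhoModel_nonneg {d : ℕ} (x : Ed d) : 0 ≤ rhoModel d 0 x := by
  rw [rhoModel_eq]; positivity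

lemma rhoModel_pos {d : ℕ} {x : Ed d} (hx : x ∈ ModelDomain d 0) : 0 < rhoModel d 0 x := by
  rw [modelDomain_eq] at hx
  rw [rhoModel_eq]
  have : 0 < ‖x‖ := norm_pos_iff.2 hx
  positivity

lemma continuous_rhoModel {d : ℕ} : Continuous (rhoModel d 0) := by
  rw [rhoModel_eq]; fun_prop

lemma KnormM_eq {d m : ℕ} {a p : ℝ} {u : Ed d → ℝ} {D : (Fin d → ℕ) → Ed d → ℝ}
    (h : KMemData d (ModelDomain d 0) (rhoModel d 0) m a p u D) :
    KnormM d 0 m a p u = KnormP d (ModelDomain d 0) (rhoModel d 0) m a p D :=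
  Knorm_eq isOpen_model h

lemma KnormM_nonneg {d m : ℕ} {a p : ℝ} {u : Ed d → ℝ} (h : MemKM d 0 m a p u) :
    0 ≤ KnormM d 0 m a p u := by
  obtain ⟨D, hD⟩ := h
  rw [KnormM_eq hD]
  unfold KnormP
  refine Real.rpow_nonneg (Finset.sum_nonneg fun α _ => ?_) _
  exact integral_nonneg fun x => kIntegrand_nonneg rhoModel_nonneg _ _ _ _ _

/-- Lower bound for the norm. -/
lemma KnormM_lower {d m : ℕ} {a p : ℝ} (hp : 1 ≤ p) {u : Ed d → ℝ} (h : MemKM d 0 m a p u)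
    {B : Set (Ed d)} (hB : MeasurableSet B) (hBΩ : B ⊆ ModelDomain d 0) {N : ℝ} (hN : 0 < N)
    (hu : ∀ x ∈ B, N ≤ u x) (hintg : IntegrableOn (kIntegrand d (rhoModel d 0) a p 0 1) B volume) :
    N * (∫ x in B, kIntegrand d (rhoModel d 0) a p 0 1 x) ^ (1 / p) ≤ KnormM d 0 m a p u := by
  obtain ⟨D, hD⟩ := h
  rw [KnormM_eq hD]
  have h0 : (0 : Fin d → ℕ) ∈ multiIdx d m := mem_multiIdx.2 (by simp)
  have hD0 := (wchain_of_family isOpen_model hD.1).2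
  have hnn : ∀ α v, 0 ≤ ∫ x in ModelDomain d 0, kIntegrand d (rhoModel d 0) a p α v x :=
    fun α v => integral_nonneg fun x => kIntegrand_nonneg rhoModel_nonneg _ _ _ _ _
  have hI : 0 ≤ ∫ x in B, kIntegrand d (rhoModel d 0) a p 0 1 x :=
    integral_nonneg fun x => kIntegrand_nonneg rhoModel_nonneg _ _ _ _ _
  unfold KnormP
  have hle : N ^ p * (∫ x in B, kIntegrand d (rhoModel d 0) a p 0 1 x) ≤
      ∑ α ∈ multiIdx d m, ∫ x in ModelDomain d 0, kIntegrand d (rhoModel d 0) a p α (D α) x := by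
    refine le_trans ?_ (Finset.single_le_sum (f := fun α => ∫ x in ModelDomain d 0, kIntegrand d (rhoModel d 0) a p α (D α) x) (fun α _ => hnn α _) h0)
    have h1 : ∫ x in B, kIntegrand d (rhoModel d 0) a p 0 (D 0) x ≤
      ∫ x in ModelDomain d 0, kIntegrand d (rhoModel d 0) a p 0 (D 0) x :=
      setIntegral_mono_set (hD.2 0 h0)
        (Eventually.of_forall fun x => kIntegrand_nonneg rhoModel_nonneg _ _ _ _ _)
        (Eventually.of_forall hBΩ)
    refine le_trans ?_ h1
    rw [← integral_const_mul]
    refine integral_mono_ae (hintg.const_mul _) ((hD.2 0 h0).mono_set hBΩ) ?_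
    have hD0' : D 0 =ᵐ[volume.restrict B] u := ae_restrict_of_ae_restrict_of_subset hBΩ hD0
    filter_upwards [hD0', ae_restrict_mem hB] with x hx hxB
    have hρ := rhoModel_nonneg x
    have := hu x hxB
    have h3 : 0 ≤ rhoModel d 0 x ^ (((∑ i : Fin d, (0 : Fin d → ℕ) i : ℕ) : ℝ) - a) := by positivity
    simp only [kIntegrand]
    rw [← Real.mul_rpow hN.le (by positivity), hx]
    apply Real.rpow_le_rpow (by positivity) _ (by linarith)
    simp only [Pi.one_apply, abs_one, mul_one]
    rw [mul_comm]
    gcongr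
    exact this.trans (le_abs_self _)
  calc N * (∫ x in B, kIntegrand d (rhoModel d 0) a p 0 1 x) ^ (1 / p)
      = (N ^ p * (∫ x in B, kIntegrand d (rhoModel d 0) a p 0 1 x)) ^ (1 / p) := by
        rw [Real.mul_rpow (by positivity) hI, ← Real.rpow_mul hN.le]
        rw [mul_one_div_cancel (by linarith), Real.rpow_one]
    _ ≤ _ := Real.rpow_le_rpow (by positivity) hle (by positivity)

/-- The algebra property forces an `L_∞` bound. -/
lemma algebra_sup {d m : ℕ} {a p : ℝ} (hp : 1 ≤ p)
    (h1 : ∀ u v : Ed d → ℝ, MemKM d 0 m a p u → MemKM d 0 m a p v → MemKM d 0 m a p (u * v))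
    {c : ℝ} (hc : 0 < c) (h2 : ∀ u v : Ed d → ℝ, MemKM d 0 m a p u → MemKM d 0 m a p v →
        KnormM d 0 m a p (u * v) ≤ c * KnormM d 0 m a p u * KnormM d 0 m a p v)
    {u : Ed d → ℝ} (hu : MemKM d 0 m a p u) {y : Ed d} {r : ℝ} (hr : 0 < r)
    (hB : closedBall y r ⊆ ModelDomain d 0) {N : ℝ} (hN : 0 < N)
    (huN : ∀ x ∈ closedBall y r, N ≤ u x) : N ≤ c * KnormM d 0 m a p u := by
  have hpow : ∀ n : ℕ, MemKM d 0 m a p (u ^ (n + 1)) ∧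
      KnormM d 0 m a p (u ^ (n + 1)) ≤ c ^ n * KnormM d 0 m a p u ^ (n + 1) := by
    intro n
    induction n with
    | zero => simpa using hu
    | succ n ih =>
      rw [pow_succ u (n + 1)]
      refine ⟨h1 _ _ ih.1 hu, (h2 _ _ ih.1 hu).trans ?_⟩
      have := KnormM_nonneg hu
      calc c * KnormM d 0 m a p (u ^ (n + 1)) * KnormM d 0 m a p u
          ≤ c * (c ^ n * KnormM d 0 m a p u ^ (n + 1)) * KnormM d 0 m a p u := by
            gcongr; exact ih.2
        _ = _ := by ring
  have hcont : ContinuousOn (kIntegrand d (rhoModel d 0) a p 0 1) (closedBall y r) := by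
    unfold kIntegrand
    intro x hx
    have := rhoModel_pos (hB hx)
    refine ContinuousAt.continuousWithinAt ?_
    refine ContinuousAt.rpow_const ?_ (Or.inr (by linarith))
    refine ContinuousAt.mul ?_ (by simp; fun_prop)
    exact ContinuousAt.rpow_const continuous_rhoModel.continuousAt (Or.inl this.ne')
  have hintg : IntegrableOn (kIntegrand d (rhoModel d 0) a p 0 1) (closedBall y r) volume :=
    hcont.integrableOn_compact (isCompact_closedBall y r)
  have hpos : 0 < ∫ x in closedBall y r, kIntegrand d (rhoModel d 0) a p 0 1 x := by
    rw [setIntegral_pos_iff_support_of_nonneg_ae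
      (Eventually.of_forall fun x => kIntegrand_nonneg rhoModel_nonneg _ _ _ _ _) hintg]
    refine lt_of_lt_of_le (measure_closedBall_pos volume y hr) (measure_mono ?_)
    intro x hx
    refine ⟨?_, hx⟩
    have := rhoModel_pos (hB hx)
    simp only [Function.mem_support, kIntegrand, Pi.one_apply, abs_one, mul_one]
    positivity
  set I := (∫ x in closedBall y r, kIntegrand d (rhoModel d 0) a p 0 1 x) ^ (1 / p) with hI
  have hIpos : 0 < I := by positivity
  by_contra hlt
  push Not at hlt
  have hK := KnormM_nonneg hu
  have hq : c * KnormM d 0 m a p u / N < 1 := (div_lt_one hN).2 hlt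
  have ht : Tendsto (fun n : ℕ => (c * KnormM d 0 m a p u / N) ^ (n + 1)) atTop (𝓝 0) :=
    (tendsto_pow_atTop_nhds_zero_of_lt_one (by positivity) hq).comp (tendsto_add_atTop_nat 1)
  have hb : ∀ n : ℕ, c * I ≤ (c * KnormM d 0 m a p u / N) ^ (n + 1) := by
    intro n
    have hl := KnormM_lower hp (hpow n).1 measurableSet_closedBall hB (pow_pos hN (n + 1))
      (fun x hx => by
        simp only [Pi.pow_apply]
        exact pow_le_pow_left₀ hN.le (huN x hx) _) hintg
    have := hl.trans (hpow n).2
    rw [div_pow, le_div_iff₀ (by positivity)]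
    calc c * I * N ^ (n + 1) = c * (N ^ (n + 1) * I) := by ring
      _ ≤ c * (c ^ n * KnormM d 0 m a p u ^ (n + 1)) := by gcongr
      _ = _ := by rw [mul_pow]; ring
  have := ge_of_tendsto' ht hb
  have : 0 < c * I := by positivity
  linarith

lemma clm_eq_sum {d : ℕ} (L : Ed d →L[ℝ] ℝ) :
    L = ∑ i, L (EuclideanSpace.single i 1) • (EuclideanSpace.proj i : Ed d →L[ℝ] ℝ) := by
  ext x
  have hx : x = ∑ i, x i • (EuclideanSpace.single i (1 : ℝ) : Ed d) := by
    ext j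
    simp [Pi.single_apply]
  conv_lhs => rw [hx]
  simp [mul_comm]

lemma jet_smooth {d m : ℕ} {f : Ed d → ℝ} (hf : Smth f) :
    IsJet d m univ (fun α => pderivA d α f) := by
  refine ⟨fun α _ => (pderivA_smooth α _ hf).continuous, fun α _ x _ => ?_⟩
  have h1 : DifferentiableAt ℝ (pderivA d α f) x :=
    ((pderivA_smooth α _ hf).differentiable (by simp)) x
  have h2 := h1.hasFDerivAt
  rw [clm_eq_sum (fderiv ℝ (pderivA d α f) x)] at h2
  refine h2.congr_fderiv (Finset.sum_congr rfl fun i _ => ?_)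
  beta_reduce
  rw [pderivA_succ _ _ _ hf]
  rfl

lemma jet_affine {d m : ℕ} {W : (Fin d → ℕ) → Ed d → ℝ} (h : IsJet d m univ W) (l : ℝ) (z : Ed d) :
    IsJet d m univ (fun α x => l ^ (∑ i, α i) * W α (l • x - z)) := by
  refine ⟨fun α hα => ?_, fun α hα x _ => ?_⟩
  · have := h.1 α hα
    fun_prop
  · have h1 := h.2 α hα (l • x - z) (mem_univ _)
    have h2 : HasFDerivAt (fun x : Ed d => l • x - z) (l • ContinuousLinearMap.id ℝ (Ed d)) x :=
      ((hasFDerivAt_id x).const_smul l).sub_const z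
    have h3 := (h1.comp x h2).const_mul (l ^ (∑ i, α i))
    refine h3.congr_fderiv ?_
    ext y
    simp only [sum_add_single, ContinuousLinearMap.sum_apply, ContinuousLinearMap.smul_apply,
      ContinuousLinearMap.comp_apply, ContinuousLinearMap.id_apply, smul_eq_mul, map_smul,
      Finset.mul_sum]
    refine Finset.sum_congr rfl fun i _ => ?_
    ring

lemma jet_sum {d m : ℕ} {ι : Type*} (S : Finset ι) {U : Set (Ed d)}
    {W : ι → (Fin d → ℕ) → Ed d → ℝ} (h : ∀ k ∈ S, IsJet d m U (W k)) :
    IsJet d m U (fun α x => ∑ k ∈ S, W k α x) := by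
  refine ⟨fun α hα => continuous_finset_sum _ fun k hk => (h k hk).1 α hα, fun α hα x hx => ?_⟩
  have := HasFDerivAt.fun_sum (fun k hk => (h k hk).2 α hα x hx)
  refine this.congr_fderiv ?_
  rw [Finset.sum_comm]
  refine Finset.sum_congr rfl fun i _ => ?_
  rw [Finset.sum_smul]

lemma kIntegrand_supp {d : ℕ} {ρ : Ed d → ℝ} {a p : ℝ} (hp : 1 ≤ p) {α : Fin d → ℕ}
    {v : Ed d → ℝ} {x : Ed d} (hv : v x = 0) : kIntegrand d ρ a p α v x = 0 := by
  simp [kIntegrand, hv, Real.zero_rpow (by linarith : p ≠ 0)]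

lemma jet_kdata {d m : ℕ} {a p : ℝ} (hp : 1 ≤ p) {W : (Fin d → ℕ) → Ed d → ℝ}
    (h : IsJet d m univ W) {K : Set (Ed d)} (hK : IsCompact K) (hKΩ : K ⊆ ModelDomain d 0)
    (hW : ∀ α x, x ∉ K → W α x = 0) :
    KMemData d (ModelDomain d 0) (rhoModel d 0) m a p (W 0) W := by
  have h' : IsJet d m (ModelDomain d 0) W := ⟨h.1, fun α hα x _ => h.2 α hα x (mem_univ _)⟩
  refine ⟨family_of_wchain (wchain_of_jet h') (EventuallyEq.refl _ _)
    ((h.1 0 (by simp)).locallyIntegrable.locallyIntegrableOn _), fun α hα => ?_⟩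
  have hc : ContinuousOn (kIntegrand d (rhoModel d 0) a p α (W α)) K := by
    intro x hx
    have := rhoModel_pos (hKΩ hx)
    have h2 := h.1 α (mem_multiIdx.1 hα)
    refine ContinuousAt.continuousWithinAt ?_
    refine ContinuousAt.rpow_const ?_ (Or.inr (by linarith))
    refine ContinuousAt.mul ?_ (by fun_prop)
    exact ContinuousAt.rpow_const continuous_rhoModel.continuousAt (Or.inl this.ne')
  have h3 := hc.integrableOn_compact (μ := volume) hK
  refine (h3.integrable_of_forall_notMem_eq_zero ?_).integrableOn
  intro x hx
  exact kIntegrand_supp hp (hW α x hx)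

lemma KnormM_jet_le {d m : ℕ} {a p : ℝ} (hp : 1 ≤ p) {W : (Fin d → ℕ) → Ed d → ℝ}
    (h : IsJet d m univ W) {K : Set (Ed d)} (hK : IsCompact K) (hKΩ : K ⊆ ModelDomain d 0)
    (hW : ∀ α x, x ∉ K → W α x = 0) {B : ℝ} (hB : 0 ≤ B) {C : (Fin d → ℕ) → ℝ}
    (hBK : ∀ α ∈ multiIdx d m, ∀ x ∈ K, rhoModel d 0 x ^ (((∑ i, α i : ℕ) : ℝ) - a) ≤ B * C α)
    (hC : ∀ α, 0 ≤ C α) :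
    KnormM d 0 m a p (W 0) ^ p ≤ B ^ p * ∑ α ∈ multiIdx d m, C α ^ p * ∫ x, |W α x| ^ p := by
  have hD := jet_kdata (a := a) hp h hK hKΩ hW
  rw [KnormM_eq hD]
  unfold KnormP
  rw [← Real.rpow_mul, one_div_mul_cancel (by linarith), Real.rpow_one]
  swap
  · exact Finset.sum_nonneg fun α _ => integral_nonneg fun x =>
      kIntegrand_nonneg rhoModel_nonneg _ _ _ _ _
  rw [Finset.mul_sum]
  refine Finset.sum_le_sum fun α hα => ?_
  have hi : Integrable (fun x => |W α x| ^ p) volume := by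
    have hc : Continuous (fun x => |W α x| ^ p) :=
      (h.1 α (mem_multiIdx.1 hα)).abs.rpow_const fun x => Or.inr (by linarith)
    refine (hc.continuousOn.integrableOn_compact hK).integrable_of_forall_notMem_eq_zero ?_
    intro x hx
    simp [hW α x hx, Real.zero_rpow (by linarith : p ≠ 0)]
  have hs : ∫ x in ModelDomain d 0, kIntegrand d (rhoModel d 0) a p α (W α) x =
      ∫ x, kIntegrand d (rhoModel d 0) a p α (W α) x := by
    refine setIntegral_eq_integral_of_forall_compl_eq_zero fun x hx => ?_
    exact kIntegrand_supp hp (hW α x fun hh => hx (hKΩ hh))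
  rw [hs, ← mul_assoc, ← integral_const_mul]
  refine integral_mono_of_nonneg (Eventually.of_forall fun x =>
      kIntegrand_nonneg rhoModel_nonneg _ _ _ _ _) (hi.const_mul _) ?_
  refine Eventually.of_forall fun x => ?_
  by_cases hx : x ∈ K
  · have h1 := hBK α hα x hx
    have h2 : 0 ≤ rhoModel d 0 x ^ (((∑ i, α i : ℕ) : ℝ) - a) :=
      Real.rpow_nonneg (rhoModel_nonneg x) _
    simp only [kIntegrand]
    rw [Real.mul_rpow h2 (abs_nonneg _), ← Real.mul_rpow hB (hC α)]
    gcongr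
  · simp [kIntegrand_supp hp (hW α x hx), hW α x hx, Real.zero_rpow (by linarith : p ≠ 0)]

lemma integral_affine {d : ℕ} (f : Ed d → ℝ) {l : ℝ} (hl : 0 < l) (z : Ed d) :
    ∫ x, f (l • x - z) = l ^ (-(d : ℝ)) * ∫ x, f x := by
  have h1 : ∫ x, f (l • x - z) = ∫ x, (fun y => f (y - z)) (l • x) := rfl
  rw [h1, Measure.integral_comp_smul volume (fun y => f (y - z)) l, integral_sub_right_eq_self f z]
  simp only [finrank_euclideanSpace, Fintype.card_fin, smul_eq_mul]
  rw [abs_of_pos (by positivity), Real.rpow_neg hl.le, Real.rpow_natCast]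

/-- the bump used for the counterexamples -/
def cexBump (d : ℕ) : ContDiffBump (0 : Ed d) := ⟨1 / 2, 1, by norm_num, by norm_num⟩

def cexJ (d : ℕ) (α : Fin d → ℕ) : Ed d → ℝ := pderivA d α (cexBump d)

lemma cex_smooth (d : ℕ) : Smth (cexBump d : Ed d → ℝ) := (cexBump d).contDiff

lemma cexJ_supp {d : ℕ} (α : Fin d → ℕ) {y : Ed d} (hy : cexJ d α y ≠ 0) : ‖y‖ ≤ 1 := by
  have h1 : y ∈ tsupport (cexJ d α) := subset_tsupport _ hy
  have h2 := pderivA_tsupport α (cexBump d : Ed d → ℝ) h1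
  rw [(cexBump d).tsupport_eq] at h2
  simpa [cexBump] using h2

lemma cexJ_zero {d : ℕ} : cexJ d 0 = cexBump d := pderivA_zero _

lemma cexJ_supp' {d : ℕ} (α : Fin d → ℕ) (hα : α ≠ 0) {y : Ed d} (hy : cexJ d α y ≠ 0) :
    1 / 2 ≤ ‖y‖ := by
  by_contra hlt
  push Not at hlt
  obtain ⟨n, hn⟩ : ∃ n, ∑ i, α i = n + 1 := by
    refine Nat.exists_eq_succ_of_ne_zero ?_
    intro h0
    apply hα
    ext i
    exact (Finset.sum_eq_zero_iff.1 h0) i (Finset.mem_univ _)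
  obtain ⟨β, i, rfl, -⟩ := exists_pred α n hn
  apply hy
  unfold cexJ
  rw [pderivA_succ' _ _ _ (cex_smooth d)]
  refine image_eq_zero_of_notMem_tsupport fun hmem => ?_
  have h3 := pderivA_tsupport β _ hmem
  have h4 : pderivI d i (cexBump d) =ᶠ[𝓝 y] 0 := by
    have : (cexBump d : Ed d → ℝ) =ᶠ[𝓝 y] fun _ => 1 := by
      have := (cexBump d).eventuallyEq_one_of_mem_ball (x := y) (by simpa [cexBump] using hlt)
      exact this
    filter_upwards [this.eventuallyEq_nhds] with z hz
    simp [pderivI, hz.fderiv_eq]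
  exact (notMem_tsupport_iff_eventuallyEq.2 h4) h3

lemma cex_one {d : ℕ} {y : Ed d} (hy : ‖y‖ ≤ 1 / 2) : cexBump d y = 1 := by
  apply (cexBump d).one_of_mem_closedBall
  simpa [cexBump] using hy

def cexC (d : ℕ) (p : ℝ) (α : Fin d → ℕ) : ℝ := ∫ x, |cexJ d α x| ^ p

lemma cexC_nonneg (d : ℕ) (p : ℝ) (α : Fin d → ℕ) : 0 ≤ cexC d p α :=
  integral_nonneg fun x => by positivity

def cexAtom (d : ℕ) (l : ℝ) (z : Ed d) (α : Fin d → ℕ) (x : Ed d) : ℝ :=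
  l ^ (∑ i, α i) * cexJ d α (l • x - z)

lemma cexAtom_jet (d m : ℕ) (l : ℝ) (z : Ed d) : IsJet d m univ (cexAtom d l z) :=
  jet_affine (jet_smooth (cex_smooth d)) l z

lemma cexAtom_int {d : ℕ} {p : ℝ} {l : ℝ} (hl : 0 < l) (z : Ed d) (α : Fin d → ℕ) :
    ∫ x, |cexAtom d l z α x| ^ p = l ^ (((∑ i, α i : ℕ) : ℝ) * p - d) * cexC d p α := by
  have h1 : ∀ x, |cexAtom d l z α x| ^ p =
      l ^ (((∑ i, α i : ℕ) : ℝ) * p) * (fun y => |cexJ d α y| ^ p) (l • x - z) := by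
    intro x
    simp only [cexAtom]
    rw [abs_mul, Real.mul_rpow (by positivity) (by positivity), abs_of_pos (by positivity),
      Real.rpow_mul hl.le, Real.rpow_natCast]
  simp_rw [h1]
  rw [integral_const_mul, integral_affine (fun y => |cexJ d α y| ^ p) hl z, ← mul_assoc, ← Real.rpow_add hl]
  rfl

/-- necessity of `a ≥ d/p` -/
lemma nec_a {d m : ℕ} (hd : 2 ≤ d) {a p : ℝ} (hp : 1 ≤ p)
    (h1 : ∀ u v : Ed d → ℝ, MemKM d 0 m a p u → MemKM d 0 m a p v → MemKM d 0 m a p (u * v))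
    {c : ℝ} (hc : 0 < c) (h2 : ∀ u v : Ed d → ℝ, MemKM d 0 m a p u → MemKM d 0 m a p v →
        KnormM d 0 m a p (u * v) ≤ c * KnormM d 0 m a p u * KnormM d 0 m a p v) :
    d ≤ a * p := by
  by_contra hlt
  push Not at hlt
  let x0 : Ed d := EuclideanSpace.single ⟨0, by omega⟩ 2
  have hx0 : ‖x0‖ = 2 := by simp [x0]
  -- constant
  let Cs : ℝ := c ^ p * ((3 ^ ((m : ℝ) + |a|)) ^ p * ∑ α ∈ multiIdx d m, cexC d p α)
  have key : ∀ l : ℝ, 3 ≤ l → 1 ≤ Cs * l ^ (a * p - d) := by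
    intro l hl
    have hl0 : 0 < l := by linarith
    let K : Set (Ed d) := closedBall (l⁻¹ • x0) l⁻¹
    have hK : ∀ x, x ∈ K ↔ ‖l • x - x0‖ ≤ 1 := by
      intro x
      have : l • x - x0 = l • (x - l⁻¹ • x0) := by
        rw [smul_sub, smul_inv_smul₀ hl0.ne']
      rw [this, norm_smul, Real.norm_of_nonneg hl0.le, mem_closedBall, dist_eq_norm, ← one_div,
        le_div_iff₀ hl0, mul_comm]
    have hKn : ∀ x ∈ K, 1 ≤ l * ‖x‖ ∧ l * ‖x‖ ≤ 3 := by
      intro x hx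
      rw [hK] at hx
      have e1 : ‖l • x‖ = l * ‖x‖ := by rw [norm_smul, Real.norm_of_nonneg hl0.le]
      have t1 := norm_sub_norm_le x0 (l • x)
      have t2 := norm_sub_norm_le (l • x) x0
      rw [norm_sub_rev] at t1
      rw [← e1]
      constructor <;> linarith
    have hKΩ : K ⊆ ModelDomain d 0 := by
      intro x hx
      rw [modelDomain_eq]
      rintro rfl
      have := (hKn _ hx).1
      simp at this
      linarith
    have hW : ∀ α x, x ∉ K → cexAtom d l x0 α x = 0 := by
      intro α x hx
      by_contra hne
      exact hx ((hK x).2 (cexJ_supp α (right_ne_zero_of_mul hne)))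
    have hρ : ∀ x ∈ K, rhoModel d 0 x = ‖x‖ := by
      intro x hx
      rw [rhoModel_eq]
      refine min_eq_right ?_
      have := (hKn x hx).2
      nlinarith [norm_nonneg x]
    have hB : ∀ α ∈ multiIdx d m, ∀ x ∈ K, rhoModel d 0 x ^ (((∑ i, α i : ℕ) : ℝ) - a) ≤
        3 ^ ((m : ℝ) + |a|) * l ^ (a - ((∑ i, α i : ℕ) : ℝ)) := by
      intro α hα x hx
      have hα' : ((∑ i, α i : ℕ) : ℝ) ≤ m := by exact_mod_cast mem_multiIdx.1 hα
      set s : ℝ := ((∑ i, α i : ℕ) : ℝ) with hs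
      have hs0 : 0 ≤ s := by positivity
      rw [hρ x hx]
      have e : ‖x‖ = l⁻¹ * (l * ‖x‖) := by field_simp
      have hn := hKn x hx
      rw [e, Real.mul_rpow (by positivity) (by linarith), Real.inv_rpow hl0.le,
        ← Real.rpow_neg hl0.le, neg_sub, mul_comm]
      gcongr
      rcases le_total 0 (s - a) with h | h
      · calc (l * ‖x‖) ^ (s - a) ≤ 3 ^ (s - a) := by
              apply Real.rpow_le_rpow (by linarith) hn.2 h
          _ ≤ 3 ^ ((m : ℝ) + |a|) := by
              apply Real.rpow_le_rpow_of_exponent_le (by norm_num)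
              linarith [neg_abs_le a]
      · calc (l * ‖x‖) ^ (s - a) ≤ 1 := Real.rpow_le_one_of_one_le_of_nonpos hn.1 h
          _ ≤ 3 ^ ((m : ℝ) + |a|) := Real.one_le_rpow (by norm_num) (by positivity)
    have hN := KnormM_jet_le hp (cexAtom_jet d m l x0) (isCompact_closedBall _ _) hKΩ hW
      (by positivity) hB (fun α => by positivity)
    have hmem : MemKM d 0 m a p (cexAtom d l x0 0) := ⟨_, jet_kdata hp (cexAtom_jet d m l x0)
      (isCompact_closedBall _ _) hKΩ hW⟩
    have hsup := algebra_sup hp h1 hc h2 hmem (y := l⁻¹ • x0) (r := l⁻¹ / 2) (by positivity)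
      ((closedBall_subset_closedBall (by linarith [inv_pos.2 hl0])).trans hKΩ) (N := 1) one_pos
      (by
        intro x hx
        have : l • x - x0 = l • (x - l⁻¹ • x0) := by
          rw [smul_sub, smul_inv_smul₀ hl0.ne']
        have h3 : ‖l • x - x0‖ ≤ 1 / 2 := by
          rw [this, norm_smul, Real.norm_of_nonneg hl0.le]
          rw [mem_closedBall, dist_eq_norm] at hx
          calc l * ‖x - l⁻¹ • x0‖ ≤ l * (l⁻¹ / 2) := by gcongr
            _ = 1 / 2 := by field_simp
        simp [cexAtom, cexJ_zero, cex_one h3])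
    have hnn := KnormM_nonneg hmem
    have h5 : (1 : ℝ) ≤ (c * KnormM d 0 m a p (cexAtom d l x0 0)) ^ p :=
      Real.one_le_rpow hsup (by linarith)
    rw [Real.mul_rpow hc.le hnn] at h5
    refine h5.trans ?_
    simp only [Cs]
    rw [mul_assoc]
    gcongr
    refine hN.trans (le_of_eq ?_)
    rw [mul_assoc]
    congr 1
    rw [Finset.sum_mul]
    refine Finset.sum_congr rfl fun α _ => ?_
    rw [cexAtom_int hl0, ← mul_assoc, ← Real.rpow_mul hl0.le, ← Real.rpow_add hl0, mul_comm]
    congr 2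
    ring
  have ht : Tendsto (fun l : ℝ => Cs * l ^ (a * p - d)) atTop (𝓝 (Cs * 0)) := by
    have := tendsto_rpow_neg_atTop (y := d - a * p) (by linarith)
    simp only [neg_sub] at this
    exact this.const_mul Cs
  rw [mul_zero] at ht
  have h6 := ge_of_tendsto ht (eventually_atTop.2 ⟨3, key⟩)
  linarith

/-- The second family of counterexamples. -/
lemma nec_fam {d m : ℕ} (hd : 2 ≤ d) {a p : ℝ} (hp : 1 ≤ p)
    (h1 : ∀ u v : Ed d → ℝ, MemKM d 0 m a p u → MemKM d 0 m a p v → MemKM d 0 m a p (u * v))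
    {c : ℝ} (hc : 0 < c) (h2 : ∀ u v : Ed d → ℝ, MemKM d 0 m a p u → MemKM d 0 m a p v →
        KnormM d 0 m a p (u * v) ≤ c * KnormM d 0 m a p u * KnormM d 0 m a p v) :
    ∃ C : ℝ, 0 ≤ C ∧ ∀ S : Finset ℕ, S.Nonempty → (S.card : ℝ) ^ p ≤
      C * ((S.card : ℝ) ^ (p - 1) * ∑ k ∈ S, ((4 : ℝ) ^ k) ^ (-(d : ℝ)) +
        ∑ k ∈ S, ((4 : ℝ) ^ k) ^ (m * p - d)) := by
  let x0 : Ed d := EuclideanSpace.single ⟨0, by omega⟩ 2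
  have hx0 : ‖x0‖ = 2 := by simp [x0]
  refine ⟨c ^ p * ∑ α ∈ multiIdx d m, cexC d p α, ?_, fun S hS => ?_⟩
  · have : 0 ≤ ∑ α ∈ multiIdx d m, cexC d p α := Finset.sum_nonneg fun α _ => cexC_nonneg d p α
    positivity
  let W : (Fin d → ℕ) → Ed d → ℝ := fun α x => ∑ k ∈ S, cexAtom d (4 ^ k) ((4 : ℝ) ^ k • x0) α x
  have hjet : IsJet d m univ W := jet_sum S fun k _ => cexAtom_jet d m _ _
  let K : Set (Ed d) := closedBall x0 1
  have hsub : ∀ k : ℕ, ∀ x : Ed d, ‖(4 : ℝ) ^ k • x - (4 : ℝ) ^ k • x0‖ = 4 ^ k * ‖x - x0‖ := by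
    intro k x
    rw [← smul_sub, norm_smul, Real.norm_of_nonneg (by positivity)]
  have h4 : ∀ k : ℕ, (1 : ℝ) ≤ 4 ^ k := fun k => one_le_pow₀ (by norm_num)
  have hW : ∀ α x, x ∉ K → W α x = 0 := by
    intro α x hx
    refine Finset.sum_eq_zero fun k _ => ?_
    by_contra hne
    have := cexJ_supp α (right_ne_zero_of_mul hne)
    rw [hsub] at this
    apply hx
    rw [mem_closedBall, dist_eq_norm]
    nlinarith [h4 k, norm_nonneg (x - x0)]
  have hKn : ∀ x ∈ K, 1 ≤ ‖x‖ := by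
    intro x hx
    rw [mem_closedBall, dist_eq_norm] at hx
    have := norm_sub_norm_le x0 x
    rw [norm_sub_rev] at this
    linarith
  have hKΩ : K ⊆ ModelDomain d 0 := by
    intro x hx
    rw [modelDomain_eq]
    rintro rfl
    have := hKn _ hx
    simp at this
    linarith
  have hρ : ∀ x ∈ K, rhoModel d 0 x = 1 := by
    intro x hx
    rw [rhoModel_eq]
    exact min_eq_left (hKn x hx)
  have hN := KnormM_jet_le (a := a) hp hjet (isCompact_closedBall _ _) hKΩ hW
      (B := 1) (C := fun _ => 1) (by positivity) (fun α _ x hx => by simp [hρ x hx])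
      (fun α => by positivity)
  simp only [Real.one_rpow, one_mul] at hN
  have hmem : MemKM d 0 m a p (W 0) := ⟨_, jet_kdata hp hjet (isCompact_closedBall _ _) hKΩ hW⟩
  have hcard : 0 < (S.card : ℝ) := by exact_mod_cast hS.card_pos
  obtain ⟨M, hM⟩ : ∃ M : ℕ, ∀ k ∈ S, k ≤ M := ⟨S.sup id, fun k hk => Finset.le_sup (f := id) hk⟩
  have hsup := algebra_sup hp h1 hc h2 hmem (y := x0) (r := (4 ^ M)⁻¹ / 2) (by positivity)
      ((closedBall_subset_closedBall (by
        have := inv_le_one_of_one_le₀ (h4 M)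
        linarith)).trans hKΩ) (N := S.card) hcard
      (by
        intro x hx
        have : W 0 x = ∑ k ∈ S, (1 : ℝ) := by
          refine Finset.sum_congr rfl fun k hk => ?_
          have h3 : ‖(4 : ℝ) ^ k • x - (4 : ℝ) ^ k • x0‖ ≤ 1 / 2 := by
            rw [hsub]
            rw [mem_closedBall, dist_eq_norm] at hx
            calc 4 ^ k * ‖x - x0‖ ≤ 4 ^ M * ((4 ^ M)⁻¹ / 2) := by
                  gcongr
                  · norm_num
                  · exact hM k hk
              _ = 1 / 2 := by field_simp
          simp [cexAtom, cexJ_zero, cex_one h3]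
        rw [this]; simp)
  have hnn := KnormM_nonneg hmem
  have h5 : (S.card : ℝ) ^ p ≤ (c * KnormM d 0 m a p (W 0)) ^ p :=
    Real.rpow_le_rpow hcard.le hsup (by linarith)
  rw [Real.mul_rpow hc.le hnn] at h5
  refine h5.trans ?_
  rw [mul_assoc]
  gcongr
  refine hN.trans ?_
  rw [Finset.sum_mul]
  refine Finset.sum_le_sum fun α hα => ?_
  have hα' : ((∑ i, α i : ℕ) : ℝ) ≤ m := by exact_mod_cast mem_multiIdx.1 hα
  have hCα := cexC_nonneg d p α
  have hintg : ∀ k ∈ S, Integrable (fun x => |cexAtom d (4 ^ k) ((4 : ℝ) ^ k • x0) α x| ^ p) := by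
    intro k _
    have hc : Continuous (fun x => |cexAtom d (4 ^ k) ((4 : ℝ) ^ k • x0) α x| ^ p) :=
      ((cexAtom_jet d m _ _).1 α (mem_multiIdx.1 hα)).abs.rpow_const fun x => Or.inr (by linarith)
    refine (hc.continuousOn.integrableOn_compact
      (isCompact_closedBall x0 1)).integrable_of_forall_notMem_eq_zero ?_
    intro x hx
    have : cexAtom d (4 ^ k) ((4 : ℝ) ^ k • x0) α x = 0 := by
      by_contra hne
      have := cexJ_supp α (right_ne_zero_of_mul hne)
      rw [hsub] at this
      apply hx
      rw [mem_closedBall, dist_eq_norm]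
      nlinarith [h4 k, norm_nonneg (x - x0)]
    simp [this, Real.zero_rpow (by linarith : p ≠ 0)]
  have hsum : ∀ k : ℕ, ∫ x, |cexAtom d (4 ^ k) ((4 : ℝ) ^ k • x0) α x| ^ p =
      ((4 : ℝ) ^ k) ^ (((∑ i, α i : ℕ) : ℝ) * p - d) * cexC d p α :=
    fun k => cexAtom_int (by positivity) _ _
  by_cases h0 : α = 0
  · have hb : ∫ x, |W α x| ^ p ≤ (S.card : ℝ) ^ (p - 1) * ∑ k ∈ S, ∫ x,
        |cexAtom d (4 ^ k) ((4 : ℝ) ^ k • x0) α x| ^ p := by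
      rw [← integral_finset_sum _ hintg, ← integral_const_mul]
      refine integral_mono_of_nonneg (Eventually.of_forall fun x => by positivity)
        ((integrable_finset_sum _ hintg).const_mul _) (Eventually.of_forall fun x => ?_)
      have t1 := Real.rpow_sum_le_const_mul_sum_rpow S
        (fun k => cexAtom d (4 ^ k) ((4 : ℝ) ^ k • x0) α x) hp
      refine le_trans ?_ t1
      refine Real.rpow_le_rpow (abs_nonneg _) (Finset.abs_sum_le_sum_abs _ _) (by linarith)
    refine hb.trans ?_
    simp_rw [hsum, ← Finset.sum_mul]
    subst h0
    rw [← mul_assoc, mul_comm]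
    gcongr
    simp only [Pi.zero_apply, Finset.sum_const_zero, Nat.cast_zero, zero_mul, zero_sub]
    have : 0 ≤ ∑ k ∈ S, ((4 : ℝ) ^ k) ^ (m * p - d) := by positivity
    linarith
  · have hb : ∫ x, |W α x| ^ p ≤ ∑ k ∈ S, ∫ x,
        |cexAtom d (4 ^ k) ((4 : ℝ) ^ k • x0) α x| ^ p := by
      rw [← integral_finset_sum _ hintg]
      refine integral_mono_of_nonneg (Eventually.of_forall fun x => by positivity)
        ((integrable_finset_sum _ hintg)) (Eventually.of_forall fun x => ?_)
      by_cases hx : ∃ k ∈ S, cexAtom d (4 ^ k) ((4 : ℝ) ^ k • x0) α x ≠ 0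
      · obtain ⟨k, hk, hne⟩ := hx
        have : W α x = cexAtom d (4 ^ k) ((4 : ℝ) ^ k • x0) α x := by
          refine Finset.sum_eq_single_of_mem k hk fun j _ hj => ?_
          by_contra hne'
          have a1 := cexJ_supp α (right_ne_zero_of_mul hne)
          have a2 := cexJ_supp' α h0 (right_ne_zero_of_mul hne)
          have b1 := cexJ_supp α (right_ne_zero_of_mul hne')
          have b2 := cexJ_supp' α h0 (right_ne_zero_of_mul hne')
          rw [hsub] at a1 a2 b1 b2
          have hq : ∀ i j : ℕ, i < j → (4 : ℝ) * 4 ^ i ≤ 4 ^ j := by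
            intro i j hij
            rw [← pow_succ']
            exact pow_le_pow_right₀ (by norm_num) hij
          rcases lt_or_gt_of_ne hj with hlt | hlt
          · nlinarith [hq _ _ hlt, norm_nonneg (x - x0)]
          · nlinarith [hq _ _ hlt, norm_nonneg (x - x0)]
        simp only [this]
        exact Finset.single_le_sum
          (f := fun k => |cexAtom d (4 ^ k) ((4 : ℝ) ^ k • x0) α x| ^ p)
          (fun i _ => by positivity) hk
      · push Not at hx
        have : W α x = 0 := Finset.sum_eq_zero hx
        simp only [this, abs_zero]
        rw [Real.zero_rpow (by linarith)]
        exact Finset.sum_nonneg fun i _ => by positivity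
    refine hb.trans ?_
    simp_rw [hsum, ← Finset.sum_mul]
    rw [mul_comm]
    gcongr
    have t1 : ∑ k ∈ S, ((4 : ℝ) ^ k) ^ (((∑ i, α i : ℕ) : ℝ) * p - d) ≤
        ∑ k ∈ S, ((4 : ℝ) ^ k) ^ (m * p - d) := by
      refine Finset.sum_le_sum fun k _ => ?_
      refine Real.rpow_le_rpow_of_exponent_le (h4 k) ?_
      gcongr
    have : 0 ≤ (S.card : ℝ) ^ (p - 1) * ∑ k ∈ S, ((4 : ℝ) ^ k) ^ (-(d : ℝ)) := by positivity
    linarith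

lemma necessity {d m : ℕ} (hd : 2 ≤ d) {a p : ℝ} (hp : 1 ≤ p)
    (h1 : ∀ u v : Ed d → ℝ, MemKM d 0 m a p u → MemKM d 0 m a p v → MemKM d 0 m a p (u * v))
    {c : ℝ} (hc : 0 < c) (h2 : ∀ u v : Ed d → ℝ, MemKM d 0 m a p u → MemKM d 0 m a p v →
        KnormM d 0 m a p (u * v) ≤ c * KnormM d 0 m a p u * KnormM d 0 m a p v) :
    (d : ℝ) / p ≤ a ∧ ((1 < p ∧ (d : ℝ) / p < m) ∨ (p = 1 ∧ d ≤ m)) := by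
  have hp0 : 0 < p := by linarith
  have ha := nec_a hd hp h1 hc h2
  refine ⟨(div_le_iff₀ hp0).2 ha, ?_⟩
  obtain ⟨C, hC, hS⟩ := nec_fam hd hp h1 hc h2
  have hd0 : (2 : ℝ) ≤ d := by exact_mod_cast hd
  have hge : (d : ℝ) ≤ m * p := by
    by_contra hlt
    push Not at hlt
    have key : ∀ k : ℕ, (1 : ℝ) ≤
        C * (((4 : ℝ) ^ k) ^ (-(d : ℝ)) + ((4 : ℝ) ^ k) ^ (-((d : ℝ) - m * p))) := by
      intro k
      have := hS {k} (by simp)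
      simpa using this
    have t4 : Tendsto (fun k : ℕ => (4 : ℝ) ^ k) atTop atTop :=
      tendsto_pow_atTop_atTop_of_one_lt (by norm_num)
    have ta := (tendsto_rpow_neg_atTop (y := (d : ℝ)) (by linarith)).comp t4
    have tb := (tendsto_rpow_neg_atTop (y := (d : ℝ) - m * p) (by linarith)).comp t4
    have := ge_of_tendsto' ((ta.add tb).const_mul C) key
    simp at this
    linarith
  rcases hp.lt_or_eq with hp1 | hp1
  · left
    refine ⟨hp1, ?_⟩
    rw [div_lt_iff₀ hp0]
    refine lt_of_le_of_ne hge fun heq => ?_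
    have hgeo : ∀ N : ℕ, ∑ k ∈ Finset.range N, ((4 : ℝ) ^ k) ^ (-(d : ℝ)) ≤ 2 := by
      intro N
      calc ∑ k ∈ Finset.range N, ((4 : ℝ) ^ k) ^ (-(d : ℝ))
          ≤ ∑ k ∈ Finset.range N, (1 / 2 : ℝ) ^ k := by
            refine Finset.sum_le_sum fun k _ => ?_
            have h4 : (1 : ℝ) ≤ 4 ^ k := one_le_pow₀ (by norm_num)
            calc ((4 : ℝ) ^ k) ^ (-(d : ℝ)) ≤ ((4 : ℝ) ^ k) ^ (-1 : ℝ) :=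
                  Real.rpow_le_rpow_of_exponent_le h4 (by linarith)
              _ = (1 / 4 : ℝ) ^ k := by rw [Real.rpow_neg_one, one_div, inv_pow]
              _ ≤ (1 / 2 : ℝ) ^ k := by gcongr; norm_num
        _ ≤ 2 := sum_geometric_two_le N
    have key : ∀ N : ℕ, (1 : ℝ) ≤ C * (2 * ((N : ℝ) + 1) ^ (-(1 : ℝ)) + ((N : ℝ) + 1) ^ (-(p - 1))) := by
      intro N
      have h3 := hS (Finset.range (N + 1)) (by simp)
      have hn : (0 : ℝ) < (N : ℝ) + 1 := by positivity
      simp only [Finset.card_range, ← heq, sub_self, Real.rpow_zero, Finset.sum_const,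
        nsmul_eq_mul, mul_one] at h3
      push_cast at h3
      have h4 : ((N : ℝ) + 1) ^ p ≤ C * (((N : ℝ) + 1) ^ (p - 1) * 2 + (N + 1)) := by
        refine h3.trans ?_
        gcongr
        exact hgeo _
      have h5 : 0 < ((N : ℝ) + 1) ^ (-p) := by positivity
      have h6 := mul_le_mul_of_nonneg_left h4 h5.le
      rw [← Real.rpow_add hn, neg_add_cancel, Real.rpow_zero] at h6
      refine h6.trans (le_of_eq ?_)
      have e1 : ((N : ℝ) + 1) ^ (-(1 : ℝ)) = ((N : ℝ) + 1) ^ (-p) * ((N : ℝ) + 1) ^ (p - 1) := by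
        rw [← Real.rpow_add hn]; congr 1; ring
      have e2 : ((N : ℝ) + 1) ^ (-(p - 1)) = ((N : ℝ) + 1) ^ (-p) * ((N : ℝ) + 1) := by
        nth_rewrite 3 [← Real.rpow_one ((N : ℝ) + 1)]
        rw [← Real.rpow_add hn]; congr 1; ring
      rw [e1, e2]
      ring
    have t4 : Tendsto (fun k : ℕ => (k : ℝ) + 1) atTop atTop :=
      tendsto_atTop_add_const_right _ _ tendsto_natCast_atTop_atTop
    have ta := (tendsto_rpow_neg_atTop (y := (1 : ℝ)) (by linarith)).comp t4
    have tb := (tendsto_rpow_neg_atTop (y := p - 1) (by linarith)).comp t4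
    have := ge_of_tendsto' (((ta.const_mul 2).add tb).const_mul C) key
    simp at this
    linarith
  · right
    refine ⟨hp1.symm, ?_⟩
    rw [← hp1, mul_one] at hge
    exact_mod_cast hge

lemma rho_le_one {d : ℕ} (x : Ed d) : rhoModel d 0 x ≤ 1 := by
  rw [rhoModel_eq]; exact min_le_left _ _

lemma rho_lip {d : ℕ} (x y : Ed d) : rhoModel d 0 x ≤ rhoModel d 0 y + ‖y - x‖ := by
  rw [rhoModel_eq]
  have h1 := norm_sub_norm_le x y
  rw [norm_sub_rev] at h1
  have h3 : 0 ≤ ‖y - x‖ := norm_nonneg _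
  simp only
  rcases le_total 1 ‖y‖ with h | h
  · rw [min_eq_left h]
    linarith [min_le_left 1 ‖x‖]
  · rw [min_eq_right h]
    linarith [min_le_right 1 ‖x‖]

lemma rho_slow {d : ℕ} {x y : Ed d} (h : ‖y - x‖ ≤ rhoModel d 0 x / 2) :
    rhoModel d 0 x ≤ 2 * rhoModel d 0 y ∧ rhoModel d 0 y ≤ 2 * rhoModel d 0 x := by
  have h1 := rho_lip x y
  have h2 := rho_lip y x
  rw [norm_sub_rev] at h2
  have := rhoModel_nonneg x
  constructor <;> linarith

lemma rpow_slow {s t c b : ℝ} (hs : 0 < s) (ht : 0 < t) (h1 : s ≤ 2 * t) (h2 : t ≤ 2 * s)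
    (hc : |c| ≤ b) : s ^ c ≤ 2 ^ b * t ^ c := by
  have hb : (2 : ℝ) ^ |c| ≤ 2 ^ b := Real.rpow_le_rpow_of_exponent_le (by norm_num) hc
  refine le_trans ?_ (mul_le_mul_of_nonneg_right hb (by positivity))
  rcases le_total 0 c with h | h
  · rw [abs_of_nonneg h, ← Real.mul_rpow (by norm_num) ht.le]
    exact Real.rpow_le_rpow hs.le h1 h
  · rw [abs_of_nonpos h]
    have : t / 2 ≤ s := by linarith
    calc s ^ c ≤ (t / 2) ^ c := Real.rpow_le_rpow_of_nonpos (by positivity) this h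
      _ = 2 ^ (-c) * t ^ c := by
        rw [Real.div_rpow ht.le (by norm_num), Real.rpow_neg (by norm_num)]
        field_simp

/-- Weighted one-dimensional integral. -/
def AI (s k : ℕ) (f : ℝ → ℝ) : ℝ := ∫ t in (0 : ℝ)..1, t ^ s * (1 - t) ^ k * f t

lemma AI_step {f f' : ℝ → ℝ} (hf : Continuous f) (hf' : Continuous f')
    (hd : ∀ t ∈ Icc (0 : ℝ) 1, HasDerivAt f (f' t) t) (s k : ℕ) :
    (s + 1) * AI s (k + 1) f = (k + 1) * AI (s + 1) k f - AI (s + 1) (k + 1) f' := by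
  have h1 : ∀ t ∈ uIcc (0 : ℝ) 1, HasDerivAt (fun t => t ^ (s + 1) * (1 - t) ^ (k + 1) * f t)
      ((s + 1) * (t ^ s * (1 - t) ^ (k + 1) * f t) - (k + 1) * (t ^ (s + 1) * (1 - t) ^ k * f t)
        + t ^ (s + 1) * (1 - t) ^ (k + 1) * f' t) t := by
    intro t ht
    rw [uIcc_of_le zero_le_one] at ht
    have a1 : HasDerivAt (fun t : ℝ => t ^ (s + 1)) ((s + 1 : ℕ) * t ^ s) t := by
      simpa using hasDerivAt_pow (s + 1) t
    have a2 : HasDerivAt (fun t : ℝ => (1 - t) ^ (k + 1)) ((k + 1 : ℕ) * (1 - t) ^ k * (-1)) t := by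
      exact (((hasDerivAt_id t).const_sub 1).fun_pow (k + 1)).congr_deriv (by simp)
    have := (a1.mul a2).mul (hd t ht)
    refine this.congr_deriv ?_
    simp only [Pi.mul_apply]
    push_cast
    ring
  have h2 := intervalIntegral.integral_eq_sub_of_hasDerivAt h1
    (Continuous.intervalIntegrable (by fun_prop) _ _)
  rw [intervalIntegral.integral_add (Continuous.intervalIntegrable (by fun_prop) _ _)
    (Continuous.intervalIntegrable (by fun_prop) _ _), intervalIntegral.integral_sub
    (Continuous.intervalIntegrable (by fun_prop) _ _)
    (Continuous.intervalIntegrable (by fun_prop) _ _), intervalIntegral.integral_const_mul,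
    intervalIntegral.integral_const_mul] at h2
  simp at h2
  unfold AI
  linarith

lemma AI_start {f f' : ℝ → ℝ} (hf : Continuous f) (hf' : Continuous f')
    (hd : ∀ t ∈ Icc (0 : ℝ) 1, HasDerivAt f (f' t) t) (k : ℕ) :
    f 0 = (k + 1) * AI 0 k f - AI 0 (k + 1) f' := by
  have h1 : ∀ t ∈ uIcc (0 : ℝ) 1, HasDerivAt (fun t => (1 - t) ^ (k + 1) * f t)
      (- ((k + 1) * (t ^ 0 * (1 - t) ^ k * f t))
        + t ^ 0 * (1 - t) ^ (k + 1) * f' t) t := by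
    intro t ht
    rw [uIcc_of_le zero_le_one] at ht
    have a2 : HasDerivAt (fun t : ℝ => (1 - t) ^ (k + 1)) ((k + 1 : ℕ) * (1 - t) ^ k * (-1)) t := by
      exact (((hasDerivAt_id t).const_sub 1).fun_pow (k + 1)).congr_deriv (by simp)
    have := a2.mul (hd t ht)
    refine this.congr_deriv ?_
    push_cast
    ring
  have h2 := intervalIntegral.integral_eq_sub_of_hasDerivAt h1
    (Continuous.intervalIntegrable (by fun_prop) _ _)
  rw [intervalIntegral.integral_add (Continuous.intervalIntegrable (by fun_prop) _ _)
    (Continuous.intervalIntegrable (by fun_prop) _ _), intervalIntegral.integral_neg,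
    intervalIntegral.integral_const_mul] at h2
  unfold AI
  simp at h2 ⊢
  linarith

lemma AI_abs_le {f g : ℝ → ℝ} (hf : Continuous f) (hg : Continuous g)
    (h : ∀ t, |f t| ≤ g t) (s k : ℕ) : |AI s k f| ≤ ∫ t in (0 : ℝ)..1, t ^ s * g t := by
  unfold AI
  refine (intervalIntegral.abs_integral_le_integral_abs zero_le_one).trans ?_
  refine intervalIntegral.integral_mono_on zero_le_one
    (Continuous.intervalIntegrable (by fun_prop) _ _)
    (Continuous.intervalIntegrable (by fun_prop) _ _) ?_
  rintro t ⟨h0, h1⟩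
  rw [abs_mul, abs_mul, abs_of_nonneg (pow_nonneg h0 s), abs_of_nonneg (pow_nonneg (by linarith) k)]
  have : (1 - t) ^ k ≤ 1 := pow_le_one₀ (by linarith) (by linarith)
  have h2 := h t
  calc t ^ s * (1 - t) ^ k * |f t| ≤ t ^ s * 1 * g t := by gcongr
    _ = _ := by ring

/-- Total jet size at scale `r`. -/
def Fl (d m : ℕ) (r : ℝ) (W : (Fin d → ℕ) → Ed d → ℝ) (y : Ed d) : ℝ :=
  ∑ α ∈ multiIdx d m, r ^ (∑ i, α i) * |W α y|

lemma Fl_cont {d m : ℕ} {U : Set (Ed d)} {W : (Fin d → ℕ) → Ed d → ℝ} (h : IsJet d m U W) (r : ℝ) :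
    Continuous (Fl d m r W) := by
  unfold Fl
  refine continuous_finsetSum _ fun α hα => ?_
  have := h.1 α (mem_multiIdx.1 hα)
  fun_prop

lemma Fl_ge {d m : ℕ} {W : (Fin d → ℕ) → Ed d → ℝ} {r : ℝ} (hr : 0 ≤ r) {β : Fin d → ℕ}
    (hβ : ∑ i, β i ≤ m) (y : Ed d) : r ^ (∑ i, β i) * |W β y| ≤ Fl d m r W y := by
  unfold Fl
  exact Finset.single_le_sum (f := fun α : Fin d → ℕ => r ^ (∑ i, α i) * |W α y|)
    (fun α _ => by positivity) (mem_multiIdx.2 hβ)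

lemma jet_path {d m : ℕ} {U : Set (Ed d)} {W : (Fin d → ℕ) → Ed d → ℝ} (h : IsJet d m U W)
    {x v : Ed d} (hU : ∀ t ∈ Icc (0 : ℝ) 1, x + t • v ∈ U) {β : Fin d → ℕ} (hβ : ∑ i, β i < m) :
    ∀ t ∈ Icc (0 : ℝ) 1, HasDerivAt (fun t : ℝ => W β (x + t • v))
      (∑ i, v i * W (β + Pi.single i 1) (x + t • v)) t := by
  intro t ht
  have h1 := h.2 β hβ _ (hU t ht)
  have h2 : HasDerivAt (fun t : ℝ => x + t • v) v t := by
    simpa using ((hasDerivAt_id t).smul_const v).const_add x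
  have h3 := h1.comp_hasDerivAt t h2
  refine h3.congr_deriv ?_
  simp [mul_comm]

lemma AI_sum {d : ℕ} (s k : ℕ) (c : Fin d → ℝ) (g : Fin d → ℝ → ℝ) (hg : ∀ i, Continuous (g i)) :
    AI s k (fun t => ∑ i, c i * g i t) = ∑ i, c i * AI s k (g i) := by
  unfold AI
  simp_rw [← intervalIntegral.integral_const_mul]
  rw [← intervalIntegral.integral_finset_sum]
  · congr 1
    ext t
    rw [Finset.mul_sum]
    exact Finset.sum_congr rfl fun i _ => by ring
  · intro i _
    have := hg i
    exact Continuous.intervalIntegrable (by fun_prop) _ _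

lemma ray_aux {d m : ℕ} {U : Set (Ed d)} {W : (Fin d → ℕ) → Ed d → ℝ} (h : IsJet d m U W)
    {x v : Ed d} {r : ℝ} (hr : 0 ≤ r) (hv : ∀ i, |v i| ≤ r)
    (hU : ∀ t ∈ Icc (0 : ℝ) 1, x + t • v ∈ U) (s : ℕ) :
    ∀ (β : Fin d → ℕ) (i k : ℕ), ∑ i, β i + s ≤ m → s ≤ k → k ≤ m →
      r ^ (∑ i, β i) * |AI i k (fun t => W β (x + t • v))| ≤
        (m + d : ℝ) ^ s * ∫ t in (0 : ℝ)..1, t ^ (i + s) * Fl d m r W (x + t • v) := by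
  have hFc : Continuous fun t : ℝ => Fl d m r W (x + t • v) := (Fl_cont h r).comp (by fun_prop)
  have hWc : ∀ α : Fin d → ℕ, ∑ i, α i ≤ m → Continuous fun t : ℝ => W α (x + t • v) :=
    fun α hα => (h.1 α hα).comp (by fun_prop)
  induction s with
  | zero =>
    intro β i k hβ _ _
    simp only [pow_zero, one_mul, add_zero]
    have e : r ^ (∑ i, β i) * |AI i k (fun t => W β (x + t • v))| =
        |AI i k (fun t => r ^ (∑ i, β i) * W β (x + t • v))| := by
      rw [← abs_of_nonneg (pow_nonneg hr (∑ i, β i)), ← abs_mul, abs_of_nonneg (pow_nonneg hr (∑ i, β i))]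
      unfold AI
      rw [← intervalIntegral.integral_const_mul]
      congr 2
      ext t; ring
    rw [e]
    refine AI_abs_le ((hWc β hβ).const_mul _) hFc (fun t => ?_) i k
    rw [abs_mul, abs_of_nonneg (pow_nonneg hr _)]
    exact Fl_ge hr hβ _
  | succ s ih =>
    intro β i k hβ hk hkm
    obtain ⟨k, rfl⟩ : ∃ k', k = k' + 1 := ⟨k - 1, by omega⟩
    have hstep := AI_step (hWc β (by omega)) (f' := fun t => ∑ i, v i * W (β + Pi.single i 1) (x + t • v))
      (continuous_finsetSum _ fun j _ => (hWc _ (by rw [sum_add_single]; omega)).const_mul _)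
      (jet_path h hU (by omega)) i k
    rw [AI_sum _ _ _ _ (fun j => hWc _ (by rw [sum_add_single]; omega))] at hstep
    set I := ∫ t in (0 : ℝ)..1, t ^ (i + (s + 1)) * Fl d m r W (x + t • v) with hI
    have h1 := ih β (i + 1) k (by omega) (by omega) (by omega)
    have h2 : ∀ j, r ^ (∑ i, β i + 1) * |AI (i + 1) (k + 1) (fun t => W (β + Pi.single j 1) (x + t • v))|
        ≤ (m + d : ℝ) ^ s * I := by
      intro j
      have := ih (β + Pi.single j 1) (i + 1) (k + 1) (by rw [sum_add_single]; omega) (by omega)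
        (by omega)
      rw [sum_add_single] at this
      rw [hI, show i + (s + 1) = i + 1 + s by ring]
      exact this
    rw [show i + 1 + s = i + (s + 1) by ring, ← hI] at h1
    have h3 : |AI i (k + 1) fun t => W β (x + t • v)| ≤
        (k + 1) * |AI (i + 1) k fun t => W β (x + t • v)| +
          ∑ j, r * |AI (i + 1) (k + 1) (fun t => W (β + Pi.single j 1) (x + t • v))| := by
      have e1 : |AI i (k + 1) fun t => W β (x + t • v)| ≤
          |(i + 1) * AI i (k + 1) fun t => W β (x + t • v)| := by
        rw [abs_mul]
        refine le_mul_of_one_le_left (abs_nonneg _) ?_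
        rw [abs_of_nonneg (by positivity)]
        have : (0 : ℝ) ≤ i := by positivity
        linarith
      refine e1.trans ?_
      rw [hstep]
      refine (abs_sub _ _).trans ?_
      rw [abs_mul, abs_of_nonneg (by positivity : (0 : ℝ) ≤ (k : ℝ) + 1)]
      gcongr
      refine (Finset.abs_sum_le_sum_abs _ _).trans (Finset.sum_le_sum fun j _ => ?_)
      rw [abs_mul]
      gcongr
      exact hv j
    calc r ^ (∑ i, β i) * |AI i (k + 1) fun t => W β (x + t • v)|
        ≤ r ^ (∑ i, β i) * ((k + 1) * |AI (i + 1) k fun t => W β (x + t • v)| +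
          ∑ j, r * |AI (i + 1) (k + 1) (fun t => W (β + Pi.single j 1) (x + t • v))|) := by gcongr
      _ = (k + 1) * (r ^ (∑ i, β i) * |AI (i + 1) k fun t => W β (x + t • v)|) +
          ∑ j : Fin d, r ^ (∑ i, β i + 1) * |AI (i + 1) (k + 1) (fun t => W (β + Pi.single j 1) (x + t • v))| := by
        rw [mul_add, Finset.mul_sum]
        congr 1
        · ring
        · exact Finset.sum_congr rfl fun j _ => by ring
      _ ≤ (k + 1) * ((m + d : ℝ) ^ s * I) + ∑ j : Fin d, (m + d : ℝ) ^ s * I := by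
        exact add_le_add (mul_le_mul_of_nonneg_left h1 (by positivity))
          (Finset.sum_le_sum fun j _ => h2 j)
      _ = (k + 1 + d) * ((m + d : ℝ) ^ s * I) := by simp; ring
      _ ≤ (m + d) * ((m + d : ℝ) ^ s * I) := by
        have hI0 : 0 ≤ I := by
          refine intervalIntegral.integral_nonneg zero_le_one fun t ht => ?_
          have := ht.1
          unfold Fl
          positivity
        have : ((k : ℝ) + 1) ≤ m := by exact_mod_cast hkm
        gcongr
      _ = _ := by ring

lemma ray_bound {d m : ℕ} {U : Set (Ed d)} {W : (Fin d → ℕ) → Ed d → ℝ} (h : IsJet d m U W)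
    {x v : Ed d} {r : ℝ} (hr : 0 ≤ r) (hv : ∀ i, |v i| ≤ r)
    (hU : ∀ t ∈ Icc (0 : ℝ) 1, x + t • v ∈ U) (s : ℕ) (β : Fin d → ℕ)
    (hβ : ∑ i, β i + (s + 1) ≤ m) :
    r ^ (∑ i, β i) * |W β x| ≤
      (m + d : ℝ) ^ (s + 1) * ∫ t in (0 : ℝ)..1, t ^ s * Fl d m r W (x + t • v) := by
  have hWc : ∀ α : Fin d → ℕ, ∑ i, α i ≤ m → Continuous fun t : ℝ => W α (x + t • v) :=
    fun α hα => (h.1 α hα).comp (by fun_prop)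
  have hstart := AI_start (hWc β (by omega))
    (f' := fun t => ∑ i, v i * W (β + Pi.single i 1) (x + t • v))
      (continuous_finsetSum _ fun j _ => (hWc _ (by rw [sum_add_single]; omega)).const_mul _)
      (jet_path h hU (by omega)) s
  rw [AI_sum _ _ _ _ (fun j => hWc _ (by rw [sum_add_single]; omega))] at hstart
  simp only [zero_smul, add_zero] at hstart
  set I := ∫ t in (0 : ℝ)..1, t ^ s * Fl d m r W (x + t • v) with hI
  have h1 := ray_aux h hr hv hU s β 0 s (by omega) le_rfl (by omega)
  have h2 : ∀ j, r ^ (∑ i, β i + 1) * |AI 0 (s + 1) (fun t => W (β + Pi.single j 1) (x + t • v))|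
        ≤ (m + d : ℝ) ^ s * I := by
    intro j
    have := ray_aux h hr hv hU s (β + Pi.single j 1) 0 (s + 1) (by rw [sum_add_single]; omega) (by omega)
        (by omega)
    rw [sum_add_single, zero_add] at this
    exact this
  rw [zero_add, ← hI] at h1
  rw [hstart]
  calc r ^ (∑ i, β i) * |(s + 1) * AI 0 s (fun t => W β (x + t • v)) -
        ∑ j, v j * AI 0 (s + 1) (fun t => W (β + Pi.single j 1) (x + t • v))|
      ≤ r ^ (∑ i, β i) * ((s + 1) * |AI 0 s fun t => W β (x + t • v)| +
          ∑ j, r * |AI 0 (s + 1) (fun t => W (β + Pi.single j 1) (x + t • v))|) := by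
        gcongr
        refine (abs_sub _ _).trans ?_
        rw [abs_mul, abs_of_nonneg (by positivity : (0 : ℝ) ≤ (s : ℝ) + 1)]
        gcongr
        refine (Finset.abs_sum_le_sum_abs _ _).trans (Finset.sum_le_sum fun j _ => ?_)
        rw [abs_mul]
        gcongr
        exact hv j
    _ = (s + 1) * (r ^ (∑ i, β i) * |AI 0 s fun t => W β (x + t • v)|) +
          ∑ j : Fin d, r ^ (∑ i, β i + 1) * |AI 0 (s + 1) (fun t => W (β + Pi.single j 1) (x + t • v))| := by
        rw [mul_add, Finset.mul_sum]
        congr 1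
        · ring
        · exact Finset.sum_congr rfl fun j _ => by ring
    _ ≤ (s + 1) * ((m + d : ℝ) ^ s * I) + ∑ j : Fin d, (m + d : ℝ) ^ s * I := by
        exact add_le_add (mul_le_mul_of_nonneg_left h1 (by positivity))
          (Finset.sum_le_sum fun j _ => h2 j)
    _ = (s + 1 + d) * ((m + d : ℝ) ^ s * I) := by simp; ring
    _ ≤ (m + d) * ((m + d : ℝ) ^ s * I) := by
        have hI0 : 0 ≤ I := by
          refine intervalIntegral.integral_nonneg zero_le_one fun t ht => ?_
          have := ht.1
          unfold Fl
          positivity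
        have : ((s : ℝ) + 1) ≤ m := by
          have : s + 1 ≤ m := by omega
          exact_mod_cast this
        gcongr
    _ = _ := by ring

/-- One coordinate step. -/
lemma coord_bound {d m : ℕ} {U : Set (Ed d)} {W : (Fin d → ℕ) → Ed d → ℝ} (h : IsJet d m U W)
    {x : Ed d} {r : ℝ} (hr : 0 ≤ r) (i : Fin d)
    (hU : ∀ t ∈ Icc (0 : ℝ) 1, x + t • EuclideanSpace.single i r ∈ U) (β : Fin d → ℕ)
    (hβ : ∑ i, β i + 1 ≤ m) :
    |W β x| ≤ ∫ t in (0 : ℝ)..1, (|W β (x + t • EuclideanSpace.single i r)| +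
      r * |W (β + Pi.single i 1) (x + t • EuclideanSpace.single i r)|) := by
  set v : Ed d := EuclideanSpace.single i r with hv
  have hWc : ∀ α : Fin d → ℕ, ∑ i, α i ≤ m → Continuous fun t : ℝ => W α (x + t • v) :=
    fun α hα => (h.1 α hα).comp (by fun_prop)
  have hp := jet_path h hU (β := β) (by omega)
  have e : ∀ t : ℝ, ∑ j, v j * W (β + Pi.single j 1) (x + t • v) =
      r * W (β + Pi.single i 1) (x + t • v) := by
    intro t
    simp [hv, Pi.single_apply]
  simp_rw [e] at hp
  have c1 := hWc β (by omega)
  have c2 := hWc (β + Pi.single i 1) (by rw [sum_add_single]; omega)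
  have hstart := AI_start c1 (c2.const_mul r) hp 0
  simp only [zero_smul, add_zero] at hstart
  have a1 := AI_abs_le c1 c1.abs (fun t => le_rfl) 0 0
  have a2 := AI_abs_le (c2.const_mul r) (c2.abs.const_mul r)
    (fun t => by rw [abs_mul, abs_of_nonneg hr]) 0 1
  rw [intervalIntegral.integral_add (c1.abs.intervalIntegrable _ _)
    ((c2.abs.const_mul r).intervalIntegrable _ _), hstart]
  refine (abs_sub _ _).trans ?_
  simp at a1 a2 ⊢
  linarith

lemma jensen_lintegral {X : Type*} [MeasurableSpace X] (ν : Measure X) {p : ℝ} (hp : 1 ≤ p)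
    {f : X → ℝ≥0∞} (hf : AEMeasurable f ν) :
    (∫⁻ x, f x ∂ν) ^ p ≤ ν univ ^ (p - 1) * ∫⁻ x, f x ^ p ∂ν := by
  rcases hp.lt_or_eq with h | h
  · have hc : p.HolderConjugate (p / (p - 1)) := Real.HolderConjugate.conjExponent h
    have h1 := ENNReal.lintegral_mul_le_Lp_mul_Lq ν hc hf (aemeasurable_const (b := (1 : ℝ≥0∞)))
    simp only [Pi.mul_apply, mul_one, ENNReal.one_rpow, lintegral_const, one_mul] at h1
    have h2 := ENNReal.rpow_le_rpow h1 (by linarith : 0 ≤ p)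
    refine h2.trans (le_of_eq ?_)
    rw [ENNReal.mul_rpow_of_nonneg _ _ (by linarith), ← ENNReal.rpow_mul, ← ENNReal.rpow_mul,
      one_div_mul_cancel (by linarith), ENNReal.rpow_one, mul_comm]
    congr 2
    field_simp
  · subst h
    simp

lemma lintegral_affine {d : ℕ} {g : Ed d → ℝ≥0∞} (x : Ed d) {c : ℝ}
    (hc : 0 < c) : ∫⁻ e, g (x + c • e) = ENNReal.ofReal (c⁻¹ ^ d) * ∫⁻ y, g y := by
  have hm : MeasurableEmbedding (fun e : Ed d => c • e) :=
    (Homeomorph.smulOfNeZero c hc.ne').measurableEmbedding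
  have h1 : ∫⁻ e, g (x + c • e) = ∫⁻ y, g (x + y) ∂(Measure.map (fun e : Ed d => c • e) volume) := by
    rw [hm.lintegral_map]
  rw [h1, Measure.map_addHaar_smul _ hc.ne', lintegral_smul_measure,
    lintegral_add_left_eq_self g x]
  simp only [finrank_euclideanSpace, Fintype.card_fin, smul_eq_mul]
  congr 2
  rw [abs_of_pos (by positivity), inv_pow]

/-- uniform probability measure on the unit ball -/
def Qb (d : ℕ) : Measure (Ed d) := ProbabilityTheory.cond volume (closedBall (0 : Ed d) 1)

lemma volball_ne_zero (d : ℕ) : volume (closedBall (0 : Ed d) 1) ≠ 0 :=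
  (measure_closedBall_pos volume _ one_pos).ne'

lemma volball_ne_top (d : ℕ) : volume (closedBall (0 : Ed d) 1) ≠ ∞ :=
  measure_closedBall_lt_top.ne

instance Qb_prob (d : ℕ) : IsProbabilityMeasure (Qb d) :=
  ProbabilityTheory.cond_isProbabilityMeasure_of_finite (volball_ne_zero d) (volball_ne_top d)

lemma Qb_ae (d : ℕ) : ∀ᵐ e ∂(Qb d), e ∈ closedBall (0 : Ed d) 1 :=
  ProbabilityTheory.ae_cond_mem measurableSet_closedBall

lemma lintegral_Qb {d : ℕ} (f : Ed d → ℝ≥0∞) :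
    ∫⁻ e, f e ∂(Qb d) = (volume (closedBall (0 : Ed d) 1))⁻¹ *
      ∫⁻ e in closedBall (0 : Ed d) 1, f e := by
  unfold Qb ProbabilityTheory.cond
  rw [lintegral_smul_measure, smul_eq_mul]

/-- Averages over balls of radius comparable to the distance to the singular point -/
def Mav (d : ℕ) (t : ℝ) (h : Ed d → ℝ≥0∞) (x : Ed d) : ℝ≥0∞ :=
  ∫⁻ e, h (x + (t * (rhoModel d 0 x / 2)) • e) ∂(Qb d)

lemma Mav_meas {d : ℕ} {h : Ed d → ℝ≥0∞} (hh : Measurable h) :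
    Measurable (fun q : ℝ × Ed d => Mav d q.1 h q.2) := by
  unfold Mav
  refine Measurable.lintegral_prod_right'
    (f := fun q : (ℝ × Ed d) × Ed d => h (q.1.2 + (q.1.1 * (rhoModel d 0 q.1.2 / 2)) • q.2)) ?_
  refine hh.comp ?_
  have := continuous_rhoModel (d := d)
  exact Continuous.measurable (by fun_prop)

lemma Mav_sup {d : ℕ} (hd : 2 ≤ d) {h : Ed d → ℝ≥0∞} {t : ℝ} (ht : 0 ≤ t) (x : Ed d) :
    ENNReal.ofReal t ^ (d : ℝ) * (ENNReal.ofReal (rhoModel d 0 x) ^ (d : ℝ) * Mav d t h x) ≤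
      2 ^ d * (volume (closedBall (0 : Ed d) 1))⁻¹ * ∫⁻ y, h y := by
  have hd0 : (0 : ℝ) < d := by
    have : (2 : ℝ) ≤ d := by exact_mod_cast hd
    linarith
  rcases ht.eq_or_lt with h0 | h0
  · rw [← h0, ENNReal.ofReal_zero, ENNReal.zero_rpow_of_pos hd0, zero_mul]
    exact zero_le
  rcases (rhoModel_nonneg x).eq_or_lt with h1 | h1
  · rw [← h1, ENNReal.ofReal_zero, ENNReal.zero_rpow_of_pos hd0, zero_mul, mul_zero]
    exact zero_le
  set c := t * (rhoModel d 0 x / 2) with hc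
  have hc0 : 0 < c := by positivity
  have h2 : Mav d t h x ≤ (volume (closedBall (0 : Ed d) 1))⁻¹ *
      (ENNReal.ofReal (c⁻¹ ^ d) * ∫⁻ y, h y) := by
    unfold Mav
    rw [lintegral_Qb, ← lintegral_affine x hc0]
    gcongr
    exact Measure.restrict_le_self
  have h3 : ENNReal.ofReal t ^ (d : ℝ) * ENNReal.ofReal (rhoModel d 0 x) ^ (d : ℝ) *
      ENNReal.ofReal (c⁻¹ ^ d) = 2 ^ d := by
    rw [ENNReal.rpow_natCast, ENNReal.rpow_natCast, ← ENNReal.ofReal_pow h0.le,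
      ← ENNReal.ofReal_pow h1.le, ← ENNReal.ofReal_mul (by positivity),
      ← ENNReal.ofReal_mul (by positivity), ← mul_pow, ← mul_pow]
    have : t * rhoModel d 0 x * c⁻¹ = 2 := by rw [hc]; field_simp
    rw [this, ENNReal.ofReal_pow (by norm_num)]
    simp
  calc ENNReal.ofReal t ^ (d : ℝ) * (ENNReal.ofReal (rhoModel d 0 x) ^ (d : ℝ) * Mav d t h x)
      ≤ ENNReal.ofReal t ^ (d : ℝ) * (ENNReal.ofReal (rhoModel d 0 x) ^ (d : ℝ) *
        ((volume (closedBall (0 : Ed d) 1))⁻¹ * (ENNReal.ofReal (c⁻¹ ^ d) * ∫⁻ y, h y))) := by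
        gcongr
    _ = (ENNReal.ofReal t ^ (d : ℝ) * ENNReal.ofReal (rhoModel d 0 x) ^ (d : ℝ) *
      ENNReal.ofReal (c⁻¹ ^ d)) * (volume (closedBall (0 : Ed d) 1))⁻¹ * ∫⁻ y, h y := by ring
    _ = _ := by rw [h3]

lemma ae_ne_zero {d : ℕ} (hd : 2 ≤ d) : ∀ᵐ x : Ed d, x ≠ 0 := by
  haveI : Nonempty (Fin d) := ⟨⟨0, by omega⟩⟩
  haveI : Nontrivial (Ed d) := inferInstance
  have : volume ({0} : Set (Ed d)) = 0 := measure_singleton 0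
  exact compl_mem_ae_iff.2 this

lemma rho_pos' {d : ℕ} {x : Ed d} (hx : x ≠ 0) : 0 < rhoModel d 0 x :=
  rhoModel_pos (by rw [modelDomain_eq]; exact hx)

lemma Mav_int {d : ℕ} (hd : 2 ≤ d) {h : Ed d → ℝ≥0∞} (hh : Measurable h) {t : ℝ} (ht : 0 ≤ t)
    (ht1 : t ≤ 1) : ∫⁻ x, Mav d t h x ≤ 4 ^ d * ∫⁻ y, h y := by
  rcases ht.eq_or_lt with h0 | h0
  · have : ∀ x, Mav d t h x = h x := by intro x; simp [Mav, ← h0]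
    simp_rw [this]
    exact le_mul_of_one_le_left zero_le (one_le_pow₀ (by norm_num))
  have hρc := continuous_rhoModel (d := d)
  set ω := volume (closedBall (0 : Ed d) 1) with hω
  let c : Ed d → ℝ := fun x => t * (rhoModel d 0 x / 2)
  have hcc : Continuous c := by fun_prop
  let S : Set (Ed d × Ed d) := {q | ‖q.2 - q.1‖ ≤ c q.1}
  have hS : MeasurableSet S := by
    refine measurableSet_le ?_ ?_
    · exact Continuous.measurable (by fun_prop)
    · exact Continuous.measurable (by fun_prop)
  let k : Ed d → Ed d → ℝ≥0∞ := fun x y =>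
    ENNReal.ofReal ((c x)⁻¹ ^ d) * S.indicator (fun q => h q.2) (x, y)
  have h1 : ∀ᵐ x : Ed d, Mav d t h x ≤ ω⁻¹ * ∫⁻ y, k x y := by
    filter_upwards [ae_ne_zero hd] with x hx
    have hc0 : 0 < c x := by have := rho_pos' hx; positivity
    have e1 : ∫⁻ y, k x y = ∫⁻ e, S.indicator (fun q => h q.2) (x, x + c x • e) := by
      simp only [k]
      rw [lintegral_const_mul' _ _ ENNReal.ofReal_ne_top]
      rw [lintegral_affine (g := fun y => S.indicator (fun q => h q.2) (x, y)) x hc0]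
    rw [e1]
    unfold Mav
    rw [lintegral_Qb]
    refine mul_le_mul_right ?_ _
    rw [← lintegral_indicator measurableSet_closedBall]
    refine lintegral_mono fun e => ?_
    by_cases he : e ∈ closedBall (0 : Ed d) 1
    · rw [indicator_of_mem he, indicator_of_mem]
      simp only [S, mem_setOf_eq, add_sub_cancel_left, norm_smul, Real.norm_of_nonneg hc0.le]
      rw [mem_closedBall_zero_iff] at he
      nlinarith
    · rw [indicator_of_notMem he]; exact zero_le
  have hk : Measurable (Function.uncurry k) := by
    refine Measurable.mul ?_ ((hh.comp measurable_snd).indicator hS)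
    exact ENNReal.measurable_ofReal.comp (((hcc.measurable.inv).pow_const d).comp measurable_fst)
  have h2 : ∀ᵐ y : Ed d, ∫⁻ x, k x y ≤ 4 ^ d * ω * h y := by
    filter_upwards [ae_ne_zero hd] with y hy
    have hρy := rho_pos' hy
    have h3 : ∀ᵐ x : Ed d, k x y ≤ (closedBall y (t * rhoModel d 0 y)).indicator
        (fun _ => ENNReal.ofReal ((t * rhoModel d 0 y / 4)⁻¹ ^ d) * h y) x := by
      filter_upwards [ae_ne_zero hd] with x hx
      have hρx := rho_pos' hx
      by_cases hq : (x, y) ∈ S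
      · have hq' : ‖y - x‖ ≤ t * (rhoModel d 0 x / 2) := hq
        have hsl := rho_slow (x := x) (y := y) (hq'.trans (by nlinarith))
        rw [indicator_of_mem]
        · simp only [k]
          rw [indicator_of_mem hq]
          gcongr
          simp only [c]
          nlinarith
        · rw [mem_closedBall, dist_eq_norm, norm_sub_rev]
          nlinarith
      · simp only [k]
        rw [indicator_of_notMem hq, mul_zero]
        exact zero_le
    refine (lintegral_mono_ae h3).trans ?_
    rw [lintegral_indicator measurableSet_closedBall, setLIntegral_const,
      Measure.addHaar_closedBall' _ _ (by positivity)]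
    simp only [finrank_euclideanSpace, Fintype.card_fin]
    rw [← hω]
    calc ENNReal.ofReal ((t * rhoModel d 0 y / 4)⁻¹ ^ d) * h y *
          (ENNReal.ofReal ((t * rhoModel d 0 y) ^ d) * ω)
        = (ENNReal.ofReal ((t * rhoModel d 0 y / 4)⁻¹ ^ d) *
          ENNReal.ofReal ((t * rhoModel d 0 y) ^ d)) * ω * h y := by ring
      _ = 4 ^ d * ω * h y := by
        rw [← ENNReal.ofReal_mul (by positivity), ← mul_pow]
        have : (t * rhoModel d 0 y / 4)⁻¹ * (t * rhoModel d 0 y) = 4 := by field_simp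
        rw [this, ENNReal.ofReal_pow (by norm_num)]
        simp
      _ ≤ _ := le_rfl
  calc ∫⁻ x, Mav d t h x ≤ ∫⁻ x, ω⁻¹ * ∫⁻ y, k x y := lintegral_mono_ae h1
    _ = ω⁻¹ * ∫⁻ x, ∫⁻ y, k x y := lintegral_const_mul _ (hk.lintegral_prod_right')
    _ = ω⁻¹ * ∫⁻ y, ∫⁻ x, k x y := by rw [lintegral_lintegral_swap hk.aemeasurable]
    _ ≤ ω⁻¹ * ∫⁻ y, 4 ^ d * ω * h y := by gcongr 1; exact lintegral_mono_ae h2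
    _ = 4 ^ d * ∫⁻ y, h y := by
      rw [lintegral_const_mul _ hh, ← mul_assoc]
      congr 1
      rw [mul_comm (4 ^ d) ω, ← mul_assoc, ENNReal.inv_mul_cancel (volball_ne_zero d)
        (volball_ne_top d), one_mul]

def Kcst (d : ℕ) : ℝ≥0∞ := 2 ^ d * (volume (closedBall (0 : Ed d) 1))⁻¹ * 4 ^ d

lemma Kcst_ne_top (d : ℕ) : Kcst d ≠ ∞ := by
  unfold Kcst
  refine ENNReal.mul_ne_top (ENNReal.mul_ne_top (by simp) ?_) (by simp)
  exact ENNReal.inv_ne_top.2 (volball_ne_zero d)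

lemma Mav_prod_aux {d : ℕ} (hd : 2 ≤ d) {h1 h2 : Ed d → ℝ≥0∞} (hm1 : Measurable h1)
    {t τ μ ν : ℝ} (ht : 0 ≤ t) (hτ1 : τ ≤ 1) (htτ : t ≤ τ)
    (hμ : 0 ≤ μ) (hν : 0 ≤ ν) (hsum : μ + ν = d) :
    ENNReal.ofReal t ^ μ * ENNReal.ofReal τ ^ ν *
      ∫⁻ x, ENNReal.ofReal (rhoModel d 0 x) ^ (d : ℝ) * (Mav d t h1 x * Mav d τ h2 x) ≤
      Kcst d * (∫⁻ x, h1 x) * ∫⁻ x, h2 x := by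
  have e1 : ENNReal.ofReal t ^ μ * ENNReal.ofReal τ ^ ν ≤ ENNReal.ofReal τ ^ (d : ℝ) := by
    rw [← hsum, ENNReal.rpow_add_of_nonneg _ _ hμ hν]
    gcongr
  have hM1 : Measurable (Mav d t h1) := (Mav_meas hm1).comp measurable_prodMk_left
  calc ENNReal.ofReal t ^ μ * ENNReal.ofReal τ ^ ν *
      ∫⁻ x, ENNReal.ofReal (rhoModel d 0 x) ^ (d : ℝ) * (Mav d t h1 x * Mav d τ h2 x)
      ≤ ENNReal.ofReal τ ^ (d : ℝ) *
      ∫⁻ x, ENNReal.ofReal (rhoModel d 0 x) ^ (d : ℝ) * (Mav d t h1 x * Mav d τ h2 x) := by gcongr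
    _ = ∫⁻ x, ENNReal.ofReal τ ^ (d : ℝ) *
      (ENNReal.ofReal (rhoModel d 0 x) ^ (d : ℝ) * (Mav d t h1 x * Mav d τ h2 x)) := by
        rw [lintegral_const_mul']
        exact ENNReal.rpow_ne_top_of_nonneg (by positivity) ENNReal.ofReal_ne_top
    _ ≤ ∫⁻ x, (2 ^ d * (volume (closedBall (0 : Ed d) 1))⁻¹ * ∫⁻ y, h2 y) * Mav d t h1 x := by
        refine lintegral_mono fun x => ?_
        have := Mav_sup hd (h := h2) (ht.trans htτ) x
        calc _ = (ENNReal.ofReal τ ^ (d : ℝ) * (ENNReal.ofReal (rhoModel d 0 x) ^ (d : ℝ) *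
              Mav d τ h2 x)) * Mav d t h1 x := by ring
          _ ≤ _ := by gcongr
    _ = (2 ^ d * (volume (closedBall (0 : Ed d) 1))⁻¹ * ∫⁻ y, h2 y) * ∫⁻ x, Mav d t h1 x :=
        lintegral_const_mul _ hM1
    _ ≤ (2 ^ d * (volume (closedBall (0 : Ed d) 1))⁻¹ * ∫⁻ y, h2 y) * (4 ^ d * ∫⁻ x, h1 x) := by
        gcongr
        exact Mav_int hd hm1 ht (htτ.trans hτ1)
    _ = _ := by unfold Kcst; ring

lemma Mav_prod {d : ℕ} (hd : 2 ≤ d) {h1 h2 : Ed d → ℝ≥0∞} (hm1 : Measurable h1)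
    (hm2 : Measurable h2)
    {t τ μ ν : ℝ} (ht : t ∈ Icc (0 : ℝ) 1) (hτ : τ ∈ Icc (0 : ℝ) 1)
    (hμ : 0 ≤ μ) (hν : 0 ≤ ν) (hsum : μ + ν = d) :
    ENNReal.ofReal t ^ μ * ENNReal.ofReal τ ^ ν *
      ∫⁻ x, ENNReal.ofReal (rhoModel d 0 x) ^ (d : ℝ) * (Mav d t h1 x * Mav d τ h2 x) ≤
      Kcst d * (∫⁻ x, h1 x) * ∫⁻ x, h2 x := by
  rcases le_total t τ with h | h
  · exact Mav_prod_aux hd hm1 ht.1 hτ.2 h hμ hν hsum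
  · have := Mav_prod_aux hd (h2 := h1) hm2 hτ.1 ht.2 h hν hμ (by linarith)
    rw [mul_comm (ENNReal.ofReal t ^ μ)]
    simp_rw [mul_comm (Mav d t h1 _)]
    refine this.trans (le_of_eq (by ring))

def Gw (d : ℕ) (a : ℝ) (W : (Fin d → ℕ) → Ed d → ℝ) (α : Fin d → ℕ) (y : Ed d) : ℝ :=
  rhoModel d 0 y ^ (((∑ i, α i : ℕ) : ℝ) - a) * |W α y|

lemma Gw_nonneg {d : ℕ} {a : ℝ} {W : (Fin d → ℕ) → Ed d → ℝ} {α : Fin d → ℕ} {y : Ed d} :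
    0 ≤ Gw d a W α y := by
  have := rhoModel_nonneg y
  unfold Gw; positivity

def Fw (d m : ℕ) (a : ℝ) (U : Set (Ed d)) (W : (Fin d → ℕ) → Ed d → ℝ) : Ed d → ℝ≥0∞ :=
  U.indicator fun y => ∑ α ∈ multiIdx d m, ENNReal.ofReal (Gw d a W α y)

/-- the weighted norm (to the power `p`) over a set -/
def Nrm (d m : ℕ) (a p : ℝ) (U : Set (Ed d)) (W : (Fin d → ℕ) → Ed d → ℝ) : ℝ≥0∞ :=
  ∑ α ∈ multiIdx d m, ∫⁻ y in U, ENNReal.ofReal (Gw d a W α y) ^ p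

lemma Gw_meas {d : ℕ} {a : ℝ} {W : (Fin d → ℕ) → Ed d → ℝ} {α : Fin d → ℕ}
    (h : Measurable (W α)) : Measurable (Gw d a W α) := by
  unfold Gw
  refine Measurable.mul ?_ (by fun_prop)
  exact (continuous_rhoModel.measurable).pow_const _

lemma Fw_meas {d m : ℕ} {a : ℝ} {U : Set (Ed d)} (hU : MeasurableSet U)
    {W : (Fin d → ℕ) → Ed d → ℝ} (h : ∀ α, ∑ i, α i ≤ m → Measurable (W α)) :
    Measurable (Fw d m a U W) := by
  unfold Fw
  refine Measurable.indicator ?_ hU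
  refine Finset.measurable_sum _ fun α hα => ?_
  exact (Gw_meas (h α (mem_multiIdx.1 hα))).ennreal_ofReal

lemma Fw_int {d m : ℕ} {a p : ℝ} (hp : 1 ≤ p) {U : Set (Ed d)} (hU : MeasurableSet U)
    {W : (Fin d → ℕ) → Ed d → ℝ} (h : ∀ α, ∑ i, α i ≤ m → Measurable (W α)) :
    ∫⁻ y, Fw d m a U W y ^ p ≤ ((multiIdx d m).card : ℝ≥0∞) ^ (p - 1) * Nrm d m a p U W := by
  have e : (fun y => Fw d m a U W y ^ p) =
      U.indicator fun y => (∑ α ∈ multiIdx d m, ENNReal.ofReal (Gw d a W α y)) ^ p := by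
    ext y
    unfold Fw
    by_cases hy : y ∈ U
    · simp [hy]
    · simp [hy, ENNReal.zero_rpow_of_pos (by linarith : 0 < p)]
  rw [e, lintegral_indicator hU]
  have hm : ∀ α ∈ multiIdx d m, Measurable fun y => ENNReal.ofReal (Gw d a W α y) ^ p :=
    fun α hα => (Gw_meas (h α (mem_multiIdx.1 hα))).ennreal_ofReal.pow_const _
  unfold Nrm
  rw [← lintegral_finsetSum _ hm, ← lintegral_const_mul _ (Finset.measurable_sum _ hm)]
  refine lintegral_mono fun y => ?_
  exact ENNReal.rpow_sum_le_const_mul_sum_rpow _ _ hp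

lemma Gw_le_Fw {d m : ℕ} {a : ℝ} {U : Set (Ed d)} {W : (Fin d → ℕ) → Ed d → ℝ} {α : Fin d → ℕ}
    (hα : ∑ i, α i ≤ m) {x : Ed d} (hx : x ∈ U) :
    ENNReal.ofReal (Gw d a W α x) ≤ Fw d m a U W x := by
  unfold Fw
  rw [indicator_of_mem hx]
  exact Finset.single_le_sum (f := fun α => ENNReal.ofReal (Gw d a W α x)) (fun _ _ => zero_le)
    (mem_multiIdx.2 hα)

lemma transfer {d m : ℕ} {a : ℝ} {U : Set (Ed d)} {W : (Fin d → ℕ) → Ed d → ℝ} {x y : Ed d}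
    {δ : ℝ} (hδ : 0 < δ) (hδ1 : δ ≤ 1) (hx : 0 < rhoModel d 0 x)
    (hxy : ‖y - x‖ ≤ rhoModel d 0 x / 2) (hy : y ∈ U) :
    ENNReal.ofReal (rhoModel d 0 x ^ (-a) * Fl d m (δ * rhoModel d 0 x) W y) ≤
      ENNReal.ofReal (2 ^ (m + |a|)) * Fw d m a U W y := by
  unfold Fw
  rw [indicator_of_mem hy, ← ENNReal.ofReal_sum_of_nonneg (fun _ _ => Gw_nonneg),
    ← ENNReal.ofReal_mul (by positivity)]
  refine ENNReal.ofReal_le_ofReal ?_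
  unfold Fl
  rw [Finset.mul_sum, Finset.mul_sum]
  refine Finset.sum_le_sum fun α hα => ?_
  have hα' : ((∑ i, α i : ℕ) : ℝ) ≤ m := by exact_mod_cast mem_multiIdx.1 hα
  have hsl := rho_slow hxy
  have hy0 : 0 < rhoModel d 0 y := by linarith
  unfold Gw
  have h1 : rhoModel d 0 x ^ (-a) * (δ * rhoModel d 0 x) ^ (∑ i, α i) ≤
      rhoModel d 0 x ^ (((∑ i, α i : ℕ) : ℝ) - a) := by
    rw [sub_eq_add_neg, Real.rpow_add hx, mul_comm, Real.rpow_natCast]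
    gcongr
    nlinarith
  have h2 := rpow_slow hx hy0 hsl.1 hsl.2 (c := ((∑ i, α i : ℕ) : ℝ) - a) (b := m + |a|) (by
    refine (abs_sub _ _).trans ?_
    rw [abs_of_nonneg (by positivity)]
    linarith)
  calc rhoModel d 0 x ^ (-a) * ((δ * rhoModel d 0 x) ^ (∑ i, α i) * |W α y|)
      = (rhoModel d 0 x ^ (-a) * (δ * rhoModel d 0 x) ^ (∑ i, α i)) * |W α y| := by ring
    _ ≤ (2 ^ (m + |a|) * rhoModel d 0 y ^ (((∑ i, α i : ℕ) : ℝ) - a)) * |W α y| := by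
      exact mul_le_mul_of_nonneg_right (h1.trans h2) (abs_nonneg _)
    _ = _ := by ring

lemma Gw_scale {d m : ℕ} {a : ℝ} {W : (Fin d → ℕ) → Ed d → ℝ} {x : Ed d}
    {δ : ℝ} (hδ : 0 < δ) (hδ1 : δ ≤ 1) (hx : 0 < rhoModel d 0 x) {β : Fin d → ℕ}
    (hβ : ∑ i, β i ≤ m) :
    Gw d a W β x ≤ δ⁻¹ ^ m * (rhoModel d 0 x ^ (-a) *
      ((δ * rhoModel d 0 x) ^ (∑ i, β i) * |W β x|)) := by
  unfold Gw
  rw [sub_eq_add_neg, Real.rpow_add hx, Real.rpow_natCast, mul_pow]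
  have h1 : 1 ≤ δ⁻¹ ^ m * δ ^ (∑ i, β i) := by
    rw [inv_pow, ← div_eq_inv_mul, le_div_iff₀ (by positivity), one_mul]
    exact pow_le_pow_of_le_one hδ.le hδ1 hβ
  calc rhoModel d 0 x ^ (∑ i, β i) * rhoModel d 0 x ^ (-a) * |W β x|
      ≤ (δ⁻¹ ^ m * δ ^ (∑ i, β i)) * (rhoModel d 0 x ^ (∑ i, β i) * rhoModel d 0 x ^ (-a) * |W β x|) :=
        le_mul_of_one_le_left (by positivity) h1
    _ = _ := by ring

/-- pointwise bound by an integral over a cone -/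
lemma cone_bound {d m : ℕ} (a : ℝ) (s : ℕ) : ∃ C : ℝ≥0∞, C ≠ ∞ ∧
    ∀ (U : Set (Ed d)) (W : (Fin d → ℕ) → Ed d → ℝ), MeasurableSet U → IsJet d m U W →
      (∀ α, Measurable (W α)) →
    ∀ (x : Ed d), x ≠ 0 → closedBall x (rhoModel d 0 x / 2) ⊆ U →
    ∀ (β : Fin d → ℕ), ∑ i, β i + (s + 1) ≤ m →
      ENNReal.ofReal (Gw d a W β x) ≤ C * ∫⁻ t in Ioc (0 : ℝ) 1, ENNReal.ofReal t ^ (s : ℝ) *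
        Mav d t (Fw d m a U W) x := by
  refine ⟨ENNReal.ofReal ((2 : ℝ) ^ m * (m + d : ℝ) ^ (s + 1)) * ENNReal.ofReal (2 ^ (m + |a|)),
    ENNReal.mul_ne_top ENNReal.ofReal_ne_top ENNReal.ofReal_ne_top, ?_⟩
  intro U W hUm hW hWm x hx hU β hβ
  have hρ := rho_pos' hx
  have hFm := Fw_meas (a := a) (m := m) hUm fun α _ => hWm α
  set r := rhoModel d 0 x / 2 with hr
  have hr0 : 0 < r := by positivity
  have hr' : r = (1 / 2) * rhoModel d 0 x := by rw [hr]; ring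
  set C1 : ℝ := (2 : ℝ) ^ m * (m + d : ℝ) ^ (s + 1) with hC1
  set C2 : ℝ := 2 ^ (m + |a|) with hC2
  -- for each direction
  have hdir : ∀ e ∈ closedBall (0 : Ed d) 1, ENNReal.ofReal (Gw d a W β x) ≤
      ENNReal.ofReal C1 * ENNReal.ofReal C2 * ∫⁻ t in Ioc (0 : ℝ) 1, ENNReal.ofReal t ^ (s : ℝ) *
        Fw d m a U W (x + (t * r) • e) := by
    intro e he
    rw [mem_closedBall_zero_iff] at he
    have hmem : ∀ t ∈ Icc (0 : ℝ) 1, ‖(x + t • (r • e)) - x‖ ≤ r := by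
      intro t ht
      rw [add_sub_cancel_left, norm_smul, norm_smul, Real.norm_of_nonneg ht.1,
        Real.norm_of_nonneg hr0.le]
      calc t * (r * ‖e‖) ≤ 1 * (r * 1) := by
            gcongr
            exact ht.2
        _ = r := by ring
    have hUe : ∀ t ∈ Icc (0 : ℝ) 1, x + t • (r • e) ∈ U := fun t ht =>
      hU (by rw [mem_closedBall, dist_eq_norm]; exact hmem t ht)
    have hb := ray_bound hW (r := r) (v := r • e) hr0.le (fun i => by
      have h1 : |e i| ≤ ‖e‖ := by
        have := EuclideanSpace.norm_eq e
        have := PiLp.norm_apply_le e i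
        simpa using this
      simp only [PiLp.smul_apply, smul_eq_mul, abs_mul, abs_of_nonneg hr0.le]
      nlinarith) hUe s β hβ
    have hsc := Gw_scale (a := a) (W := W) (δ := 1 / 2) (by norm_num) (by norm_num) hρ
      (β := β) (m := m) (by omega)
    rw [← hr'] at hsc
    have hFc : Continuous fun t : ℝ => Fl d m r W (x + t • (r • e)) :=
      (Fl_cont hW r).comp (by fun_prop)
    have hFn : ∀ y, 0 ≤ Fl d m r W y := fun y => by unfold Fl; positivity
    have h2 : Gw d a W β x ≤ C1 * ∫ t in (0 : ℝ)..1, t ^ s *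
        (rhoModel d 0 x ^ (-a) * Fl d m r W (x + t • (r • e))) := by
      refine hsc.trans ?_
      have e1 : ∫ t in (0 : ℝ)..1, t ^ s *
        (rhoModel d 0 x ^ (-a) * Fl d m r W (x + t • (r • e))) =
        rhoModel d 0 x ^ (-a) * ∫ t in (0 : ℝ)..1, t ^ s * Fl d m r W (x + t • (r • e)) := by
        rw [← intervalIntegral.integral_const_mul]
        congr 1; ext t; ring
      rw [e1]
      have e2 : ((1 / 2 : ℝ))⁻¹ ^ m = 2 ^ m := by norm_num
      rw [e2]
      calc 2 ^ m * (rhoModel d 0 x ^ (-a) * (r ^ (∑ i, β i) * |W β x|))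
          ≤ 2 ^ m * (rhoModel d 0 x ^ (-a) * ((m + d : ℝ) ^ (s + 1) *
            ∫ t in (0 : ℝ)..1, t ^ s * Fl d m r W (x + t • r • e))) := by gcongr
        _ = _ := by rw [hC1]; ring
    refine (ENNReal.ofReal_le_ofReal h2).trans ?_
    rw [ENNReal.ofReal_mul (by positivity), mul_assoc]
    gcongr
    rw [intervalIntegral.integral_of_le zero_le_one, ofReal_integral_eq_lintegral_ofReal]
    · rw [← lintegral_const_mul' _ _ ENNReal.ofReal_ne_top]
      refine setLIntegral_mono_ae' measurableSet_Ioc (Eventually.of_forall fun t ht => ?_)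
      have ht' : t ∈ Icc (0 : ℝ) 1 := ⟨ht.1.le, ht.2⟩
      rw [ENNReal.ofReal_mul (pow_nonneg ht.1.le s), ENNReal.ofReal_pow ht.1.le,
        ENNReal.rpow_natCast]
      have htr := transfer (m := m) (a := a) (W := W) (δ := 1 / 2) (by norm_num) (by norm_num) hρ
        (hmem t ht') (hUe t ht')
      rw [← hr', smul_smul] at htr
      calc ENNReal.ofReal t ^ s * ENNReal.ofReal (rhoModel d 0 x ^ (-a) * Fl d m r W (x + t • r • e))
          ≤ ENNReal.ofReal t ^ s * (ENNReal.ofReal C2 * Fw d m a U W (x + (t * r) • e)) := by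
            rw [smul_smul]; gcongr
        _ = _ := by ring
    · have : Continuous fun t : ℝ => t ^ s * (rhoModel d 0 x ^ (-a) * Fl d m r W (x + t • r • e)) := by
        fun_prop
      exact (this.integrableOn_Icc (a := 0) (b := 1)).mono_set Ioc_subset_Icc_self
    · refine (ae_restrict_iff' measurableSet_Ioc).2 (Eventually.of_forall fun t ht => ?_)
      have := ht.1.le
      have := hFn (x + t • r • e)
      positivity
  -- average
  have hav : ENNReal.ofReal (Gw d a W β x) ≤ ∫⁻ e, ENNReal.ofReal C1 * ENNReal.ofReal C2 *
      (∫⁻ t in Ioc (0 : ℝ) 1, ENNReal.ofReal t ^ (s : ℝ) *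
        Fw d m a U W (x + (t * r) • e)) ∂(Qb d) := by
    have : ENNReal.ofReal (Gw d a W β x) = ∫⁻ _, ENNReal.ofReal (Gw d a W β x) ∂(Qb d) := by simp
    rw [this]
    refine lintegral_mono_ae ?_
    filter_upwards [Qb_ae d] with e he using hdir e he
  refine hav.trans (le_of_eq ?_)
  rw [lintegral_const_mul' _ _ (ENNReal.mul_ne_top ENNReal.ofReal_ne_top ENNReal.ofReal_ne_top)]
  congr 1
  rw [lintegral_lintegral_swap]
  · refine lintegral_congr fun t => ?_
    unfold Mav
    rw [lintegral_const_mul' _ _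
      (ENNReal.rpow_ne_top_of_nonneg (by positivity) ENNReal.ofReal_ne_top)]
  · refine Measurable.aemeasurable ?_
    refine Measurable.mul ?_ (hFm.comp ?_)
    · exact (measurable_snd.ennreal_ofReal).pow_const _
    · exact Continuous.measurable (by fun_prop)

lemma cone_p {d m : ℕ} (a : ℝ) {p : ℝ} (hp : 1 ≤ p) (s : ℕ) {κ : ℝ} (hκ0 : 0 ≤ κ) (hκ : κ < 1) :
    ∃ ν : Measure ℝ, IsFiniteMeasure ν ∧ (∀ᵐ t ∂ν, t ∈ Icc (0 : ℝ) 1) ∧ ∃ C : ℝ≥0∞, C ≠ ∞ ∧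
    ∀ (U : Set (Ed d)) (W : (Fin d → ℕ) → Ed d → ℝ), MeasurableSet U → IsJet d m U W →
      (∀ α, Measurable (W α)) →
    ∀ (x : Ed d), x ≠ 0 → closedBall x (rhoModel d 0 x / 2) ⊆ U →
    ∀ (β : Fin d → ℕ), ∑ i, β i + s ≤ m →
      ENNReal.ofReal (Gw d a W β x) ^ p ≤ C * ∫⁻ t, ENNReal.ofReal t ^ (s * κ * p) *
        Mav d t (fun y => Fw d m a U W y ^ p) x ∂ν := by
  rcases s with _ | s
  · refine ⟨Measure.dirac 0, inferInstance, ?_, 1, by simp, ?_⟩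
    · rw [ae_dirac_eq]; simp
    · intro U W hUm hW hWm x hx hU β hβ
      have hxU : x ∈ U := hU (mem_closedBall_self (by have := rho_pos' hx; positivity))
      rw [lintegral_dirac]
      simp only [Nat.cast_zero, zero_mul, ENNReal.rpow_zero, one_mul, Mav, zero_smul, add_zero,
        lintegral_const, measure_univ, mul_one]
      exact ENNReal.rpow_le_rpow (Gw_le_Fw (by omega) hxU) (by linarith)
  · have hs1 : -1 < ((s + 1 : ℕ) : ℝ) * (1 - κ) - 1 := by
      have : 0 < ((s + 1 : ℕ) : ℝ) * (1 - κ) := mul_pos (by positivity) (by linarith)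
      linarith
    set e := ((s + 1 : ℕ) : ℝ) * (1 - κ) - 1 with he
    set dens : ℝ → ℝ≥0∞ := fun t => ENNReal.ofReal (t ^ e) with hdens
    have hdm : Measurable dens := by fun_prop
    set ν := (volume.restrict (Ioc (0 : ℝ) 1)).withDensity dens with hν
    have hfin : IsFiniteMeasure ν := by
      refine isFiniteMeasure_withDensity ?_
      have h1 : IntegrableOn (fun t : ℝ => t ^ e) (Ioc 0 1) := by
        rw [← intervalIntegrable_iff_integrableOn_Ioc_of_le zero_le_one]
        exact intervalIntegral.intervalIntegrable_rpow' hs1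
      exact h1.lintegral_lt_top.ne
    obtain ⟨C, hC, hcone⟩ := cone_bound (d := d) (m := m) a s
    refine ⟨ν, hfin, ?_, C ^ p * ν univ ^ (p - 1), ?_, ?_⟩
    · have : ν ≪ volume.restrict (Ioc (0 : ℝ) 1) := withDensity_absolutelyContinuous _ _
      refine this.ae_le ?_
      filter_upwards [ae_restrict_mem measurableSet_Ioc] with t ht using ⟨ht.1.le, ht.2⟩
    · refine ENNReal.mul_ne_top (ENNReal.rpow_ne_top_of_nonneg (by linarith) hC)
        (ENNReal.rpow_ne_top_of_nonneg (by linarith) (measure_ne_top _ _))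
    · intro U W hUm hW hWm x hx hU β hβ
      have hFm := Fw_meas (a := a) (m := m) hUm fun α _ => hWm α
      have hMm : Measurable fun t => Mav d t (Fw d m a U W) x :=
        (Mav_meas hFm).comp (by fun_prop : Measurable fun t : ℝ => (t, x))
      have h0 := hcone U W hUm hW hWm x hx hU β (by omega)
      have h1 : ∫⁻ t in Ioc (0 : ℝ) 1, ENNReal.ofReal t ^ (s : ℝ) * Mav d t (Fw d m a U W) x =
          ∫⁻ t, ENNReal.ofReal t ^ (((s + 1 : ℕ) : ℝ) * κ) * Mav d t (Fw d m a U W) x ∂ν := by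
        rw [hν, lintegral_withDensity_eq_lintegral_mul _ hdm (by fun_prop)]
        refine setLIntegral_congr_fun measurableSet_Ioc fun t ht => ?_
        simp only [Pi.mul_apply, hdens]
        rw [← mul_assoc, ENNReal.ofReal_rpow_of_pos ht.1, ENNReal.ofReal_rpow_of_pos ht.1,
          ← ENNReal.ofReal_mul (Real.rpow_nonneg ht.1.le _), ← Real.rpow_add ht.1]
        congr 3
        rw [he]; push_cast; ring
      rw [h1] at h0
      refine (ENNReal.rpow_le_rpow h0 (by linarith : 0 ≤ p)).trans ?_
      rw [ENNReal.mul_rpow_of_nonneg _ _ (by linarith : 0 ≤ p), mul_assoc]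
      gcongr
      refine (jensen_lintegral ν hp (by fun_prop)).trans ?_
      gcongr with t
      rw [ENNReal.mul_rpow_of_nonneg _ _ (by linarith : 0 ≤ p), ← ENNReal.rpow_mul]
      gcongr
      unfold Mav
      have := jensen_lintegral (Qb d) hp
        (f := fun e => Fw d m a U W (x + (t * (rhoModel d 0 x / 2)) • e))
        ((hFm.comp (by fun_prop)).aemeasurable)
      simpa using this

/-- bilinear estimate for a pair of multi-indices -/
def EBound (d m : ℕ) (a p : ℝ) (β κ : Fin d → ℕ) : Prop :=
  ∃ C : ℝ≥0∞, C ≠ ∞ ∧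
    ∀ (U V : Set (Ed d)) (W Z : (Fin d → ℕ) → Ed d → ℝ), MeasurableSet U → MeasurableSet V →
      IsJet d m U W → IsJet d m U Z → (∀ α, Measurable (W α)) → (∀ α, Measurable (Z α)) →
      (∀ x ∈ V, x ≠ 0 ∧ closedBall x (rhoModel d 0 x / 2) ⊆ U) →
      ∫⁻ x in V, ENNReal.ofReal (rhoModel d 0 x ^ (((∑ i, β i + ∑ i, κ i : ℕ) : ℝ) - a) *
        |W β x * Z κ x|) ^ p ≤ C * Nrm d m a p U W * Nrm d m a p U Z

lemma weight_split {d : ℕ} {a p : ℝ} (hp : 1 ≤ p) (ha : (d : ℝ) / p ≤ a) {x : Ed d} (hx : x ≠ 0)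
    (W Z : (Fin d → ℕ) → Ed d → ℝ) (β κ : Fin d → ℕ) :
    ENNReal.ofReal (rhoModel d 0 x ^ (((∑ i, β i + ∑ i, κ i : ℕ) : ℝ) - a) *
        |W β x * Z κ x|) ^ p ≤ ENNReal.ofReal (rhoModel d 0 x) ^ (d : ℝ) *
      (ENNReal.ofReal (Gw d a W β x) ^ p * ENNReal.ofReal (Gw d a Z κ x) ^ p) := by
  have hρ := rho_pos' hx
  have hp0 : 0 ≤ p := by linarith
  have e : rhoModel d 0 x ^ (((∑ i, β i + ∑ i, κ i : ℕ) : ℝ) - a) * |W β x * Z κ x| =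
      rhoModel d 0 x ^ a * (Gw d a W β x * Gw d a Z κ x) := by
    unfold Gw
    have : rhoModel d 0 x ^ (((∑ i, β i + ∑ i, κ i : ℕ) : ℝ) - a) = rhoModel d 0 x ^ a *
      (rhoModel d 0 x ^ (((∑ i, β i : ℕ) : ℝ) - a) * rhoModel d 0 x ^ (((∑ i, κ i : ℕ) : ℝ) - a)) := by
      rw [← Real.rpow_add hρ, ← Real.rpow_add hρ]
      congr 1; push_cast; ring
    rw [this, abs_mul]; ring
  rw [e, ENNReal.ofReal_mul (by positivity), ENNReal.ofReal_mul Gw_nonneg,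
    ENNReal.mul_rpow_of_nonneg _ _ hp0, ENNReal.mul_rpow_of_nonneg _ _ hp0]
  gcongr
  rw [← ENNReal.ofReal_rpow_of_pos hρ, ← ENNReal.rpow_mul]
  refine ENNReal.rpow_le_rpow_of_exponent_ge ?_ ?_
  · rw [← ENNReal.ofReal_one]; exact ENNReal.ofReal_le_ofReal (rho_le_one x)
  · rwa [div_le_iff₀ (by linarith)] at ha

lemma E1 {d m : ℕ} (hd : 2 ≤ d) {a p : ℝ} (hp : 1 ≤ p) (hm : (d : ℝ) / p < m)
    (ha : (d : ℝ) / p ≤ a) {β κ : Fin d → ℕ} (hβκ : ∑ i, β i + ∑ i, κ i ≤ m) :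
    EBound d m a p β κ := by
  obtain ⟨s, hs⟩ : ∃ s, ∑ i, β i + s = m := ⟨m - ∑ i, β i, by omega⟩
  obtain ⟨σ, hσ⟩ : ∃ s, ∑ i, κ i + s = m := ⟨m - ∑ i, κ i, by omega⟩
  have hp0 : 0 < p := by linarith
  have hdp : 0 < (d : ℝ) / p := div_pos (by exact_mod_cast (by omega : 0 < d)) hp0
  have hsσ : (m : ℝ) ≤ s + σ := by exact_mod_cast (by omega : m ≤ s + σ)
  have hpos : (0 : ℝ) < s + σ := by linarith
  set k : ℝ := (d : ℝ) / p / (s + σ) with hk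
  have hk0 : 0 ≤ k := by positivity
  have hk1 : k < 1 := by rw [hk, div_lt_one hpos]; linarith
  obtain ⟨ν1, hf1, hI1, C1, hC1, hb1⟩ := cone_p (d := d) (m := m) a hp s hk0 hk1
  obtain ⟨ν2, hf2, hI2, C2, hC2, hb2⟩ := cone_p (d := d) (m := m) a hp σ hk0 hk1
  set N := ((multiIdx d m).card : ℝ≥0∞) ^ (p - 1) with hN
  have hNt : N ≠ ∞ := ENNReal.rpow_ne_top_of_nonneg (by linarith) (by simp)
  refine ⟨C1 * C2 * (Kcst d * (ν1.prod ν2) univ) * N * N, ?_, ?_⟩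
  · exact ENNReal.mul_ne_top (ENNReal.mul_ne_top (ENNReal.mul_ne_top (ENNReal.mul_ne_top hC1 hC2)
      (ENNReal.mul_ne_top (Kcst_ne_top d) (measure_ne_top _ _))) hNt) hNt
  intro U V W Z hU hV hW hZ hWm hZm hUV
  have hF1 := Fw_meas (a := a) (m := m) hU fun α _ => hWm α
  have hF2 := Fw_meas (a := a) (m := m) hU fun α _ => hZm α
  set h1 : Ed d → ℝ≥0∞ := fun y => Fw d m a U W y ^ p with hh1
  set h2 : Ed d → ℝ≥0∞ := fun y => Fw d m a U Z y ^ p with hh2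
  have hm1 : Measurable h1 := hF1.pow_const _
  have hm2 : Measurable h2 := hF2.pow_const _
  have hM1 : Measurable fun q : ℝ × Ed d => Mav d q.1 h1 q.2 := Mav_meas hm1
  have hM2 : Measurable fun q : ℝ × Ed d => Mav d q.1 h2 q.2 := Mav_meas hm2
  have hρm : Measurable (rhoModel d 0) := continuous_rhoModel.measurable
  set Ψ : Ed d → ℝ × ℝ → ℝ≥0∞ := fun x q => ENNReal.ofReal (rhoModel d 0 x) ^ (d : ℝ) *
    ((ENNReal.ofReal q.1 ^ (s * k * p) * Mav d q.1 h1 x) *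
      (ENNReal.ofReal q.2 ^ (σ * k * p) * Mav d q.2 h2 x)) with hΨ
  have hA : ∀ x : Ed d, Measurable fun t : ℝ => Mav d t h1 x := fun x =>
    hM1.comp (by fun_prop : Measurable fun t : ℝ => (t, x))
  have hB : ∀ x : Ed d, Measurable fun t : ℝ => Mav d t h2 x := fun x =>
    hM2.comp (by fun_prop : Measurable fun t : ℝ => (t, x))
  calc ∫⁻ x in V, ENNReal.ofReal (rhoModel d 0 x ^ (((∑ i, β i + ∑ i, κ i : ℕ) : ℝ) - a) *
        |W β x * Z κ x|) ^ p
      ≤ ∫⁻ x in V, C1 * C2 * ∫⁻ q, Ψ x q ∂(ν1.prod ν2) := by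
        refine setLIntegral_mono_ae' hV (Eventually.of_forall fun x hx => ?_)
        obtain ⟨hx0, hxU⟩ := hUV x hx
        refine (weight_split hp ha hx0 W Z β κ).trans ?_
        have hb1' := hb1 U W hU hW hWm x hx0 hxU β hs.le
        have hb2' := hb2 U Z hU hZ hZm x hx0 hxU κ hσ.le
        rw [hΨ, lintegral_const_mul' _ _
          (ENNReal.rpow_ne_top_of_nonneg (by positivity) ENNReal.ofReal_ne_top),
          lintegral_prod_mul (f := fun t => ENNReal.ofReal t ^ (s * k * p) * Mav d t h1 x)
            (g := fun t => ENNReal.ofReal t ^ (σ * k * p) * Mav d t h2 x)]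
        · refine (mul_le_mul_right (mul_le_mul' hb1' hb2') _).trans (le_of_eq ?_)
          ring
        · have := hA x
          fun_prop
        · have := hB x
          fun_prop
    _ ≤ ∫⁻ x, C1 * C2 * ∫⁻ q, Ψ x q ∂(ν1.prod ν2) := setLIntegral_le_lintegral _ _
    _ = C1 * C2 * ∫⁻ q, (∫⁻ x, Ψ x q) ∂(ν1.prod ν2) := by
        rw [lintegral_const_mul' _ _ (ENNReal.mul_ne_top hC1 hC2), lintegral_lintegral_swap]
        refine Measurable.aemeasurable ?_
        have e1 : Measurable fun z : Ed d × ℝ × ℝ => Mav d z.2.1 h1 z.1 :=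
          hM1.comp (by fun_prop : Measurable fun z : Ed d × ℝ × ℝ => (z.2.1, z.1))
        have e2 : Measurable fun z : Ed d × ℝ × ℝ => Mav d z.2.2 h2 z.1 :=
          hM2.comp (by fun_prop : Measurable fun z : Ed d × ℝ × ℝ => (z.2.2, z.1))
        simp only [hΨ, Function.uncurry_def]
        fun_prop
    _ ≤ C1 * C2 * ∫⁻ q, Kcst d * (∫⁻ y, h1 y) * (∫⁻ y, h2 y) ∂(ν1.prod ν2) := by
        refine mul_le_mul_right ?_ _
        refine lintegral_mono_ae ?_
        have i1 : ∀ᵐ q ∂(ν1.prod ν2), q.1 ∈ Icc (0 : ℝ) 1 := Measure.quasiMeasurePreserving_fst.ae hI1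
        have i2 : ∀ᵐ q ∂(ν1.prod ν2), q.2 ∈ Icc (0 : ℝ) 1 := Measure.quasiMeasurePreserving_snd.ae hI2
        filter_upwards [i1, i2] with q hq1 hq2
        have := Mav_prod hd hm1 hm2 hq1 hq2 (μ := s * k * p) (ν := σ * k * p) (by positivity)
          (by positivity) (by rw [hk]; field_simp)
        refine le_trans (le_of_eq ?_) this
        rw [← lintegral_const_mul' _ _ (ENNReal.mul_ne_top
          (ENNReal.rpow_ne_top_of_nonneg (by positivity) ENNReal.ofReal_ne_top)
          (ENNReal.rpow_ne_top_of_nonneg (by positivity) ENNReal.ofReal_ne_top))]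
        refine lintegral_congr fun x => ?_
        simp only [hΨ]
        ring
    _ = C1 * C2 * (Kcst d * (ν1.prod ν2) univ) * (∫⁻ y, h1 y) * (∫⁻ y, h2 y) := by
        rw [lintegral_const]; ring
    _ ≤ C1 * C2 * (Kcst d * (ν1.prod ν2) univ) * (N * Nrm d m a p U W) * (N * Nrm d m a p U Z) := by
        have g1 := Fw_int (a := a) (m := m) hp hU (W := W) fun α _ => hWm α
        have g2 := Fw_int (a := a) (m := m) hp hU (W := Z) fun α _ => hZm α
        exact mul_le_mul' (mul_le_mul' le_rfl g1) g2
    _ = _ := by ring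

/-- marginal integral with respect to Lebesgue measure -/
def lm (d : ℕ) (S : Finset (Fin d)) (F : (Fin d → ℝ) → ℝ≥0∞) : (Fin d → ℝ) → ℝ≥0∞ :=
  lmarginal (fun _ => (volume : Measure ℝ)) S F

lemma lm_fubini {d : ℕ} (S : Finset (Fin d)) {F G : (Fin d → ℝ) → ℝ≥0∞} (hF : Measurable F)
    (hG : Measurable G) :
    ∫⁻ z, lm d S F z * lm d Sᶜ G z = (∫⁻ z, F z) * ∫⁻ z, G z := by
  have hA : Measurable (lm d S F) := hF.lmarginal _
  have hB : Measurable (lm d Sᶜ G) := hG.lmarginal _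
  have hu : S ∪ Sᶜ = Finset.univ := by ext i; by_cases h : i ∈ S <;> simp [h]
  have hu' : Sᶜ ∪ S = Finset.univ := by ext i; by_cases h : i ∈ S <;> simp [h]
  have huni : ∀ f : (Fin d → ℝ) → ℝ≥0∞, lm d Finset.univ f = fun _ => ∫⁻ z, f z := by
    intro f; unfold lm; rw [lmarginal_univ, volume_pi]
  have h1 : lm d Sᶜ (fun z => lm d S F z * lm d Sᶜ G z) =
      fun z => (∫⁻ z, F z) * lm d Sᶜ G z := by
    ext z
    have e1 : ∀ y, lm d Sᶜ G (Function.updateFinset z Sᶜ y) = lm d Sᶜ G z := by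
      intro y
      refine lmarginal_congr _ _ fun i hi => ?_
      simp [Function.updateFinset, hi]
    have e2 : lm d Sᶜ (lm d S F) z = ∫⁻ z, F z := by
      have := lmarginal_union (fun _ : Fin d => (volume : Measure ℝ)) F hF (s := Sᶜ) (t := S)
        disjoint_compl_left
      have h3 : lm d (Sᶜ ∪ S) F = lm d Sᶜ (lm d S F) := this
      rw [← h3, hu', huni]
    have hm : Measurable fun y => lm d S F (Function.updateFinset z Sᶜ y) :=
      hA.comp measurable_updateFinset
    rw [← e2]
    have e3 : lm d Sᶜ (fun z => lm d S F z * lm d Sᶜ G z) z = ∫⁻ y,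
      lm d S F (Function.updateFinset z Sᶜ y) * lm d Sᶜ G (Function.updateFinset z Sᶜ y) := rfl
    rw [e3]
    simp_rw [e1]
    exact lintegral_mul_const _ hm
  have h2 : lm d Finset.univ (fun z => lm d S F z * lm d Sᶜ G z) =
      fun _ => (∫⁻ z, F z) * ∫⁻ z, G z := by
    have h3 : lm d (S ∪ Sᶜ) (fun z => lm d S F z * lm d Sᶜ G z) =
      lm d S (lm d Sᶜ (fun z => lm d S F z * lm d Sᶜ G z)) :=
      lmarginal_union _ _ (hA.mul hB) disjoint_compl_right
    have h4 : lm d (S ∪ Sᶜ) G = lm d S (lm d Sᶜ G) := lmarginal_union _ _ hG disjoint_compl_right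
    rw [hu] at h3 h4
    rw [h3, h1]
    ext z
    have h5 : ∫⁻ z, G z = lm d S (lm d Sᶜ G) z := by rw [← h4, huni]
    rw [h5]
    have hm : Measurable fun y => lm d Sᶜ G (Function.updateFinset z S y) :=
      hB.comp measurable_updateFinset
    exact lintegral_const_mul _ hm
  rw [huni] at h2
  exact congrFun h2 0

lemma toLp_update {d : ℕ} (y : Fin d → ℝ) (i : Fin d) (r t : ℝ) :
    (WithLp.toLp 2 (Function.update y i (y i + r * t)) : Ed d) =
      WithLp.toLp 2 y + t • EuclideanSpace.single i r := by
  ext j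
  by_cases hj : j = i
  · subst hj; simp [mul_comm]
  · simp [hj]

lemma coord_bound' {d m : ℕ} {U : Set (Ed d)} {W : (Fin d → ℕ) → Ed d → ℝ} (h : IsJet d m U W)
    {y : Fin d → ℝ} {r : ℝ} (hr : 0 ≤ r) (i : Fin d)
    (hU : ∀ ξ ∈ Icc (y i) (y i + r), WithLp.toLp 2 (Function.update y i ξ) ∈ U) (β : Fin d → ℕ)
    (hβ : ∑ i, β i + 1 ≤ m) :
    ENNReal.ofReal r * ENNReal.ofReal |W β (WithLp.toLp 2 y)| ≤
      ∫⁻ ξ in Icc (y i) (y i + r),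
        (ENNReal.ofReal |W β (WithLp.toLp 2 (Function.update y i ξ))| + ENNReal.ofReal (r *
          |W (β + Pi.single i 1) (WithLp.toLp 2 (Function.update y i ξ))|)) := by
  have hb := coord_bound h (x := WithLp.toLp 2 y) hr i (fun t ht => by
    rw [← toLp_update]
    exact hU _ ⟨by nlinarith [ht.1, ht.2], by nlinarith [ht.1, ht.2]⟩) β hβ
  simp_rw [← toLp_update] at hb
  set g : ℝ → ℝ := fun ξ => |W β (WithLp.toLp 2 (Function.update y i ξ))| + r *
          |W (β + Pi.single i 1) (WithLp.toLp 2 (Function.update y i ξ))| with hg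
  have hup : Continuous fun ξ : ℝ => (WithLp.toLp 2 (Function.update y i ξ) : Ed d) :=
    (PiLp.continuous_toLp 2 _).comp (continuous_const.update i continuous_id)
  have hgc : Continuous g := by
    have h1 := (h.1 β (by omega)).comp hup
    have h2 := (h.1 (β + Pi.single i 1) (by rw [sum_add_single]; omega)).comp hup
    simp only [Function.comp_def] at h1 h2
    exact h1.abs.add (continuous_const.mul h2.abs)
  have hsub : r * ∫ t in (0 : ℝ)..1, g (y i + r * t) = ∫ ξ in (y i)..(y i + r), g ξ := by
    have := intervalIntegral.smul_integral_comp_add_mul (a := 0) (b := 1) g r (y i)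
    simpa using this
  have h2 : r * |W β (WithLp.toLp 2 y)| ≤ ∫ ξ in (y i)..(y i + r), g ξ := by
    rw [← hsub]; exact mul_le_mul_of_nonneg_left hb hr
  rw [← ENNReal.ofReal_mul hr]
  refine (ENNReal.ofReal_le_ofReal h2).trans ?_
  rw [intervalIntegral.integral_of_le (by linarith), ← integral_Icc_eq_integral_Ioc,
    ofReal_integral_eq_lintegral_ofReal (hgc.integrableOn_Icc)
      (Eventually.of_forall fun ξ => by simp only [hg, Pi.zero_apply]; positivity)]
  refine lintegral_mono fun ξ => ?_
  simp only [hg]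
  rw [ENNReal.ofReal_add (abs_nonneg _) (by positivity)]

set_option maxHeartbeats 800000 in
lemma tens_aux {d m : ℕ} {U : Set (Ed d)} {W : (Fin d → ℕ) → Ed d → ℝ} (h : IsJet d m U W)
    (x : Fin d → ℝ) {r : ℝ} (hr : 0 ≤ r) (B : Set (Fin d → ℝ))
    (hB : B = {z | ∀ i, z i ∈ Icc (x i) (x i + r)}) (hBU : ∀ z ∈ B, WithLp.toLp 2 z ∈ U)
    (H : (Fin d → ℝ) → ℝ≥0∞)
    (hH : H = B.indicator fun z => ENNReal.ofReal (Fl d m r W (WithLp.toLp 2 z)))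
    (S : Finset (Fin d)) : ∀ y ∈ B, (∀ i ∈ S, y i = x i) → ∀ β : Fin d → ℕ,
      ∑ i, β i + S.card ≤ m →
      ENNReal.ofReal r ^ S.card * ENNReal.ofReal (r ^ (∑ i, β i) * |W β (WithLp.toLp 2 y)|) ≤
        2 ^ S.card * lm d S H y := by
  have hBm : MeasurableSet B := by
    rw [hB]
    have : {z : Fin d → ℝ | ∀ i, z i ∈ Icc (x i) (x i + r)} =
      ⋂ i, (fun z : Fin d → ℝ => z i) ⁻¹' Icc (x i) (x i + r) := by ext; simp
    rw [this]
    exact MeasurableSet.iInter fun i => measurable_pi_apply i measurableSet_Icc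
  have hHm : Measurable H := by
    rw [hH]
    refine Measurable.indicator ?_ hBm
    have : Continuous fun z : Fin d → ℝ => Fl d m r W (WithLp.toLp 2 z) :=
      (Fl_cont h r).comp (PiLp.continuous_toLp 2 _)
    exact this.measurable.ennreal_ofReal
  induction S using Finset.induction with
  | empty =>
    intro y hy _ β hβ
    have : lm d ∅ H y = H y := by unfold lm; rw [lmarginal_empty]
    rw [this]
    simp only [Finset.card_empty, pow_zero, one_mul, hH, indicator_of_mem hy]
    exact ENNReal.ofReal_le_ofReal (Fl_ge hr (by simpa using hβ) _)
  | insert i S hi ih =>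
    intro y hy hyS β hβ
    rw [Finset.card_insert_of_notMem hi] at hβ ⊢
    have hyi : y i = x i := hyS i (by simp)
    have hupB : ∀ ξ ∈ Icc (y i) (y i + r), Function.update y i ξ ∈ B := by
      intro ξ hξ
      rw [hB] at hy ⊢
      intro j
      by_cases hj : j = i
      · subst hj; rw [hyi] at hξ; simpa using hξ
      · simpa [hj] using hy j
    have hcb := coord_bound' h (y := y) hr i (fun ξ hξ => hBU _ (hupB ξ hξ)) β (by omega)
    have hins : lm d (insert i S) H y = ∫⁻ ξ, lm d S H (Function.update y i ξ) :=
      lmarginal_insert H hHm hi y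
    have hupS : ∀ ξ : ℝ, ∀ j ∈ S, Function.update y i ξ j = x j := by
      intro ξ j hj
      have hne : j ≠ i := fun h => hi (h ▸ hj)
      rw [Function.update_of_ne hne]
      exact hyS j (by simp [hj])
    rw [hins]
    have hne : ENNReal.ofReal r ^ S.card * ENNReal.ofReal (r ^ (∑ i, β i)) ≠ ∞ :=
      ENNReal.mul_ne_top (ENNReal.pow_ne_top ENNReal.ofReal_ne_top) ENNReal.ofReal_ne_top
    calc ENNReal.ofReal r ^ (S.card + 1) *
        ENNReal.ofReal (r ^ (∑ i, β i) * |W β (WithLp.toLp 2 y)|)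
        = (ENNReal.ofReal r ^ S.card * ENNReal.ofReal (r ^ (∑ i, β i))) *
          (ENNReal.ofReal r * ENNReal.ofReal |W β (WithLp.toLp 2 y)|) := by
          rw [ENNReal.ofReal_mul (by positivity)]; ring
      _ ≤ _ := mul_le_mul_right hcb _
      _ = ∫⁻ ξ in Icc (y i) (y i + r), (ENNReal.ofReal r ^ S.card *
          ENNReal.ofReal (r ^ (∑ i, β i) * |W β (WithLp.toLp 2 (Function.update y i ξ))|) +
          ENNReal.ofReal r ^ S.card * ENNReal.ofReal (r ^ (∑ j, (β + Pi.single i 1 : Fin d → ℕ) j) *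
            |W (β + Pi.single i 1) (WithLp.toLp 2 (Function.update y i ξ))|)) := by
          rw [← lintegral_const_mul' _ _ hne]
          refine lintegral_congr fun ξ => ?_
          rw [sum_add_single, pow_succ (a := r), mul_assoc (r ^ _), ENNReal.ofReal_mul (by positivity : 0 ≤ r ^ (∑ i, β i)),
            ENNReal.ofReal_mul (by positivity : 0 ≤ r ^ (∑ i, β i))]
          ring
      _ ≤ ∫⁻ ξ in Icc (y i) (y i + r), (2 ^ (S.card + 1) * lm d S H (Function.update y i ξ)) := by
          refine setLIntegral_mono_ae' measurableSet_Icc (Eventually.of_forall fun ξ hξ => ?_)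
          refine (add_le_add (ih _ (hupB ξ hξ) (hupS ξ) β (by omega))
            (ih _ (hupB ξ hξ) (hupS ξ) (β + Pi.single i 1)
              (by rw [sum_add_single]; omega))).trans (le_of_eq ?_)
          rw [pow_succ]; ring
      _ ≤ ∫⁻ ξ, (2 ^ (S.card + 1) * lm d S H (Function.update y i ξ)) :=
          setLIntegral_le_lintegral _ _
      _ = _ := lintegral_const_mul' _ _ (by simp)

lemma norm_le_box {d : ℕ} {z : Ed d} {r : ℝ} (hr : 0 ≤ r) (h : ∀ i, |z i| ≤ r) : ‖z‖ ≤ d * r := by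
  rw [EuclideanSpace.norm_eq]
  refine Real.sqrt_le_iff.2 ⟨by positivity, ?_⟩
  calc ∑ i, ‖z i‖ ^ 2 ≤ ∑ _i : Fin d, r ^ 2 := by
        refine Finset.sum_le_sum fun i _ => ?_
        rw [Real.norm_eq_abs]
        exact pow_le_pow_left₀ (abs_nonneg _) (h i) 2
    _ = d * r ^ 2 := by simp
    _ ≤ (d * r) ^ 2 := by
        have : (d : ℝ) ≤ d ^ 2 := by exact_mod_cast Nat.le_self_pow (by norm_num) d
        rw [mul_pow]
        gcongr

lemma tens_bound {d m : ℕ} (hd : 2 ≤ d) (a : ℝ) (S : Finset (Fin d)) : ∃ C : ℝ≥0∞, C ≠ ∞ ∧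
    ∀ (U : Set (Ed d)) (W : (Fin d → ℕ) → Ed d → ℝ), IsJet d m U W →
    ∀ (x : Ed d), x ≠ 0 → closedBall x (rhoModel d 0 x / 2) ⊆ U →
    ∀ (β : Fin d → ℕ), ∑ i, β i + S.card ≤ m →
      ENNReal.ofReal (rhoModel d 0 x) ^ S.card * ENNReal.ofReal (Gw d a W β x) ≤
        C * lm d S (fun z => Fw d m a U W (WithLp.toLp 2 z)) (WithLp.ofLp x) := by
  have hd0 : (0 : ℝ) < d := by exact_mod_cast (by omega : 0 < d)
  have hd1 : (1 : ℝ) ≤ d := by exact_mod_cast (by omega : 1 ≤ d)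
  set δ : ℝ := (2 * d)⁻¹ with hδ
  have hδ0 : 0 < δ := by positivity
  have hδ1 : δ ≤ 1 := inv_le_one_of_one_le₀ (by linarith)
  refine ⟨ENNReal.ofReal (δ⁻¹ ^ S.card) * ENNReal.ofReal (δ⁻¹ ^ m) * 2 ^ S.card *
    ENNReal.ofReal (2 ^ (m + |a|)), ?_, ?_⟩
  · exact ENNReal.mul_ne_top (ENNReal.mul_ne_top (ENNReal.mul_ne_top ENNReal.ofReal_ne_top
      ENNReal.ofReal_ne_top) (by simp)) ENNReal.ofReal_ne_top
  intro U W hW x hx hU β hβ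
  have hρ := rho_pos' hx
  set r := δ * rhoModel d 0 x with hr
  have hr0 : 0 < r := by positivity
  set B : Set (Fin d → ℝ) := {z | ∀ i, z i ∈ Icc (x i) (x i + r)} with hB
  have hBn : ∀ z ∈ B, ‖WithLp.toLp 2 z - x‖ ≤ rhoModel d 0 x / 2 := by
    intro z hz
    have := norm_le_box (z := WithLp.toLp 2 z - x) hr0.le (fun i => by
      have := hz i
      simp only [PiLp.sub_apply]
      rw [abs_le]; constructor <;> linarith [this.1, this.2])
    refine this.trans (le_of_eq ?_)
    rw [hr, hδ]; field_simp
  have hBU : ∀ z ∈ B, WithLp.toLp 2 z ∈ U := fun z hz => hU (by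
    rw [mem_closedBall, dist_eq_norm]; exact hBn z hz)
  set H : (Fin d → ℝ) → ℝ≥0∞ :=
    B.indicator fun z => ENNReal.ofReal (Fl d m r W (WithLp.toLp 2 z)) with hH
  have hxB : WithLp.ofLp x ∈ B := fun i => ⟨le_rfl, by linarith⟩
  have h1 := tens_aux hW (WithLp.ofLp x) hr0.le B hB hBU H hH S _ hxB (fun _ _ => rfl) β hβ
  have h2 : ENNReal.ofReal (rhoModel d 0 x ^ (-a)) * lm d S H (WithLp.ofLp x) ≤
      ENNReal.ofReal (2 ^ (m + |a|)) *
        lm d S (fun z => Fw d m a U W (WithLp.toLp 2 z)) (WithLp.ofLp x) := by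
    unfold lm lmarginal
    rw [← lintegral_const_mul' _ _ ENNReal.ofReal_ne_top,
      ← lintegral_const_mul' _ _ ENNReal.ofReal_ne_top]
    refine lintegral_mono fun y => ?_
    set z := Function.updateFinset (WithLp.ofLp x) S y
    simp only [hH]
    by_cases hz : z ∈ B
    · rw [indicator_of_mem hz, ← ENNReal.ofReal_mul (by positivity)]
      exact transfer hδ0 hδ1 hρ (hBn z hz) (hBU z hz)
    · rw [indicator_of_notMem hz]; simp
  have h3 := ENNReal.ofReal_le_ofReal (Gw_scale (a := a) (W := W) hδ0 hδ1 hρ (β := β) (m := m) (by omega))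
  rw [ENNReal.ofReal_mul (by positivity), ENNReal.ofReal_mul (by positivity)] at h3
  have h4 : ENNReal.ofReal (rhoModel d 0 x) ^ S.card =
      ENNReal.ofReal (δ⁻¹ ^ S.card) * ENNReal.ofReal r ^ S.card := by
    rw [← ENNReal.ofReal_pow hρ.le, ← ENNReal.ofReal_pow hr0.le, ← ENNReal.ofReal_mul (by positivity),
      ← mul_pow, hr, inv_mul_cancel_left₀ hδ0.ne']
  rw [h4]
  calc _ ≤ ENNReal.ofReal (δ⁻¹ ^ S.card) * ENNReal.ofReal r ^ S.card * _ := mul_le_mul_right h3 _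
    _ = ENNReal.ofReal (δ⁻¹ ^ S.card) * ENNReal.ofReal (δ⁻¹ ^ m) *
        (ENNReal.ofReal (rhoModel d 0 x ^ (-a)) * (ENNReal.ofReal r ^ S.card *
          ENNReal.ofReal (r ^ (∑ i, β i) * |W β x|))) := by ring
    _ ≤ ENNReal.ofReal (δ⁻¹ ^ S.card) * ENNReal.ofReal (δ⁻¹ ^ m) *
        (ENNReal.ofReal (rhoModel d 0 x ^ (-a)) * (2 ^ S.card * lm d S H (WithLp.ofLp x))) := by
        refine mul_le_mul_right (mul_le_mul_right ?_ _) _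
        exact h1
    _ = ENNReal.ofReal (δ⁻¹ ^ S.card) * ENNReal.ofReal (δ⁻¹ ^ m) * 2 ^ S.card *
        (ENNReal.ofReal (rhoModel d 0 x ^ (-a)) * lm d S H (WithLp.ofLp x)) := by ring
    _ ≤ ENNReal.ofReal (δ⁻¹ ^ S.card) * ENNReal.ofReal (δ⁻¹ ^ m) * 2 ^ S.card * _ :=
        mul_le_mul_right h2 _
    _ = _ := by ring

lemma E2 {d m : ℕ} (hd : 2 ≤ d) {a : ℝ} (hm : d ≤ m)
    (ha : (d : ℝ) / 1 ≤ a) {β κ : Fin d → ℕ} (hβκ : ∑ i, β i + ∑ i, κ i ≤ m) :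
    EBound d m a 1 β κ := by
  obtain ⟨S, hS1, hS2⟩ : ∃ S : Finset (Fin d), ∑ i, β i + S.card ≤ m ∧ ∑ i, κ i + Sᶜ.card ≤ m := by
    obtain ⟨S, hS⟩ := Finset.exists_subset_card_eq (s := (Finset.univ : Finset (Fin d)))
      (n := min d (m - ∑ i, β i)) (by simp)
    have hc : Sᶜ.card = d - S.card := by rw [Finset.card_compl, Fintype.card_fin]
    exact ⟨S, by omega, by omega⟩
  obtain ⟨C1, hC1, hb1⟩ := tens_bound (m := m) hd a S
  obtain ⟨C2, hC2, hb2⟩ := tens_bound (m := m) hd a Sᶜ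
  refine ⟨C1 * C2, ENNReal.mul_ne_top hC1 hC2, ?_⟩
  intro U V W Z hU hV hW hZ hWm hZm hUV
  have hF1 := Fw_meas (a := a) (m := m) hU fun α _ => hWm α
  have hF2 := Fw_meas (a := a) (m := m) hU fun α _ => hZm α
  have htl : Measurable fun z : Fin d → ℝ => (WithLp.toLp 2 z : Ed d) :=
    (PiLp.continuous_toLp 2 _).measurable
  have hf1 : Measurable (fun z : Fin d → ℝ => Fw d m a U W (WithLp.toLp 2 z)) := hF1.comp htl
  have hf2 : Measurable (fun z : Fin d → ℝ => Fw d m a U Z (WithLp.toLp 2 z)) := hF2.comp htl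
  have hto : ∀ F : Ed d → ℝ≥0∞, Measurable F → ∫⁻ z : Fin d → ℝ, F (WithLp.toLp 2 z) = ∫⁻ x, F x :=
    fun F hF => (PiLp.volume_preserving_toLp (Fin d)).lintegral_comp hF
  calc _ ≤ ∫⁻ x in V, C1 * C2 * (lm d S (fun z => Fw d m a U W (WithLp.toLp 2 z)) (WithLp.ofLp x) *
          lm d Sᶜ (fun z => Fw d m a U Z (WithLp.toLp 2 z)) (WithLp.ofLp x)) := by
        refine setLIntegral_mono_ae' hV (Eventually.of_forall fun x hx => ?_)
        obtain ⟨hx0, hxU⟩ := hUV x hx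
        refine (weight_split le_rfl ha hx0 W Z β κ).trans ?_
        have hb1' := hb1 U W hW x hx0 hxU β hS1
        have hb2' := hb2 U Z hZ x hx0 hxU κ hS2
        have hcard : (d : ℝ) = ((S.card + Sᶜ.card : ℕ) : ℝ) := by
          rw [Finset.card_add_card_compl, Fintype.card_fin]
        rw [ENNReal.rpow_one, ENNReal.rpow_one]
        rw [show ENNReal.ofReal (rhoModel d 0 x) ^ (d : ℝ) = ENNReal.ofReal (rhoModel d 0 x) ^ S.card *
          ENNReal.ofReal (rhoModel d 0 x) ^ Sᶜ.card by rw [hcard, ENNReal.rpow_natCast, pow_add]]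
        calc _ = _ := mul_mul_mul_comm _ _ _ _
          _ ≤ _ := mul_le_mul' hb1' hb2'
          _ = _ := by ring
    _ ≤ ∫⁻ x, C1 * C2 * (lm d S (fun z => Fw d m a U W (WithLp.toLp 2 z)) (WithLp.ofLp x) *
          lm d Sᶜ (fun z => Fw d m a U Z (WithLp.toLp 2 z)) (WithLp.ofLp x)) :=
        setLIntegral_le_lintegral _ _
    _ = C1 * C2 * ∫⁻ z : Fin d → ℝ, (lm d S (fun z => Fw d m a U W (WithLp.toLp 2 z)) z *
          lm d Sᶜ (fun z => Fw d m a U Z (WithLp.toLp 2 z)) z) := by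
        rw [lintegral_const_mul' _ _ (ENNReal.mul_ne_top hC1 hC2)]
        congr 1
        have hmm : Measurable fun z : Fin d → ℝ =>
          (lm d S (fun z => Fw d m a U W (WithLp.toLp 2 z)) z *
          lm d Sᶜ (fun z => Fw d m a U Z (WithLp.toLp 2 z)) z) :=
          (hf1.lmarginal _).mul (hf2.lmarginal _)
        exact (PiLp.volume_preserving_ofLp (Fin d)).lintegral_comp hmm
    _ = C1 * C2 * ((∫⁻ x, Fw d m a U W x) * ∫⁻ x, Fw d m a U Z x) := by
        rw [lm_fubini S hf1 hf2, hto _ hF1, hto _ hF2]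
    _ ≤ C1 * C2 * (Nrm d m a 1 U W * Nrm d m a 1 U Z) := by
        have g1 := Fw_int (a := a) (m := m) le_rfl hU (W := W) fun α _ => hWm α
        have g2 := Fw_int (a := a) (m := m) le_rfl hU (W := Z) fun α _ => hZm α
        simp only [ENNReal.rpow_one, sub_self, ENNReal.rpow_zero, one_mul] at g1 g2
        exact mul_le_mul_right (mul_le_mul' g1 g2) _
    _ = _ := by ring

lemma trans_cont {d : ℕ} {P : ℝ≥0∞} (hP1 : 1 ≤ P) (hP : P ≠ ∞) {f : Ed d → ℝ}
    (hf : MemLp f P volume) :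
    Tendsto (fun t : Ed d => eLpNorm (fun x => f (x - t) - f x) P volume) (𝓝 0) (𝓝 0) := by
  haveI : Fact (1 ≤ P) := ⟨hP1⟩
  let g : Ed d → C(Ed d, Ed d) := fun t => ⟨fun x => x - t, by fun_prop⟩
  have hg : Continuous g := by
    apply ContinuousMap.continuous_of_continuous_uncurry
    show Continuous fun q : Ed d × Ed d => q.2 - q.1
    fun_prop
  have hgm : ∀ t, MeasurePreserving (g t) (volume : Measure (Ed d)) volume := fun t =>
    measurePreserving_sub_right volume t
  have key : ContinuousAt (fun t => (Lp.compMeasurePreserving (g t) (hgm t)) (hf.toLp f)) 0 :=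
    ContinuousAt.compMeasurePreservingLp continuousAt_const hg.continuousAt hgm hP
  have k2 := tendsto_iff_edist_tendsto_0.1 key
  refine k2.congr fun t => ?_
  simp only [Lp.toLp_compMeasurePreserving]
  rw [Lp.edist_toLp_toLp]
  congr 1
  ext x
  simp [g]

lemma trans_cont' {d : ℕ} {p : ℝ} (hp : 1 ≤ p) {f : Ed d → ℝ}
    (hf : MemLp f (ENNReal.ofReal p) volume) {ε : ℝ≥0∞} (hε : 0 < ε) :
    ∃ δ > 0, ∀ t : Ed d, ‖t‖ < δ → ∫⁻ x, ‖f (x - t) - f x‖ₑ ^ p ≤ ε := by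
  have hp0 : 0 < p := by linarith
  have h := trans_cont (by simpa using ENNReal.ofReal_le_ofReal hp) ENNReal.ofReal_ne_top hf
  have h2 : Tendsto (fun t : Ed d => (eLpNorm (fun x => f (x - t) - f x) (ENNReal.ofReal p) volume) ^ p)
      (𝓝 0) (𝓝 0) := by
    have := (ENNReal.continuous_rpow_const (y := p)).tendsto 0 |>.comp h
    simp only [ENNReal.zero_rpow_of_pos hp0] at this
    exact this
  have h3 := h2.eventually (ge_mem_nhds hε)
  obtain ⟨δ, hδ, h4⟩ := Metric.eventually_nhds_iff.1 h3
  refine ⟨δ, hδ, fun t ht => ?_⟩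
  have h5 := h4 (y := t) (by simpa using ht)
  rw [eLpNorm_eq_lintegral_rpow_enorm_toReal (by simpa using hp0) ENNReal.ofReal_ne_top,
    ENNReal.toReal_ofReal hp0.le, ← ENNReal.rpow_mul, one_div, inv_mul_cancel₀ hp0.ne',
    ENNReal.rpow_one] at h5
  exact h5

/-- A mollification. -/
def moll {d : ℕ} (φ : ContDiffBump (0 : Ed d)) (f : Ed d → ℝ) : Ed d → ℝ :=
  convolution (φ.normed volume) f (ContinuousLinearMap.lsmul ℝ ℝ) volume

lemma moll_apply {d : ℕ} (φ : ContDiffBump (0 : Ed d)) (f : Ed d → ℝ) (x : Ed d) :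
    moll φ f x = ∫ t, φ.normed volume t * f (x - t) := rfl

lemma moll_cont {d : ℕ} (φ : ContDiffBump (0 : Ed d)) {f : Ed d → ℝ} (hf : Integrable f volume) :
    Continuous (moll φ f) :=
  HasCompactSupport.continuous_convolution_left _ φ.hasCompactSupport_normed φ.continuous_normed
    hf.locallyIntegrable

lemma moll_Lp_bound {d : ℕ} (φ : ContDiffBump (0 : Ed d)) {p : ℝ} (hp : 1 ≤ p) {f : Ed d → ℝ}
    (hfm : Measurable f) (hf : Integrable f volume) {ε : ℝ≥0∞}
    (h : ∀ t : Ed d, ‖t‖ < φ.rOut → ∫⁻ x, ‖f (x - t) - f x‖ₑ ^ p ≤ ε) :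
    ∫⁻ x, ‖moll φ f x - f x‖ₑ ^ p ≤ ε := by
  have hp0 : 0 < p := by linarith
  set ψ : Ed d → ℝ := φ.normed volume with hψ
  have hψc : Continuous ψ := φ.continuous_normed
  have hψ0 : ∀ t, 0 ≤ ψ t := fun t => φ.nonneg_normed t
  have hψi : Integrable ψ volume := φ.integrable_normed
  have hψ1 : ∫⁻ t, ENNReal.ofReal (ψ t) = 1 := by
    rw [← ofReal_integral_eq_lintegral_ofReal hψi (Eventually.of_forall hψ0), hψ,
      ContDiffBump.integral_normed]
    simp
  have hψz : ∀ t, ¬ ‖t‖ < φ.rOut → ψ t = 0 := by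
    intro t ht
    have : t ∉ Function.support ψ := by
      rw [hψ, φ.support_normed_eq]
      simpa using ht
    simpa using this
  have hm1 : Measurable fun t => ENNReal.ofReal (ψ t) := hψc.measurable.ennreal_ofReal
  have hpt : ∀ x, ‖moll φ f x - f x‖ₑ ^ p ≤
      ∫⁻ t, ENNReal.ofReal (ψ t) * ‖f (x - t) - f x‖ₑ ^ p := by
    intro x
    have hi : Integrable (fun t => ψ t * f (x - t)) volume := by
      have := HasCompactSupport.convolutionExists_left (𝕜 := ℝ) (ContinuousLinearMap.lsmul ℝ ℝ)
        (μ := volume) φ.hasCompactSupport_normed (φ.continuous_normed (μ := (volume : Measure (Ed d)))) hf.locallyIntegrable x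
      simpa [ConvolutionExistsAt] using this
    have e1 : moll φ f x - f x = ∫ t, ψ t * (f (x - t) - f x) := by
      have : f x = ∫ t, ψ t * f x := by
        rw [integral_mul_const, hψ, ContDiffBump.integral_normed, one_mul]
      rw [moll_apply]
      conv_lhs => rw [this]
      rw [← integral_sub hi (hψi.mul_const _)]
      congr 1
      ext t
      ring
    have hm2 : Measurable fun t => ‖f (x - t) - f x‖ₑ := by
      have : Measurable fun t => f (x - t) - f x := (hfm.comp (by fun_prop)).sub_const _
      exact this.enorm
    have e2 : ‖moll φ f x - f x‖ₑ ≤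
        ∫⁻ t, ‖f (x - t) - f x‖ₑ ∂(volume.withDensity fun t => ENNReal.ofReal (ψ t)) := by
      rw [e1, lintegral_withDensity_eq_lintegral_mul _ hm1 hm2]
      refine (enorm_integral_le_lintegral_enorm _).trans (le_of_eq ?_)
      congr 1
      ext t
      rw [enorm_mul, Real.enorm_of_nonneg (hψ0 t)]
      rfl
    refine (ENNReal.rpow_le_rpow e2 hp0.le).trans ?_
    refine (jensen_lintegral _ hp hm2.aemeasurable).trans ?_
    rw [withDensity_apply _ MeasurableSet.univ, Measure.restrict_univ, hψ1, ENNReal.one_rpow, one_mul,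
      lintegral_withDensity_eq_lintegral_mul _ hm1 (hm2.pow_const p)]
    rfl
  have hmm : Measurable fun q : Ed d × Ed d => ENNReal.ofReal (ψ q.2) * ‖f (q.1 - q.2) - f q.1‖ₑ ^ p := by
    have h1 : Measurable fun q : Ed d × Ed d => f (q.1 - q.2) - f q.1 :=
      (hfm.comp (by fun_prop)).sub (hfm.comp measurable_fst)
    exact (hm1.comp measurable_snd).mul (h1.enorm.pow_const p)
  calc ∫⁻ x, ‖moll φ f x - f x‖ₑ ^ p ≤
      ∫⁻ x, ∫⁻ t, ENNReal.ofReal (ψ t) * ‖f (x - t) - f x‖ₑ ^ p := lintegral_mono hpt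
    _ = ∫⁻ t, ∫⁻ x, ENNReal.ofReal (ψ t) * ‖f (x - t) - f x‖ₑ ^ p :=
        lintegral_lintegral_swap hmm.aemeasurable
    _ ≤ ∫⁻ t, ENNReal.ofReal (ψ t) * ε := by
        refine lintegral_mono fun t => ?_
        simp only []
        rw [lintegral_const_mul' _ _ ENNReal.ofReal_ne_top]
        by_cases ht : ‖t‖ < φ.rOut
        · exact mul_le_mul_right (h t ht) _
        · rw [hψz t ht]; simp
    _ = ε := by
        rw [lintegral_mul_const _ hm1, hψ1, one_mul]

/-- standard bump sequence. -/
def bumpSeq (d : ℕ) (r : ℝ) (hr : 0 < r) (n : ℕ) : ContDiffBump (0 : Ed d) where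
  rIn := r / (2 * (n + 1))
  rOut := r / (n + 1)
  rIn_pos := by positivity
  rIn_lt_rOut := by
    apply div_lt_div_of_pos_left hr (by positivity)
    have : (0:ℝ) ≤ n := Nat.cast_nonneg n
    linarith

lemma bumpSeq_tendsto (d : ℕ) (r : ℝ) (hr : 0 < r) :
    Tendsto (fun n => (bumpSeq d r hr n).rOut) atTop (𝓝 0) := by
  have := tendsto_one_div_add_atTop_nhds_zero_nat (𝕜 := ℝ) |>.const_mul r
  simp only [mul_zero] at this
  refine this.congr fun n => ?_
  simp [bumpSeq, div_eq_mul_inv]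

lemma bumpSeq_le (d : ℕ) (r : ℝ) (hr : 0 < r) (n : ℕ) : (bumpSeq d r hr n).rOut ≤ r := by
  show r / (n + 1) ≤ r
  apply div_le_self hr.le
  have : (0:ℝ) ≤ n := Nat.cast_nonneg n
  linarith

lemma moll_tendsto_ae {d : ℕ} (r : ℝ) (hr : 0 < r) {f : Ed d → ℝ} (hf : Integrable f volume) :
    ∀ᵐ x ∂(volume : Measure (Ed d)), Tendsto (fun n => moll (bumpSeq d r hr n) f x) atTop (𝓝 (f x)) := by
  refine ContDiffBump.ae_convolution_tendsto_right_of_locallyIntegrable (K := 2)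
    (bumpSeq_tendsto d r hr) (Eventually.of_forall fun n => ?_) hf.locallyIntegrable
  show r / (n + 1) ≤ 2 * (r / (2 * (n+1)))
  apply le_of_eq
  field_simp

lemma moll_tendsto_Lp {d : ℕ} (r : ℝ) (hr : 0 < r) {p : ℝ} (hp : 1 ≤ p) {f : Ed d → ℝ}
    (hfm : Measurable f) (hf : Integrable f volume) (hfp : MemLp f (ENNReal.ofReal p) volume) :
    Tendsto (fun n => ∫⁻ x, ‖moll (bumpSeq d r hr n) f x - f x‖ₑ ^ p) atTop (𝓝 0) := by
  rw [ENNReal.tendsto_nhds_zero]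
  intro ε hε
  obtain ⟨δ, hδ, h⟩ := trans_cont' hp hfp hε
  filter_upwards [(bumpSeq_tendsto d r hr).eventually (gt_mem_nhds hδ)] with n hn
  exact moll_Lp_bound _ hp hfm hf fun t ht => h t (ht.trans hn)

lemma moll_deriv {d m : ℕ} {Ω K : Set (Ed d)} (φ : ContDiffBump (0 : Ed d))
    (hKΩ : K ⊆ Ω) (hK : MeasurableSet K) {D : (Fin d → ℕ) → Ed d → ℝ} (hD : WChain d Ω m D)
    {α : Fin d → ℕ} (hα : ∑ i, α i < m) (hi : IntegrableOn (D α) K volume)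
    {x : Ed d} (hx : closedBall x φ.rOut ⊆ K) :
    HasFDerivAt (moll φ (K.indicator (D α)))
      (∑ i, moll φ (K.indicator (D (α + Pi.single i 1))) x • (EuclideanSpace.proj i : Ed d →L[ℝ] ℝ)) x := by
  set ψ : Ed d → ℝ := φ.normed volume with hψ
  have hψs : ContDiff ℝ (⊤ : ℕ∞) ψ := φ.contDiff_normed
  have hψc : HasCompactSupport ψ := φ.hasCompactSupport_normed
  have hfi : Integrable (K.indicator (D α)) volume := (integrable_indicator_iff hK).2 hi
  have h0 := HasCompactSupport.hasFDerivAt_convolution_left (𝕜 := ℝ) (ContinuousLinearMap.lsmul ℝ ℝ)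
    (μ := (volume : Measure (Ed d))) hψc (hψs.of_le (by norm_cast)) hfi.locallyIntegrable x
  refine h0.congr_fderiv ?_
  rw [clm_eq_sum (convolution (fderiv ℝ ψ) _ _ _ x)]
  refine Finset.sum_congr rfl fun i _ => ?_
  congr 1
  -- evaluate
  have hex : ConvolutionExistsAt (fderiv ℝ ψ) (K.indicator (D α)) x
      (ContinuousLinearMap.precompL (Ed d) (ContinuousLinearMap.lsmul ℝ ℝ : ℝ →L[ℝ] ℝ →L[ℝ] ℝ)) volume :=
    HasCompactSupport.convolutionExists_left (𝕜 := ℝ) _ (hψc.fderiv (𝕜 := ℝ))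
      (hψs.continuous_fderiv (by simp)) hfi.locallyIntegrable x
  have e1 : (convolution (fderiv ℝ ψ) (K.indicator (D α))
      (ContinuousLinearMap.precompL (Ed d) (ContinuousLinearMap.lsmul ℝ ℝ : ℝ →L[ℝ] ℝ →L[ℝ] ℝ)) volume x)
      (EuclideanSpace.single i 1) =
      ∫ t, fderiv ℝ ψ t (EuclideanSpace.single i 1) * K.indicator (D α) (x - t) := by
    unfold convolution
    rw [ContinuousLinearMap.integral_apply hex]
    rfl
  rw [e1]
  set θ : Ed d → ℝ := fun y => ψ (x - y) with hθ
  have hθs : Function.support θ ⊆ ball x φ.rOut := by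
    intro y hy
    have : x - y ∈ Function.support ψ := hy
    rw [hψ, φ.support_normed_eq] at this
    simpa [dist_eq_norm, norm_sub_rev] using this
  have hθt : tsupport θ ⊆ closedBall x φ.rOut :=
    (closure_mono hθs).trans closure_ball_subset_closedBall
  have hθT : IsTestFun d Ω θ := by
    refine ⟨hψs.comp (by fun_prop), ?_, (hθt.trans hx).trans hKΩ⟩
    exact HasCompactSupport.of_support_subset_isCompact (isCompact_closedBall x φ.rOut)
      (hθs.trans ball_subset_closedBall)
  have hθd : ∀ y, pderivI d i θ y = - fderiv ℝ ψ (x - y) (EuclideanSpace.single i 1) := by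
    intro y
    have h1 : HasFDerivAt ψ (fderiv ℝ ψ (x - y)) (x - y) :=
      (hψs.differentiable (by simp) _).hasFDerivAt
    have h2 : HasFDerivAt (fun y : Ed d => x - y) (-(ContinuousLinearMap.id ℝ (Ed d))) y := by
      simpa using (hasFDerivAt_id y).const_sub x
    have h3 : HasFDerivAt θ ((fderiv ℝ ψ (x - y)).comp (-(ContinuousLinearMap.id ℝ (Ed d)))) y := h1.comp y h2
    unfold pderivI
    rw [h3.fderiv]
    simp
  have hind : ∀ (g : Ed d → ℝ) (w : Ed d → ℝ), tsupport g ⊆ K →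
      ∀ y, K.indicator w y * g y = w y * g y := by
    intro g w hg y
    by_cases hy : y ∈ K
    · simp [hy]
    · have : g y = 0 := image_eq_zero_of_notMem_tsupport fun h => hy (hg h)
      simp [this]
  have hc := hD.2 α hα i θ hθT
  have hθi := hθT.pderivI i
  have hsub : tsupport (pderivI d i θ) ⊆ tsupport θ := by
    exact pderivI_tsupport i θ
  rw [setInt_test hθi.2.2, setInt_test hθT.2.2] at hc
  have e2 : ∫ t, fderiv ℝ ψ t (EuclideanSpace.single i 1) * K.indicator (D α) (x - t) =
      - ∫ y, D α y * pderivI d i θ y := by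
    rw [← integral_sub_left_eq_self _ volume x, ← integral_neg]
    congr 1
    ext y
    rw [← hind (pderivI d i θ) (D α) ((hsub.trans hθt).trans hx) y, hθd, sub_sub_cancel]
    ring
  have e3 : moll φ (K.indicator (D (α + Pi.single i 1))) x = ∫ y, D (α + Pi.single i 1) y * θ y := by
    rw [moll_apply, ← integral_sub_left_eq_self _ volume x]
    congr 1
    ext y
    rw [← hind θ _ (hθt.trans hx) y, sub_sub_cancel]
    exact mul_comm _ _
  rw [e2, hc, neg_neg, e3]

lemma wt_bound {d : ℕ} {K : Set (Ed d)} (hK : IsCompact K) (hK0 : K ⊆ {0}ᶜ) (s : ℝ) :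
    ∃ M : ℝ, 0 < M ∧ ∀ x ∈ K, rhoModel d 0 x ^ s ≤ M := by
  have hc : ContinuousOn (fun x : Ed d => rhoModel d 0 x ^ s) K := by
    refine continuous_rhoModel.continuousOn.rpow_const fun x hx => Or.inl ?_
    exact (rho_pos' (hK0 hx)).ne'
  obtain ⟨M, hM⟩ := hK.exists_bound_of_continuousOn hc
  refine ⟨max M 1, by positivity, fun x hx => ?_⟩
  exact ((le_abs_self _).trans (hM x hx)).trans (le_max_left _ _)

lemma abs_le_Gw {d : ℕ} {a : ℝ} {W : (Fin d → ℕ) → Ed d → ℝ} {α : Fin d → ℕ} {y : Ed d} (hy : y ≠ 0)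
    {M : ℝ} (hM : rhoModel d 0 y ^ (a - ((∑ i, α i : ℕ) : ℝ)) ≤ M) :
    |W α y| ≤ M * Gw d a W α y := by
  have hρ := rho_pos' hy
  have : |W α y| = rhoModel d 0 y ^ (a - ((∑ i, α i : ℕ) : ℝ)) * Gw d a W α y := by
    unfold Gw
    rw [← mul_assoc, ← Real.rpow_add hρ]
    simp
  rw [this]
  exact mul_le_mul_of_nonneg_right hM Gw_nonneg

lemma enorm_rpow_eq (x p : ℝ) : ‖x‖ₑ ^ p = ENNReal.ofReal |x| ^ p := by
  rw [Real.enorm_eq_ofReal_abs]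

lemma Nrm_term_le {d m : ℕ} {a p : ℝ} {U : Set (Ed d)} {W : (Fin d → ℕ) → Ed d → ℝ}
    {α : Fin d → ℕ} (hα : ∑ i, α i ≤ m) :
    ∫⁻ y in U, ENNReal.ofReal (Gw d a W α y) ^ p ≤ Nrm d m a p U W := by
  unfold Nrm
  exact Finset.single_le_sum (f := fun α => ∫⁻ y in U, ENNReal.ofReal (Gw d a W α y) ^ p)
    (fun _ _ => zero_le) (mem_multiIdx.2 hα)

lemma unweight {d m : ℕ} {a p : ℝ} (hp : 1 ≤ p) {K : Set (Ed d)} (hK : IsCompact K)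
    (hK0 : K ⊆ {0}ᶜ) {α : Fin d → ℕ} (hα : ∑ i, α i ≤ m) :
    ∃ M : ℝ≥0∞, M ≠ ∞ ∧ ∀ (W : (Fin d → ℕ) → Ed d → ℝ) (U : Set (Ed d)), MeasurableSet U → U ⊆ K →
      ∫⁻ y in U, ‖W α y‖ₑ ^ p ≤ M * Nrm d m a p U W := by
  have hp0 : 0 < p := by linarith
  obtain ⟨M, hM0, hM⟩ := wt_bound hK hK0 (a - ((∑ i, α i : ℕ) : ℝ))
  refine ⟨ENNReal.ofReal M ^ p, ENNReal.rpow_ne_top_of_nonneg hp0.le ENNReal.ofReal_ne_top,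
    fun W U hU hUK => ?_⟩
  refine le_trans ?_ (mul_le_mul_right (Nrm_term_le hα) _)
  rw [← lintegral_const_mul' _ _ (ENNReal.rpow_ne_top_of_nonneg hp0.le ENNReal.ofReal_ne_top)]
  refine setLIntegral_mono_ae' hU (Eventually.of_forall fun x hx => ?_)
  rw [enorm_rpow_eq, ← ENNReal.mul_rpow_of_nonneg _ _ hp0.le, ← ENNReal.ofReal_mul hM0.le]
  exact ENNReal.rpow_le_rpow (ENNReal.ofReal_le_ofReal (abs_le_Gw (hK0 (hUK hx)) (hM x (hUK hx)))) hp0.le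

lemma mollify {d m : ℕ} {a p : ℝ} (hp : 1 ≤ p) {D : (Fin d → ℕ) → Ed d → ℝ}
    (hD : WChain d {0}ᶜ m D) (hDm : ∀ α, Measurable (D α)) (hDn : Nrm d m a p {0}ᶜ D ≠ ∞)
    {U K : Set (Ed d)} (hU : MeasurableSet U) (hK : IsCompact K) (hK0 : K ⊆ {0}ᶜ) (hUK : U ⊆ K) {r : ℝ} (hr : 0 < r)
    (hUr : ∀ x ∈ U, closedBall x r ⊆ K) :
    ∃ W : ℕ → (Fin d → ℕ) → Ed d → ℝ, (∀ n, IsJet d m U (W n)) ∧ (∀ n α, Measurable (W n α)) ∧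
      (∀ α, ∑ i, α i ≤ m → ∀ᵐ x ∂volume.restrict U, Tendsto (fun n => W n α x) atTop (𝓝 (D α x))) ∧
      Tendsto (fun n => Nrm d m a p U (W n - D)) atTop (𝓝 0) := by
  classical
  have hp0 : 0 < p := by linarith
  have hi : ∀ α, ∑ i, α i ≤ m → IntegrableOn (D α) K volume := fun α hα =>
    (hD.1 α hα).integrableOn_compact_subset hK0 hK
  have hf : ∀ α, ∑ i, α i ≤ m → Integrable (K.indicator (D α)) volume := fun α hα =>
    (integrable_indicator_iff hK.measurableSet).2 (hi α hα)
  have hfm : ∀ α, Measurable (K.indicator (D α)) := fun α => (hDm α).indicator hK.measurableSet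
  have hfp : ∀ α, ∑ i, α i ≤ m → MemLp (K.indicator (D α)) (ENNReal.ofReal p) volume := by
    intro α hα
    refine ⟨(hfm α).aestronglyMeasurable, ?_⟩
    rw [eLpNorm_eq_lintegral_rpow_enorm_toReal (by simpa using hp0) ENNReal.ofReal_ne_top,
      ENNReal.toReal_ofReal hp0.le]
    refine ENNReal.rpow_lt_top_of_nonneg (by positivity) ?_
    obtain ⟨M, hM, h⟩ := unweight (m := m) (a := a) hp hK hK0 hα
    have h1 := h D K hK.measurableSet subset_rfl
    have h2 : Nrm d m a p K D ≤ Nrm d m a p {0}ᶜ D := by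
      unfold Nrm
      exact Finset.sum_le_sum fun α _ => lintegral_mono_set hK0
    have h3 : ∫⁻ x, ‖K.indicator (D α) x‖ₑ ^ p = ∫⁻ y in K, ‖D α y‖ₑ ^ p := by
      rw [← lintegral_indicator hK.measurableSet]
      congr 1
      ext x
      by_cases hx : x ∈ K
      · simp [hx]
      · simp [hx, hp0]
    rw [h3]
    exact ne_top_of_le_ne_top (ENNReal.mul_ne_top hM hDn) (h1.trans (mul_le_mul_right h2 _))
  let φ := bumpSeq d r hr
  refine ⟨fun n α => if ∑ i, α i ≤ m then moll (φ n) (K.indicator (D α)) else 0, ?_, ?_, ?_, ?_⟩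
  · intro n
    refine ⟨fun α hα => ?_, fun α hα x hx => ?_⟩
    · simp only [hα, if_true]
      exact moll_cont _ (hf α hα)
    · have hs : ∀ i, ∑ j, (α + Pi.single i 1 : Fin d → ℕ) j ≤ m := fun i => by
        rw [sum_add_single]; omega
      simp only [hα.le, if_true, hs]
      exact moll_deriv _ hK0 hK.measurableSet hD hα (hi α hα.le)
        ((closedBall_subset_closedBall (bumpSeq_le d r hr n)).trans (hUr x hx))
  · intro n α
    by_cases hα : ∑ i, α i ≤ m
    · simp only [hα, if_true]
      exact (moll_cont _ (hf α hα)).measurable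
    · simp only [hα, if_false]
      exact measurable_const
  · intro α hα
    simp only [hα, if_true]
    rw [ae_restrict_iff' hU]
    filter_upwards [moll_tendsto_ae r hr (hf α hα)] with x hx hxU
    rwa [indicator_of_mem (hUK hxU)] at hx
  · unfold Nrm
    rw [show (0 : ℝ≥0∞) = ∑ α ∈ multiIdx d m, 0 by simp]
    refine tendsto_finsetSum _ fun α hα => ?_
    rw [mem_multiIdx] at hα
    obtain ⟨M, hM0, hM⟩ := wt_bound hK hK0 (((∑ i, α i : ℕ) : ℝ) - a)
    have h1 := moll_tendsto_Lp r hr hp (hfm α) (hf α hα) (hfp α hα)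
    have hMt : ENNReal.ofReal M ^ p ≠ ∞ := ENNReal.rpow_ne_top_of_nonneg hp0.le ENNReal.ofReal_ne_top
    have h2 := ENNReal.Tendsto.const_mul (a := ENNReal.ofReal M ^ p) h1 (Or.inr hMt)
    rw [mul_zero] at h2
    refine tendsto_of_tendsto_of_tendsto_of_le_of_le tendsto_const_nhds h2 (fun _ => zero_le) fun n => ?_
    simp only []
    rw [← lintegral_const_mul' _ _ hMt]
    refine le_trans ?_ (setLIntegral_le_lintegral U _)
    refine setLIntegral_mono_ae' hU (Eventually.of_forall fun x hx => ?_)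
    rw [enorm_rpow_eq, ← ENNReal.mul_rpow_of_nonneg _ _ hp0.le, ← ENNReal.ofReal_mul hM0.le]
    refine ENNReal.rpow_le_rpow (ENNReal.ofReal_le_ofReal ?_) hp0.le
    unfold Gw
    simp only [Pi.sub_apply, hα, if_true]
    rw [indicator_of_mem (hUK hx)]
    exact mul_le_mul_of_nonneg_right (hM x (hUK hx)) (abs_nonneg _)

/-- `D` is approximated by smooth jets on `U`. -/
def Appr (d m : ℕ) (a p : ℝ) (U : Set (Ed d)) (D : (Fin d → ℕ) → Ed d → ℝ)
    (W : ℕ → (Fin d → ℕ) → Ed d → ℝ) : Prop :=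
  (∀ n, IsJet d m U (W n)) ∧ (∀ n α, Measurable (W n α)) ∧
    (∀ α, ∑ i, α i ≤ m → ∀ᵐ x ∂volume.restrict U, Tendsto (fun n => W n α x) atTop (𝓝 (D α x))) ∧
    Tendsto (fun n => Nrm d m a p U (W n - D)) atTop (𝓝 0)

lemma IsJet.sub {d m : ℕ} {U : Set (Ed d)} {W Z : (Fin d → ℕ) → Ed d → ℝ} (hW : IsJet d m U W)
    (hZ : IsJet d m U Z) : IsJet d m U (W - Z) := by
  refine ⟨fun α hα => (hW.1 α hα).sub (hZ.1 α hα), fun α hα x hx => ?_⟩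
  refine ((hW.2 α hα x hx).sub (hZ.2 α hα x hx)).congr_fderiv ?_
  simp only [Pi.sub_apply, sub_smul, Finset.sum_sub_distrib]

/-- Weighted `p`-integral. -/
def Pw (d : ℕ) (s p : ℝ) (V : Set (Ed d)) (F : Ed d → ℝ) : ℝ≥0∞ :=
  ∫⁻ x in V, ENNReal.ofReal (rhoModel d 0 x ^ s * |F x|) ^ p

lemma add_rpow_le {p : ℝ} (hp : 0 ≤ p) (x y : ℝ≥0∞) : (x + y) ^ p ≤ 2 ^ p * (x ^ p + y ^ p) := by
  have h : x + y ≤ 2 * max x y := by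
    rw [two_mul]; exact add_le_add (le_max_left _ _) (le_max_right _ _)
  refine (ENNReal.rpow_le_rpow h hp).trans ?_
  rw [ENNReal.mul_rpow_of_nonneg _ _ hp]
  refine mul_le_mul_right ?_ _
  rcases le_total x y with h | h
  · rw [max_eq_right h]; exact le_add_self
  · rw [max_eq_left h]; exact le_self_add

lemma two_rpow_ne {p : ℝ} (hp : 0 ≤ p) : (2 : ℝ≥0∞) ^ p ≠ ∞ :=
  ENNReal.rpow_ne_top_of_nonneg hp (by simp)

lemma Pw_meas {d : ℕ} {s p : ℝ} {F : Ed d → ℝ} (hF : Measurable F) :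
    Measurable fun x => ENNReal.ofReal (rhoModel d 0 x ^ s * |F x|) ^ p := by
  have h1 : Measurable fun x : Ed d => rhoModel d 0 x ^ s := continuous_rhoModel.measurable.pow_const _
  exact ((h1.mul (by fun_prop)).ennreal_ofReal).pow_const _

lemma Pw_add_le {d : ℕ} {s p : ℝ} (hp : 0 ≤ p) {V : Set (Ed d)} {F G H : Ed d → ℝ}
    (hF : Measurable F) (h : ∀ x, |H x| ≤ |F x| + |G x|) :
    Pw d s p V H ≤ 2 ^ p * (Pw d s p V F + Pw d s p V G) := by
  unfold Pw
  rw [← lintegral_add_left (Pw_meas hF), ← lintegral_const_mul' _ _ (two_rpow_ne hp)]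
  refine lintegral_mono fun x => ?_
  refine le_trans (ENNReal.rpow_le_rpow ?_ hp) (add_rpow_le hp _ _)
  have hr : 0 ≤ rhoModel d 0 x ^ s := Real.rpow_nonneg (rhoModel_nonneg x) _
  rw [← ENNReal.ofReal_add (by positivity) (by positivity), ← mul_add]
  exact ENNReal.ofReal_le_ofReal (mul_le_mul_of_nonneg_left (h x) hr)

lemma Nrm_eq_Pw {d m : ℕ} {a p : ℝ} {U : Set (Ed d)} {W : (Fin d → ℕ) → Ed d → ℝ} :
    Nrm d m a p U W = ∑ α ∈ multiIdx d m, Pw d (((∑ i, α i : ℕ) : ℝ) - a) p U (W α) := rfl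

lemma Nrm_add_le {d m : ℕ} {a p : ℝ} (hp : 0 ≤ p) {U : Set (Ed d)} {F G H : (Fin d → ℕ) → Ed d → ℝ}
    (hF : ∀ α, Measurable (F α)) (h : ∀ α x, |H α x| ≤ |F α x| + |G α x|) :
    Nrm d m a p U H ≤ 2 ^ p * (Nrm d m a p U F + Nrm d m a p U G) := by
  simp only [Nrm_eq_Pw]
  rw [← Finset.sum_add_distrib, Finset.mul_sum]
  exact Finset.sum_le_sum fun α _ => Pw_add_le hp (hF α) (h α)

lemma Nrm_neg_sub {d m : ℕ} {a p : ℝ} {U : Set (Ed d)} {F G : (Fin d → ℕ) → Ed d → ℝ} :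
    Nrm d m a p U (F - G) = Nrm d m a p U (G - F) := by
  simp only [Nrm_eq_Pw, Pw, Pi.sub_apply, abs_sub_comm]

lemma Appr.const {d m : ℕ} {a p : ℝ} (hp : 1 ≤ p) {U : Set (Ed d)} {W : (Fin d → ℕ) → Ed d → ℝ}
    (h : IsJet d m U W) (hm : ∀ α, Measurable (W α)) : Appr d m a p U W (fun _ => W) := by
  refine ⟨fun _ => h, fun _ => hm, fun α _ => Eventually.of_forall fun x => tendsto_const_nhds, ?_⟩
  have : Nrm d m a p U (W - W) = 0 := by
    simp [Nrm_eq_Pw, Pw, show 0 < p by linarith]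
  simp only [this]
  exact tendsto_const_nhds

lemma Appr.sub_left {d m : ℕ} {a p : ℝ} {U : Set (Ed d)} {D : (Fin d → ℕ) → Ed d → ℝ}
    {W : ℕ → (Fin d → ℕ) → Ed d → ℝ} (h : Appr d m a p U D W) (n : ℕ) :
    Appr d m a p U (W n - D) (fun l => W n - W l) := by
  refine ⟨fun l => (h.1 n).sub (h.1 l), fun l α => (h.2.1 n α).sub (h.2.1 l α), fun α hα => ?_, ?_⟩
  · filter_upwards [h.2.2.1 α hα] with x hx
    exact hx.const_sub (W n α x)
  · refine h.2.2.2.congr fun l => ?_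
    rw [Nrm_neg_sub]
    congr 1
    ext α x
    simp only [Pi.sub_apply]
    ring

lemma Appr.bound {d m : ℕ} {a p : ℝ} (hp : 1 ≤ p) {β κ : Fin d → ℕ} (hβκ : ∑ i, β i + ∑ i, κ i ≤ m)
    {C : ℝ≥0∞} {U V : Set (Ed d)} (hC : ∀ W Z, IsJet d m U W → IsJet d m U Z →
      (∀ α, Measurable (W α)) → (∀ α, Measurable (Z α)) →
      Pw d (((∑ i, β i + ∑ i, κ i : ℕ) : ℝ) - a) p V (fun x => W β x * Z κ x) ≤
        C * Nrm d m a p U W * Nrm d m a p U Z)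
    (hCt : C ≠ ∞) (hVU : V ⊆ U)
    {D E : (Fin d → ℕ) → Ed d → ℝ} {W Z : ℕ → (Fin d → ℕ) → Ed d → ℝ}
    (hD : Appr d m a p U D W) (hE : Appr d m a p U E Z)
    (hDm : ∀ α, Measurable (D α)) (hEm : ∀ α, Measurable (E α))
    (hA : Nrm d m a p U D ≠ ∞) (hB : Nrm d m a p U E ≠ ∞) :
    Pw d (((∑ i, β i + ∑ i, κ i : ℕ) : ℝ) - a) p V (fun x => D β x * E κ x) ≤
      C * (2 ^ p * Nrm d m a p U D) * (2 ^ p * Nrm d m a p U E) := by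
  have hp0 : 0 ≤ p := by linarith
  set s := (((∑ i, β i + ∑ i, κ i : ℕ) : ℝ) - a) with hs
  have hlim : ∀ {D : (Fin d → ℕ) → Ed d → ℝ} {W : ℕ → (Fin d → ℕ) → Ed d → ℝ},
      Appr d m a p U D W → Tendsto (fun n => 2 ^ p * (Nrm d m a p U (W n - D) + Nrm d m a p U D)) atTop
        (𝓝 (2 ^ p * Nrm d m a p U D)) := by
    intro D W h
    have := ENNReal.Tendsto.const_mul (a := (2 : ℝ≥0∞) ^ p)
      (h.2.2.2.add (tendsto_const_nhds (x := Nrm d m a p U D))) (Or.inr (two_rpow_ne hp0))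
    rwa [zero_add] at this
  have hle : ∀ {D : (Fin d → ℕ) → Ed d → ℝ} {W : ℕ → (Fin d → ℕ) → Ed d → ℝ},
      (∀ n α, Measurable (W n α - D α)) → ∀ n, Nrm d m a p U (W n) ≤
        2 ^ p * (Nrm d m a p U (W n - D) + Nrm d m a p U D) := by
    intro D W h n
    refine Nrm_add_le hp0 (fun α => h n α) fun α x => ?_
    have := abs_add_le (W n α x - D α x) (D α x)
    simpa using this
  have hl : Tendsto (fun n => C * (2 ^ p * (Nrm d m a p U (W n - D) + Nrm d m a p U D)) *
      (2 ^ p * (Nrm d m a p U (Z n - E) + Nrm d m a p U E))) atTop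
      (𝓝 (C * (2 ^ p * Nrm d m a p U D) * (2 ^ p * Nrm d m a p U E))) := by
    have h1 : 2 ^ p * Nrm d m a p U D ≠ ∞ := ENNReal.mul_ne_top (two_rpow_ne hp0) hA
    have h2 : 2 ^ p * Nrm d m a p U E ≠ ∞ := ENNReal.mul_ne_top (two_rpow_ne hp0) hB
    exact ENNReal.Tendsto.mul (ENNReal.Tendsto.const_mul (hlim hD) (Or.inr hCt)) (Or.inr h2) (hlim hE)
      (Or.inr (ENNReal.mul_ne_top hCt h1))
  have hn : ∀ n, Pw d s p V (fun x => W n β x * Z n κ x) ≤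
      C * (2 ^ p * (Nrm d m a p U (W n - D) + Nrm d m a p U D)) *
      (2 ^ p * (Nrm d m a p U (Z n - E) + Nrm d m a p U E)) := by
    intro n
    refine (hC (W n) (Z n) (hD.1 n) (hE.1 n) (hD.2.1 n) (hE.2.1 n)).trans ?_
    exact mul_le_mul' (mul_le_mul' le_rfl (hle (fun n α => (hD.2.1 n α).sub (hDm α)) n))
      (hle (fun n α => (hE.2.1 n α).sub (hEm α)) n)
  have hF : Pw d s p V (fun x => D β x * E κ x) ≤ liminf (fun n => Pw d s p V (fun x => W n β x * Z n κ x)) atTop := by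
    unfold Pw
    refine le_trans (le_of_eq ?_) (lintegral_liminf_le fun n =>
      Pw_meas (s := s) (p := p) ((hD.2.1 n β).mul (hE.2.1 n κ)))
    apply lintegral_congr_ae
    filter_upwards [ae_restrict_of_ae_restrict_of_subset hVU (hD.2.2.1 β (by omega)),
      ae_restrict_of_ae_restrict_of_subset hVU (hE.2.2.1 κ (by omega))] with x h1 h2
    refine (Tendsto.liminf_eq ?_).symm
    have h3 : Tendsto (fun n => rhoModel d 0 x ^ s * |W n β x * Z n κ x|) atTop
      (𝓝 (rhoModel d 0 x ^ s * |D β x * E κ x|)) := ((h1.mul h2).abs).const_mul _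
    exact ((ENNReal.continuous_rpow_const (y := p)).tendsto _).comp (ENNReal.tendsto_ofReal h3)
  refine hF.trans ?_
  rw [← hl.liminf_eq]
  exact liminf_le_liminf (Eventually.of_forall hn)

lemma Appr.prod {d m : ℕ} {a p : ℝ} (hp : 1 ≤ p) {β κ : Fin d → ℕ} (hβκ : ∑ i, β i + ∑ i, κ i ≤ m)
    {C : ℝ≥0∞} {U V : Set (Ed d)} (hC : ∀ W Z, IsJet d m U W → IsJet d m U Z →
      (∀ α, Measurable (W α)) → (∀ α, Measurable (Z α)) →
      Pw d (((∑ i, β i + ∑ i, κ i : ℕ) : ℝ) - a) p V (fun x => W β x * Z κ x) ≤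
        C * Nrm d m a p U W * Nrm d m a p U Z)
    (hCt : C ≠ ∞) (hVU : V ⊆ U)
    {D E : (Fin d → ℕ) → Ed d → ℝ} {W Z : ℕ → (Fin d → ℕ) → Ed d → ℝ}
    (hD : Appr d m a p U D W) (hE : Appr d m a p U E Z)
    (hDm : ∀ α, Measurable (D α)) (hEm : ∀ α, Measurable (E α))
    (hA : Nrm d m a p U D ≠ ∞) (hB : Nrm d m a p U E ≠ ∞) :
    Tendsto (fun n => Pw d (((∑ i, β i + ∑ i, κ i : ℕ) : ℝ) - a) p V
      (fun x => W n β x * Z n κ x - D β x * E κ x)) atTop (𝓝 0) := by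
  have hp0 : 0 ≤ p := by linarith
  have h2t := two_rpow_ne hp0
  have hn : ∀ᶠ n in atTop, Pw d (((∑ i, β i + ∑ i, κ i : ℕ) : ℝ) - a) p V
      (fun x => W n β x * Z n κ x - D β x * E κ x) ≤
      2 ^ p * (C * (2 ^ p * Nrm d m a p U (W n - D)) * (2 ^ p * (2 ^ p * (Nrm d m a p U (Z n - E) + Nrm d m a p U E)))
        + C * (2 ^ p * Nrm d m a p U D) * (2 ^ p * Nrm d m a p U (Z n - E))) := by
    have f1 := hD.2.2.2.eventually (gt_mem_nhds (zero_lt_one : (0 : ℝ≥0∞) < 1))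
    have f2 := hE.2.2.2.eventually (gt_mem_nhds (zero_lt_one : (0 : ℝ≥0∞) < 1))
    filter_upwards [f1, f2] with n f1 f2
    have hZn : Nrm d m a p U (Z n) ≤ 2 ^ p * (Nrm d m a p U (Z n - E) + Nrm d m a p U E) := by
      refine Nrm_add_le hp0 (fun α => (hE.2.1 n α).sub (hEm α)) fun α x => ?_
      have := abs_add_le (Z n α x - E α x) (E α x)
      simpa using this
    have hZt : Nrm d m a p U (Z n) ≠ ∞ :=
      ne_top_of_le_ne_top (ENNReal.mul_ne_top h2t (ENNReal.add_ne_top.2 ⟨f2.ne_top, hB⟩)) hZn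
    have b1 := Appr.bound hp hβκ hC hCt hVU (hD.sub_left n) (Appr.const hp (hE.1 n) (hE.2.1 n))
      (fun α => (hD.2.1 n α).sub (hDm α)) (hE.2.1 n) f1.ne_top hZt
    have b2 := Appr.bound hp hβκ hC hCt hVU hD (hE.sub_left n) hDm
      (fun α => (hE.2.1 n α).sub (hEm α)) hA f2.ne_top
    refine (Pw_add_le hp0 (F := fun x => (W n - D) β x * Z n κ x) (G := fun x => D β x * (Z n - E) κ x)
      (((hD.2.1 n β).sub (hDm β)).mul (hE.2.1 n κ)) fun x => ?_).trans ?_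
    · refine le_trans (le_of_eq ?_) (abs_add_le _ _)
      congr 1
      simp only [Pi.sub_apply]
      ring
    · refine mul_le_mul_right (add_le_add (b1.trans ?_) b2) _
      exact mul_le_mul' le_rfl (mul_le_mul' le_rfl hZn)
  refine tendsto_of_tendsto_of_tendsto_of_le_of_le' tendsto_const_nhds ?_
    (Eventually.of_forall fun _ => zero_le) hn
  have t1 : Tendsto (fun n => 2 ^ p * Nrm d m a p U (W n - D)) atTop (𝓝 0) := by
    simpa using ENNReal.Tendsto.const_mul (a := (2 : ℝ≥0∞) ^ p) hD.2.2.2 (Or.inr h2t)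
  have t2 : Tendsto (fun n => 2 ^ p * Nrm d m a p U (Z n - E)) atTop (𝓝 0) := by
    simpa using ENNReal.Tendsto.const_mul (a := (2 : ℝ≥0∞) ^ p) hE.2.2.2 (Or.inr h2t)
  have t3 : Tendsto (fun n => C * (2 ^ p * Nrm d m a p U (W n - D))) atTop (𝓝 0) := by
    simpa using ENNReal.Tendsto.const_mul (a := C) t1 (Or.inr hCt)
  have t4 : Tendsto (fun n => 2 ^ p * (2 ^ p * (Nrm d m a p U (Z n - E) + Nrm d m a p U E))) atTop
      (𝓝 (2 ^ p * (2 ^ p * Nrm d m a p U E))) := by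
    have := ENNReal.Tendsto.const_mul (a := (2 : ℝ≥0∞) ^ p) (ENNReal.Tendsto.const_mul (a := (2 : ℝ≥0∞) ^ p)
      (hE.2.2.2.add (tendsto_const_nhds (x := Nrm d m a p U E))) (Or.inr h2t)) (Or.inr h2t)
    rwa [zero_add] at this
  have ht4 : (2 : ℝ≥0∞) ^ p * (2 ^ p * Nrm d m a p U E) ≠ ∞ :=
    ENNReal.mul_ne_top h2t (ENNReal.mul_ne_top h2t hB)
  have t5 := ENNReal.Tendsto.mul t3 (Or.inr ht4) t4 (Or.inr ENNReal.zero_ne_top)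
  have hc2 : C * (2 ^ p * Nrm d m a p U D) ≠ ∞ := ENNReal.mul_ne_top hCt (ENNReal.mul_ne_top h2t hA)
  have t6 := ENNReal.Tendsto.const_mul (a := C * (2 ^ p * Nrm d m a p U D)) t2 (Or.inr hc2)
  have t7 := ENNReal.Tendsto.const_mul (a := (2 : ℝ≥0∞) ^ p) (t5.add t6) (Or.inr h2t)
  simpa using t7

lemma L1_of_Pw {d : ℕ} {s p : ℝ} (hp : 1 ≤ p) {K : Set (Ed d)} (hK : IsCompact K) (hK0 : K ⊆ {0}ᶜ) :
    ∃ M : ℝ≥0∞, M ≠ ∞ ∧ ∀ V : Set (Ed d), MeasurableSet V → V ⊆ K → ∀ F : Ed d → ℝ, Measurable F →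
      (∫⁻ x in V, ‖F x‖ₑ) ^ p ≤ M * Pw d s p V F := by
  have hp0 : 0 < p := by linarith
  obtain ⟨M, hM0, hM⟩ := wt_bound hK hK0 (-s)
  have hMt : ENNReal.ofReal M ^ p ≠ ∞ := ENNReal.rpow_ne_top_of_nonneg hp0.le ENNReal.ofReal_ne_top
  refine ⟨volume K ^ (p - 1) * ENNReal.ofReal M ^ p, ENNReal.mul_ne_top
    (ENNReal.rpow_ne_top_of_nonneg (by linarith) hK.measure_lt_top.ne) hMt, fun V hV hVK F hF => ?_⟩
  refine (jensen_lintegral _ hp hF.enorm.aemeasurable).trans ?_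
  rw [Measure.restrict_apply_univ, mul_assoc]
  refine mul_le_mul' (ENNReal.rpow_le_rpow (measure_mono hVK) (by linarith)) ?_
  unfold Pw
  rw [← lintegral_const_mul' _ _ hMt]
  refine setLIntegral_mono_ae' hV (Eventually.of_forall fun x hx => ?_)
  rw [enorm_rpow_eq, ← ENNReal.mul_rpow_of_nonneg _ _ hp0.le, ← ENNReal.ofReal_mul hM0.le]
  refine ENNReal.rpow_le_rpow (ENNReal.ofReal_le_ofReal ?_) hp0.le
  have hρ := rho_pos' (hK0 (hVK hx))
  have e : |F x| = rhoModel d 0 x ^ (-s) * (rhoModel d 0 x ^ s * |F x|) := by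
    rw [← mul_assoc, ← Real.rpow_add hρ]; simp
  rw [e]
  have h3 : 0 ≤ rhoModel d 0 x ^ s * |F x| := by positivity
  have := mul_le_mul_of_nonneg_right (hM x (hVK hx)) h3
  rw [← e] at this ⊢
  exact this

lemma Pw_mono_set {d : ℕ} {s p : ℝ} {U V : Set (Ed d)} (h : U ⊆ V) (F : Ed d → ℝ) :
    Pw d s p U F ≤ Pw d s p V F := lintegral_mono_set h

lemma loc_of_Pw {d : ℕ} {s p : ℝ} (hp : 1 ≤ p) {F : Ed d → ℝ} (hF : Measurable F)
    (h : Pw d s p {0}ᶜ F ≠ ∞) : LocallyIntegrableOn F {0}ᶜ volume := by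
  have hp0 : 0 < p := by linarith
  rw [locallyIntegrableOn_iff isOpen_compl_singleton.isLocallyClosed]
  intro K hK0 hK
  obtain ⟨M, hM, h1⟩ := L1_of_Pw (s := s) hp hK hK0
  refine ⟨hF.aestronglyMeasurable, ?_⟩
  have h2 := h1 K hK.measurableSet subset_rfl F hF
  have h3 : (∫⁻ x in K, ‖F x‖ₑ) ^ p < ∞ := lt_of_le_of_lt h2
    (ENNReal.mul_ne_top hM (ne_top_of_le_ne_top h (Pw_mono_set hK0 F))).lt_top
  rwa [ENNReal.rpow_lt_top_iff_of_pos hp0] at h3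

/-- Annuli. -/
def Ann (d : ℕ) (R : ℝ) : Set (Ed d) := {x | R⁻¹ < ‖x‖ ∧ ‖x‖ < R}

lemma Ann_open {d : ℕ} (R : ℝ) : IsOpen (Ann d R) :=
  (isOpen_lt continuous_const continuous_norm).inter (isOpen_lt continuous_norm continuous_const)

/-- Closed annuli. -/
def CAnn (d : ℕ) (R : ℝ) : Set (Ed d) := {x | R⁻¹ ≤ ‖x‖ ∧ ‖x‖ ≤ R}

lemma CAnn_compact {d : ℕ} (R : ℝ) : IsCompact (CAnn d R) := by
  refine (isCompact_closedBall (0 : Ed d) R).of_isClosed_subset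
    ((isClosed_le continuous_const continuous_norm).inter (isClosed_le continuous_norm continuous_const)) ?_
  intro x hx
  simpa using hx.2

lemma CAnn_sub {d : ℕ} {R : ℝ} (hR : 1 ≤ R) : CAnn d R ⊆ {0}ᶜ := by
  intro x hx h
  have h0 : x = 0 := h
  have := hx.1
  rw [h0, norm_zero] at this
  have : 0 < R⁻¹ := by positivity
  linarith

lemma Ann_sub_CAnn {d : ℕ} (R : ℝ) : Ann d R ⊆ CAnn d R := fun _ hx => ⟨hx.1.le, hx.2.le⟩

lemma Ann_mono {d : ℕ} {R S : ℝ} (hR : 1 ≤ R) (h : R ≤ S) : Ann d R ⊆ Ann d S := fun _ hx =>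
  ⟨lt_of_le_of_lt (inv_anti₀ (by linarith) h) hx.1, hx.2.trans_le h⟩

lemma Ann_ball {d : ℕ} {R : ℝ} (hR : 1 ≤ R) {x : Ed d} (hx : x ∈ Ann d R) :
    x ≠ 0 ∧ closedBall x (rhoModel d 0 x / 2) ⊆ Ann d (2 * R) := by
  have hR0 : 0 < R := by linarith
  refine ⟨CAnn_sub hR (Ann_sub_CAnn R hx), fun y hy => ?_⟩
  rw [mem_closedBall, dist_eq_norm] at hy
  have h1 : rhoModel d 0 x ≤ 1 := rho_le_one x
  have h2 : rhoModel d 0 x ≤ ‖x‖ := by rw [rhoModel_eq]; exact min_le_right _ _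
  have h3 := norm_sub_norm_le y x
  have h4 := norm_sub_norm_le x y
  rw [norm_sub_rev] at h4
  have h5 := hx.1
  have h6 := hx.2
  constructor
  · rw [mul_inv]; linarith
  · linarith

lemma Ann_ball2 {d : ℕ} {R : ℝ} (hR : 1 ≤ R) {x : Ed d} (hx : x ∈ Ann d (2 * R)) :
    closedBall x ((4 * R)⁻¹) ⊆ CAnn d (4 * R) := by
  have hR0 : 0 < R := by linarith
  intro y hy
  rw [mem_closedBall, dist_eq_norm] at hy
  have h3 := norm_sub_norm_le y x
  have h4 := norm_sub_norm_le x y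
  rw [norm_sub_rev] at h4
  have h5 := hx.1
  have h6 := hx.2
  have h7 : (4 * R)⁻¹ ≤ 1 := inv_le_one_of_one_le₀ (by linarith)
  have h8 : (2 * R)⁻¹ = (4 * R)⁻¹ + (4 * R)⁻¹ := by field_simp; norm_num
  constructor <;> linarith

lemma Ann_exhaust {d : ℕ} {K : Set (Ed d)} (hK : IsCompact K) (hK0 : K ⊆ {0}ᶜ) :
    ∃ R, 1 ≤ R ∧ K ⊆ Ann d R := by
  obtain ⟨M, hM⟩ := hK.exists_bound_of_continuousOn (f := fun x : Ed d => ‖x‖⁻¹)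
    (continuous_norm.continuousOn.inv₀ fun x hx => norm_ne_zero_iff.2 (hK0 hx))
  obtain ⟨N, hN⟩ := hK.exists_bound_of_continuousOn (f := fun x : Ed d => ‖x‖) continuous_norm.continuousOn
  refine ⟨max 1 (max M N) + 1, by linarith [le_max_left 1 (max M N)], fun x hx => ?_⟩
  have h1 := hM x hx
  have h2 := hN x hx
  simp only [norm_inv, norm_norm] at h1 h2
  have h3 : M ≤ max 1 (max M N) := (le_max_left _ _).trans (le_max_right _ _)
  have h4 : N ≤ max 1 (max M N) := (le_max_right _ _).trans (le_max_right _ _)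
  have hx0 : 0 < ‖x‖ := norm_pos_iff.2 (hK0 hx)
  refine ⟨?_, by linarith⟩
  rw [inv_lt_comm₀ (by linarith [le_max_left 1 (max M N)]) hx0]
  linarith

lemma Ann_iUnion {d : ℕ} : ⋃ n : ℕ, Ann d ((n : ℝ) + 1) = {0}ᶜ := by
  apply Subset.antisymm
  · refine iUnion_subset fun n => (Ann_sub_CAnn _).trans (CAnn_sub ?_)
    have : (0 : ℝ) ≤ n := Nat.cast_nonneg n
    linarith
  · intro x hx
    obtain ⟨R, hR, h⟩ := Ann_exhaust (isCompact_singleton (x := x)) (singleton_subset_iff.2 hx)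
    obtain ⟨n, hn⟩ := exists_nat_ge R
    exact mem_iUnion.2 ⟨n, Ann_mono hR (by linarith) (h rfl)⟩

/-- Good derivative families. -/
def Good (d m : ℕ) (a p : ℝ) (D : (Fin d → ℕ) → Ed d → ℝ) : Prop :=
  WChain d {0}ᶜ m D ∧ (∀ α, Measurable (D α)) ∧ Nrm d m a p {0}ᶜ D ≠ ∞

lemma Nrm_mono_set {d m : ℕ} {a p : ℝ} {U V : Set (Ed d)} (h : U ⊆ V) (D : (Fin d → ℕ) → Ed d → ℝ) :
    Nrm d m a p U D ≤ Nrm d m a p V D :=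
  Finset.sum_le_sum fun _ _ => lintegral_mono_set h

lemma Good.appr {d m : ℕ} {a p : ℝ} (hp : 1 ≤ p) {D : (Fin d → ℕ) → Ed d → ℝ} (h : Good d m a p D)
    {R : ℝ} (hR : 1 ≤ R) : ∃ W, Appr d m a p (Ann d (2 * R)) D W := by
  have hR0 : 0 < R := by linarith
  refine mollify hp h.1 h.2.1 h.2.2 (Ann_open _).measurableSet (CAnn_compact (4 * R)) (CAnn_sub (by linarith))
    ?_ (r := (4 * R)⁻¹) (by positivity) fun x hx => Ann_ball2 hR hx
  exact (Ann_mono (by linarith) (by linarith)).trans (Ann_sub_CAnn _)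

lemma EBound.spec {d m : ℕ} {a p : ℝ} {β κ : Fin d → ℕ} (h : EBound d m a p β κ) :
    ∃ C : ℝ≥0∞, C ≠ ∞ ∧ ∀ R : ℝ, 1 ≤ R → ∀ W Z, IsJet d m (Ann d (2 * R)) W → IsJet d m (Ann d (2 * R)) Z →
      (∀ α, Measurable (W α)) → (∀ α, Measurable (Z α)) →
      Pw d (((∑ i, β i + ∑ i, κ i : ℕ) : ℝ) - a) p (Ann d R) (fun x => W β x * Z κ x) ≤
        C * Nrm d m a p (Ann d (2 * R)) W * Nrm d m a p (Ann d (2 * R)) Z := by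
  obtain ⟨C, hC, h⟩ := h
  exact ⟨C, hC, fun R hR W Z hW hZ hWm hZm => h (Ann d (2 * R)) (Ann d R) W Z (Ann_open _).measurableSet
    (Ann_open _).measurableSet hW hZ hWm hZm fun x hx => Ann_ball hR hx⟩

lemma global_bound {d m : ℕ} {a p : ℝ} (hp : 1 ≤ p) {β κ : Fin d → ℕ} (hβκ : ∑ i, β i + ∑ i, κ i ≤ m)
    (hB : EBound d m a p β κ) : ∃ C : ℝ≥0∞, C ≠ ∞ ∧ ∀ D E, Good d m a p D → Good d m a p E →
      Pw d (((∑ i, β i + ∑ i, κ i : ℕ) : ℝ) - a) p {0}ᶜ (fun x => D β x * E κ x) ≤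
        C * (Nrm d m a p {0}ᶜ D * Nrm d m a p {0}ᶜ E) := by
  have hp0 : 0 ≤ p := by linarith
  obtain ⟨C, hC, h⟩ := hB.spec
  refine ⟨C * 2 ^ p * 2 ^ p, ENNReal.mul_ne_top (ENNReal.mul_ne_top hC (two_rpow_ne hp0)) (two_rpow_ne hp0),
    fun D E hD hE => ?_⟩
  have hn : ∀ n : ℕ, Pw d (((∑ i, β i + ∑ i, κ i : ℕ) : ℝ) - a) p (Ann d ((n : ℝ) + 1)) (fun x => D β x * E κ x) ≤
      C * 2 ^ p * 2 ^ p * (Nrm d m a p {0}ᶜ D * Nrm d m a p {0}ᶜ E) := by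
    intro n
    have hR : 1 ≤ (n : ℝ) + 1 := by
      have : (0 : ℝ) ≤ n := Nat.cast_nonneg n
      linarith
    obtain ⟨W, hW⟩ := hD.appr hp hR
    obtain ⟨Z, hZ⟩ := hE.appr hp hR
    have hU : Ann d (2 * ((n : ℝ) + 1)) ⊆ {0}ᶜ := (Ann_sub_CAnn _).trans (CAnn_sub (by linarith))
    have hA := Nrm_mono_set (m := m) (a := a) (p := p) hU D
    have hB := Nrm_mono_set (m := m) (a := a) (p := p) hU E
    refine (Appr.bound hp hβκ (h _ hR) hC (Ann_mono hR (by linarith)) hW hZ hD.2.1 hE.2.1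
      (ne_top_of_le_ne_top hD.2.2 hA) (ne_top_of_le_ne_top hE.2.2 hB)).trans ?_
    calc _ ≤ C * (2 ^ p * Nrm d m a p {0}ᶜ D) * (2 ^ p * Nrm d m a p {0}ᶜ E) :=
          mul_le_mul' (mul_le_mul' le_rfl (mul_le_mul' le_rfl hA)) (mul_le_mul' le_rfl hB)
      _ = _ := by ring
  have hmono : Monotone fun n : ℕ => Ann d ((n : ℝ) + 1) := by
    intro n k hnk
    refine Ann_mono ?_ ?_
    · have : (0 : ℝ) ≤ n := Nat.cast_nonneg n
      linarith
    · have : (n : ℝ) ≤ k := by exact_mod_cast hnk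
      linarith
  have e := setLIntegral_iUnion_of_directed (μ := (volume : Measure (Ed d))) (fun x =>
    ENNReal.ofReal (rhoModel d 0 x ^ (((∑ i, β i + ∑ i, κ i : ℕ) : ℝ) - a) * |D β x * E κ x|) ^ p)
    hmono.directed_le
  rw [Ann_iUnion] at e
  unfold Pw
  rw [e]
  exact iSup_le hn

lemma Pw_test_limit {d : ℕ} {s p : ℝ} (hp : 1 ≤ p) {R : ℝ} (hR : 1 ≤ R) {F : ℕ → Ed d → ℝ} {G : Ed d → ℝ}
    (hF : ∀ n, Measurable (F n)) (hG : Measurable G)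
    (hFi : ∀ n, LocallyIntegrableOn (F n) {0}ᶜ volume) (hGi : LocallyIntegrableOn G {0}ᶜ volume)
    (h : Tendsto (fun n => Pw d s p (Ann d R) (fun x => F n x - G x)) atTop (𝓝 0))
    {g : Ed d → ℝ} (hg : Continuous g) (hgc : HasCompactSupport g) (hgs : tsupport g ⊆ Ann d R) :
    Tendsto (fun n => ∫ x, F n x * g x) atTop (𝓝 (∫ x, G x * g x)) := by
  have hp0 : 0 < p := by linarith
  have hsub : tsupport g ⊆ {0}ᶜ := (hgs.trans (Ann_sub_CAnn _)).trans (CAnn_sub hR)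
  obtain ⟨B, hB⟩ := hgc.exists_bound_of_continuous hg
  obtain ⟨M, hM, hL⟩ := L1_of_Pw (s := s) hp (CAnn_compact (d := d) R) (CAnn_sub hR)
  have t1 : Tendsto (fun n => (M * Pw d s p (Ann d R) (fun x => F n x - G x)) ^ (1 / p)) atTop (𝓝 0) := by
    have h1 := ENNReal.Tendsto.const_mul (a := M) h (Or.inr hM)
    rw [mul_zero] at h1
    have h2 := ((ENNReal.continuous_rpow_const (y := 1 / p)).tendsto 0).comp h1
    rw [ENNReal.zero_rpow_of_pos (by positivity)] at h2
    exact h2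
  have t2 : Tendsto (fun n => ENNReal.ofReal B * (M * Pw d s p (Ann d R) (fun x => F n x - G x)) ^ (1 / p))
      atTop (𝓝 0) := by
    have := ENNReal.Tendsto.const_mul (a := ENNReal.ofReal B) t1 (Or.inr ENNReal.ofReal_ne_top)
    rwa [mul_zero] at this
  rw [tendsto_iff_edist_tendsto_0]
  refine tendsto_of_tendsto_of_tendsto_of_le_of_le tendsto_const_nhds t2 (fun _ => zero_le) fun n => ?_
  simp only []
  rw [edist_eq_enorm_sub, ← integral_sub (loc_mul_test (hFi n) hg hgc hsub) (loc_mul_test hGi hg hgc hsub)]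
  refine (enorm_integral_le_lintegral_enorm _).trans ?_
  have hb : ∀ x, ‖F n x * g x - G x * g x‖ₑ ≤
      (Ann d R).indicator (fun x => ENNReal.ofReal B * ‖F n x - G x‖ₑ) x := by
    intro x
    rw [← sub_mul, enorm_mul]
    by_cases hx : x ∈ Ann d R
    · rw [indicator_of_mem hx, mul_comm]
      refine mul_le_mul' ?_ le_rfl
      rw [← ofReal_norm_eq_enorm]
      exact ENNReal.ofReal_le_ofReal (hB x)
    · have : g x = 0 := image_eq_zero_of_notMem_tsupport fun hh => hx (hgs hh)
      simp [this]
  refine (lintegral_mono hb).trans ?_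
  rw [lintegral_indicator (Ann_open R).measurableSet, lintegral_const_mul' _ _ ENNReal.ofReal_ne_top]
  refine mul_le_mul_right ?_ _
  rw [one_div, ENNReal.le_rpow_inv_iff hp0]
  exact hL _ (Ann_open R).measurableSet (Ann_sub_CAnn R) _ ((hF n).sub hG)

lemma jet_prod_ibp {d m : ℕ} {U : Set (Ed d)} {W Z : (Fin d → ℕ) → Ed d → ℝ} (hW : IsJet d m U W)
    (hZ : IsJet d m U Z) {β κ : Fin d → ℕ} (hβκ : ∑ i, β i + ∑ i, κ i < m) (i : Fin d)
    {φ : Ed d → ℝ} (hφ : IsTestFun d U φ) :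
    ∫ x, W β x * Z κ x * pderivI d i φ x =
      -((∫ x, (W (β + Pi.single i 1) x * Z κ x) * φ x) + ∫ x, (W β x * Z (κ + Pi.single i 1) x) * φ x) := by
  have hc1 : Continuous fun x => W (β + Pi.single i 1) x * Z κ x :=
    (hW.1 _ (by rw [sum_add_single]; omega)).mul (hZ.1 _ (by omega))
  have hc2 : Continuous fun x => W β x * Z (κ + Pi.single i 1) x :=
    (hW.1 _ (by omega)).mul (hZ.1 _ (by rw [sum_add_single]; omega))
  have := ibp i hφ (f := fun x => W β x * Z κ x)
    (f' := fun x => W β x • (∑ j, Z (κ + Pi.single j 1) x • (EuclideanSpace.proj j : Ed d →L[ℝ] ℝ)) +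
      Z κ x • (∑ j, W (β + Pi.single j 1) x • (EuclideanSpace.proj j : Ed d →L[ℝ] ℝ)))
    ((hW.1 _ (by omega)).mul (hZ.1 _ (by omega)))
    (by
      simp only [ContinuousLinearMap.add_apply, ContinuousLinearMap.smul_apply, jet_clm_single, smul_eq_mul]
      refine hc2.add ?_
      simpa only [mul_comm] using hc1)
    (fun x hx => (hW.2 β (by omega) x (hφ.2.2 hx)).mul (hZ.2 κ (by omega) x (hφ.2.2 hx)))
  rw [this]
  simp only [ContinuousLinearMap.add_apply, ContinuousLinearMap.smul_apply, jet_clm_single, smul_eq_mul]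
  rw [← integral_add]
  · congr 2
    ext x
    ring
  · exact loc_mul_test (Ω := univ) (hc1.locallyIntegrable.locallyIntegrableOn _) hφ.1.continuous hφ.2.1 (subset_univ _)
  · exact loc_mul_test (Ω := univ) (hc2.locallyIntegrable.locallyIntegrableOn _) hφ.1.continuous hφ.2.1 (subset_univ _)

lemma prod_loc {d m : ℕ} {a p : ℝ} (hp : 1 ≤ p)
    (hB : ∀ β κ : Fin d → ℕ, ∑ i, β i + ∑ i, κ i ≤ m → EBound d m a p β κ)
    {D E : (Fin d → ℕ) → Ed d → ℝ} (hD : Good d m a p D) (hE : Good d m a p E)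
    {β κ : Fin d → ℕ} (hβκ : ∑ i, β i + ∑ i, κ i ≤ m) :
    LocallyIntegrableOn (fun x => D β x * E κ x) {0}ᶜ volume := by
  obtain ⟨C, hC, h⟩ := global_bound hp hβκ (hB β κ hβκ)
  exact loc_of_Pw hp ((hD.2.1 β).mul (hE.2.1 κ)) (ne_top_of_le_ne_top
    (ENNReal.mul_ne_top hC (ENNReal.mul_ne_top hD.2.2 hE.2.2)) (h D E hD hE))

lemma prod_ibp {d m : ℕ} {a p : ℝ} (hp : 1 ≤ p)
    (hB : ∀ β κ : Fin d → ℕ, ∑ i, β i + ∑ i, κ i ≤ m → EBound d m a p β κ)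
    {D E : (Fin d → ℕ) → Ed d → ℝ} (hD : Good d m a p D) (hE : Good d m a p E)
    {β κ : Fin d → ℕ} (hβκ : ∑ i, β i + ∑ i, κ i < m) (i : Fin d)
    {φ : Ed d → ℝ} (hφ : IsTestFun d {0}ᶜ φ) :
    ∫ x, D β x * E κ x * pderivI d i φ x =
      -((∫ x, (D (β + Pi.single i 1) x * E κ x) * φ x) + ∫ x, (D β x * E (κ + Pi.single i 1) x) * φ x) := by
  obtain ⟨R, hR, hφR⟩ := Ann_exhaust hφ.2.1 hφ.2.2
  have hRR : Ann d R ⊆ Ann d (2 * R) := Ann_mono hR (by linarith)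
  obtain ⟨W, hW⟩ := hD.appr hp hR
  obtain ⟨Z, hZ⟩ := hE.appr hp hR
  have hU : Ann d (2 * R) ⊆ {0}ᶜ := (Ann_sub_CAnn _).trans (CAnn_sub (by linarith))
  have hA := ne_top_of_le_ne_top hD.2.2 (Nrm_mono_set (m := m) (a := a) (p := p) hU D)
  have hA' := ne_top_of_le_ne_top hE.2.2 (Nrm_mono_set (m := m) (a := a) (p := p) hU E)
  have hφi := hφ.pderivI i
  have key : ∀ b k : Fin d → ℕ, ∑ i, b i + ∑ i, k i ≤ m → ∀ g : Ed d → ℝ, Continuous g →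
      HasCompactSupport g → tsupport g ⊆ Ann d R →
      Tendsto (fun n => ∫ x, W n b x * Z n k x * g x) atTop (𝓝 (∫ x, D b x * E k x * g x)) := by
    intro b k hbk g hg hgc hgs
    obtain ⟨C, hC, h⟩ := (hB b k hbk).spec
    have hl := Appr.prod hp hbk (h R hR) hC hRR hW hZ hD.2.1 hE.2.1 hA hA'
    refine Pw_test_limit hp hR (fun n => (hW.2.1 n b).mul (hZ.2.1 n k)) ((hD.2.1 b).mul (hE.2.1 k)) (fun n => ?_)
      (prod_loc hp hB hD hE hbk) hl hg hgc hgs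
    exact (((hW.1 n).1 b (by omega)).mul ((hZ.1 n).1 k (by omega))).locallyIntegrable.locallyIntegrableOn _
  have k1 := key β κ hβκ.le _ hφi.1.continuous hφi.2.1 ((pderivI_tsupport i φ).trans hφR)
  have k2 := key (β + Pi.single i 1) κ (by rw [sum_add_single]; omega) φ hφ.1.continuous hφ.2.1 hφR
  have k3 := key β (κ + Pi.single i 1) (by rw [sum_add_single]; omega) φ hφ.1.continuous hφ.2.1 hφR
  refine tendsto_nhds_unique k1 ((k2.add k3).neg.congr fun n => ?_)
  exact (jet_prod_ibp (hW.1 n) (hZ.1 n) hβκ i ⟨hφ.1, hφ.2.1, hφR.trans hRR⟩).symm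

/-- Leibniz step. -/
def leibStep (d : ℕ) (i : Fin d) (s : Multiset ((Fin d → ℕ) × (Fin d → ℕ))) :
    Multiset ((Fin d → ℕ) × (Fin d → ℕ)) :=
  s.map (fun q => (q.1 + Pi.single i 1, q.2)) + s.map (fun q => (q.1, q.2 + Pi.single i 1))

lemma leibStep_comm (d : ℕ) (i j : Fin d) (s : Multiset ((Fin d → ℕ) × (Fin d → ℕ))) :
    leibStep d i (leibStep d j s) = leibStep d j (leibStep d i s) := by
  unfold leibStep
  simp only [Multiset.map_add, Multiset.map_map, Function.comp_def]
  have h1 : ∀ q : Fin d → ℕ, q + Pi.single j 1 + Pi.single i 1 = q + Pi.single i 1 + Pi.single j 1 :=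
    fun q => add_right_comm _ _ _
  simp only [h1]
  abel

/-- All Leibniz terms. -/
def leib (d : ℕ) (γ : Fin d → ℕ) : Multiset ((Fin d → ℕ) × (Fin d → ℕ)) :=
  foldOp (leibStep d) γ (List.finRange d) {(0, 0)}

lemma leib_zero (d : ℕ) : leib d 0 = {(0, 0)} := foldOp_zero _ _

lemma leib_succ (d : ℕ) (γ : Fin d → ℕ) (i : Fin d) : leib d (γ + Pi.single i 1) = leibStep d i (leib d γ) :=
  foldOp_add_single (P := fun _ => True) (fun _ _ _ => trivial) (fun i j x _ => leibStep_comm d i j x) γ _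
    (List.nodup_finRange d) i (List.mem_finRange i) _ trivial

lemma leib_sum {d : ℕ} : ∀ (n : ℕ) (γ : Fin d → ℕ), ∑ i, γ i = n → ∀ q ∈ leib d γ, ∑ i, q.1 i + ∑ i, q.2 i = n := by
  intro n
  induction n with
  | zero =>
    intro γ hγ q hq
    have : γ = 0 := by
      ext i
      have := Finset.single_le_sum (f := γ) (fun j _ => Nat.zero_le _) (Finset.mem_univ i)
      simp only [Pi.zero_apply]
      omega
    rw [this, leib_zero, Multiset.mem_singleton] at hq
    simp [hq]
  | succ n ih =>
    intro γ hγ q hq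
    obtain ⟨γ', i, h, h2⟩ := exists_pred γ n hγ
    rw [h, leib_succ] at hq
    unfold leibStep at hq
    rw [Multiset.mem_add, Multiset.mem_map, Multiset.mem_map] at hq
    rcases hq with ⟨q', hq', rfl⟩ | ⟨q', hq', rfl⟩
    · have := ih γ' h2 q' hq'
      simp only [sum_add_single]
      omega
    · have := ih γ' h2 q' hq'
      simp only [sum_add_single]
      omega

/-- Sum of product terms. -/
def PS {d : ℕ} (D E : (Fin d → ℕ) → Ed d → ℝ) (s : Multiset ((Fin d → ℕ) × (Fin d → ℕ))) (x : Ed d) : ℝ :=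
  (s.map fun q => D q.1 x * E q.2 x).sum

lemma PS_zero {d : ℕ} (D E : (Fin d → ℕ) → Ed d → ℝ) (x : Ed d) : PS D E 0 x = 0 := by simp [PS]

lemma PS_cons {d : ℕ} (D E : (Fin d → ℕ) → Ed d → ℝ) (q) (s : Multiset ((Fin d → ℕ) × (Fin d → ℕ)))
    (x : Ed d) : PS D E (q ::ₘ s) x = D q.1 x * E q.2 x + PS D E s x := by simp [PS]

lemma PS_add {d : ℕ} (D E : (Fin d → ℕ) → Ed d → ℝ) (s t : Multiset ((Fin d → ℕ) × (Fin d → ℕ)))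
    (x : Ed d) : PS D E (s + t) x = PS D E s x + PS D E t x := by simp [PS]

lemma PS_meas {d : ℕ} {D E : (Fin d → ℕ) → Ed d → ℝ} (hD : ∀ α, Measurable (D α))
    (hE : ∀ α, Measurable (E α)) (s : Multiset ((Fin d → ℕ) × (Fin d → ℕ))) : Measurable (PS D E s) := by
  induction s using Multiset.induction with
  | empty =>
    have : PS D E 0 = fun _ => 0 := funext fun x => PS_zero D E x
    rw [this]; exact measurable_const
  | cons q s ih =>
    have : PS D E (q ::ₘ s) = fun x => D q.1 x * E q.2 x + PS D E s x := funext fun x => PS_cons D E q s x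
    rw [this]; exact ((hD _).mul (hE _)).add ih

lemma PS_bound {d m : ℕ} {a p : ℝ} (hp : 1 ≤ p)
    (hB : ∀ β κ : Fin d → ℕ, ∑ i, β i + ∑ i, κ i ≤ m → EBound d m a p β κ) {n : ℕ} (hn : n ≤ m)
    (s : Multiset ((Fin d → ℕ) × (Fin d → ℕ))) : (∀ q ∈ s, ∑ i, q.1 i + ∑ i, q.2 i = n) →
    ∃ C : ℝ≥0∞, C ≠ ∞ ∧ ∀ D E, Good d m a p D → Good d m a p E →
      Pw d ((n : ℝ) - a) p {0}ᶜ (PS D E s) ≤ C * (Nrm d m a p {0}ᶜ D * Nrm d m a p {0}ᶜ E) := by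
  have hp0 : 0 < p := by linarith
  induction s using Multiset.induction with
  | empty =>
    intro _
    refine ⟨0, ENNReal.zero_ne_top, fun D E _ _ => ?_⟩
    simp [Pw, PS_zero, hp0]
  | cons q s ih =>
    intro hs
    obtain ⟨C1, hC1, h1⟩ := ih fun q' hq' => hs q' (Multiset.mem_cons_of_mem hq')
    have hq := hs q (Multiset.mem_cons_self q s)
    obtain ⟨C2, hC2, h2⟩ := global_bound hp (hq.le.trans hn) (hB q.1 q.2 (hq.le.trans hn))
    rw [hq] at h2
    refine ⟨2 ^ p * (C2 + C1), ENNReal.mul_ne_top (two_rpow_ne hp0.le) (ENNReal.add_ne_top.2 ⟨hC2, hC1⟩),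
      fun D E hD hE => ?_⟩
    refine (Pw_add_le hp0.le (F := fun x => D q.1 x * E q.2 x) (G := PS D E s)
      ((hD.2.1 _).mul (hE.2.1 _)) fun x => ?_).trans ?_
    · rw [PS_cons]; exact abs_add_le _ _
    · rw [mul_assoc, add_mul]
      exact mul_le_mul_right (add_le_add (h2 D E hD hE) (h1 D E hD hE)) _

lemma PS_loc {d m : ℕ} {a p : ℝ} (hp : 1 ≤ p)
    (hB : ∀ β κ : Fin d → ℕ, ∑ i, β i + ∑ i, κ i ≤ m → EBound d m a p β κ) {n : ℕ} (hn : n ≤ m)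
    {D E : (Fin d → ℕ) → Ed d → ℝ} (hD : Good d m a p D) (hE : Good d m a p E)
    {s : Multiset ((Fin d → ℕ) × (Fin d → ℕ))} (hs : ∀ q ∈ s, ∑ i, q.1 i + ∑ i, q.2 i = n) :
    LocallyIntegrableOn (PS D E s) {0}ᶜ volume := by
  obtain ⟨C, hC, h⟩ := PS_bound hp hB hn s hs
  exact loc_of_Pw hp (PS_meas hD.2.1 hE.2.1 s) (ne_top_of_le_ne_top
    (ENNReal.mul_ne_top hC (ENNReal.mul_ne_top hD.2.2 hE.2.2)) (h D E hD hE))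

lemma leibStep_cons {d : ℕ} (i : Fin d) (q) (s : Multiset ((Fin d → ℕ) × (Fin d → ℕ))) :
    leibStep d i (q ::ₘ s) = (q.1 + Pi.single i 1, q.2) ::ₘ (q.1, q.2 + Pi.single i 1) ::ₘ leibStep d i s := by
  unfold leibStep
  simp only [Multiset.map_cons, Multiset.cons_add, Multiset.add_cons]
  exact Multiset.cons_swap _ _ _

lemma leibStep_sum {d n : ℕ} (i : Fin d) {s : Multiset ((Fin d → ℕ) × (Fin d → ℕ))}
    (hs : ∀ q ∈ s, ∑ i, q.1 i + ∑ i, q.2 i = n) :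
    ∀ q ∈ leibStep d i s, ∑ i, q.1 i + ∑ i, q.2 i = n + 1 := by
  intro q hq
  unfold leibStep at hq
  rw [Multiset.mem_add, Multiset.mem_map, Multiset.mem_map] at hq
  rcases hq with ⟨q', hq', rfl⟩ | ⟨q', hq', rfl⟩
  · have := hs q' hq'
    simp only [sum_add_single]
    omega
  · have := hs q' hq'
    simp only [sum_add_single]
    omega

lemma PS_ibp {d m : ℕ} {a p : ℝ} (hp : 1 ≤ p)
    (hB : ∀ β κ : Fin d → ℕ, ∑ i, β i + ∑ i, κ i ≤ m → EBound d m a p β κ) {n : ℕ} (hn : n < m)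
    {D E : (Fin d → ℕ) → Ed d → ℝ} (hD : Good d m a p D) (hE : Good d m a p E)
    (i : Fin d) {φ : Ed d → ℝ} (hφ : IsTestFun d {0}ᶜ φ)
    (s : Multiset ((Fin d → ℕ) × (Fin d → ℕ))) : (∀ q ∈ s, ∑ i, q.1 i + ∑ i, q.2 i = n) →
    ∫ x, PS D E s x * pderivI d i φ x = - ∫ x, PS D E (leibStep d i s) x * φ x := by
  have hφi := hφ.pderivI i
  induction s using Multiset.induction with
  | empty =>
    intro _
    have : leibStep d i 0 = 0 := by simp [leibStep]
    simp [this, PS_zero]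
  | cons q s ih =>
    intro hs
    have hs' : ∀ q ∈ s, ∑ i, q.1 i + ∑ i, q.2 i = n := fun q' hq' => hs q' (Multiset.mem_cons_of_mem hq')
    have h1 := ih hs'
    have hq := hs q (Multiset.mem_cons_self q s)
    have h2 := prod_ibp hp hB hD hE (β := q.1) (κ := q.2) (by omega) i hφ
    simp only [leibStep_cons, PS_cons, add_mul]
    rw [integral_add (loc_mul_test (prod_loc hp hB hD hE (by omega)) hφi.1.continuous hφi.2.1 hφi.2.2)
      (loc_mul_test (PS_loc hp hB hn.le hD hE hs') hφi.1.continuous hφi.2.1 hφi.2.2), h1, h2]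
    have i1 : Integrable (fun x => D (q.1 + Pi.single i 1) x * E q.2 x * φ x) volume :=
      loc_mul_test (prod_loc hp hB hD hE (by rw [sum_add_single]; omega)) hφ.1.continuous hφ.2.1 hφ.2.2
    have i2 : Integrable (fun x => D q.1 x * E (q.2 + Pi.single i 1) x * φ x) volume :=
      loc_mul_test (prod_loc hp hB hD hE (by rw [sum_add_single]; omega)) hφ.1.continuous hφ.2.1 hφ.2.2
    have i3 : Integrable (fun x => PS D E (leibStep d i s) x * φ x) volume :=
      loc_mul_test (PS_loc hp hB (n := n + 1) hn hD hE (leibStep_sum i hs')) hφ.1.continuous hφ.2.1 hφ.2.2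
    have i4 : Integrable (fun x => D q.1 x * E (q.2 + Pi.single i 1) x * φ x +
      PS D E (leibStep d i s) x * φ x) volume := i2.add i3
    rw [integral_add i1 i4, integral_add i2 i3]
    ring

lemma prod_good {d m : ℕ} {a p : ℝ} (hp : 1 ≤ p)
    (hB : ∀ β κ : Fin d → ℕ, ∑ i, β i + ∑ i, κ i ≤ m → EBound d m a p β κ) :
    ∃ C : ℝ≥0∞, C ≠ ∞ ∧ ∀ D E, Good d m a p D → Good d m a p E → ∃ P, Good d m a p P ∧
      (∀ x, P 0 x = D 0 x * E 0 x) ∧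
      Nrm d m a p {0}ᶜ P ≤ C * (Nrm d m a p {0}ᶜ D * Nrm d m a p {0}ᶜ E) := by
  have h1 : ∀ γ : Fin d → ℕ, ∃ C : ℝ≥0∞, C ≠ ∞ ∧ (∑ i, γ i ≤ m → ∀ D E, Good d m a p D → Good d m a p E →
      Pw d (((∑ i, γ i : ℕ) : ℝ) - a) p {0}ᶜ (PS D E (leib d γ)) ≤
        C * (Nrm d m a p {0}ᶜ D * Nrm d m a p {0}ᶜ E)) := by
    intro γ
    by_cases hγ : ∑ i, γ i ≤ m
    · obtain ⟨C, hC, h⟩ := PS_bound hp hB hγ (leib d γ) (leib_sum _ γ rfl)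
      exact ⟨C, hC, fun _ => h⟩
    · exact ⟨0, ENNReal.zero_ne_top, fun h => absurd h hγ⟩
  choose C hC h using h1
  have hCt : ∑ γ ∈ multiIdx d m, C γ ≠ ∞ := ENNReal.sum_ne_top.2 fun γ _ => hC γ
  refine ⟨∑ γ ∈ multiIdx d m, C γ, hCt, fun D E hD hE => ?_⟩
  have hN : Nrm d m a p {0}ᶜ (fun γ => PS D E (leib d γ)) ≤
      (∑ γ ∈ multiIdx d m, C γ) * (Nrm d m a p {0}ᶜ D * Nrm d m a p {0}ᶜ E) := by
    rw [Nrm_eq_Pw, Finset.sum_mul]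
    exact Finset.sum_le_sum fun γ hγ => h γ (mem_multiIdx.1 hγ) D E hD hE
  refine ⟨fun γ => PS D E (leib d γ), ⟨⟨fun γ hγ => ?_, fun γ hγ i φ hφ => ?_⟩,
    fun γ => PS_meas hD.2.1 hE.2.1 _, ?_⟩, fun x => ?_, hN⟩
  · exact PS_loc hp hB hγ hD hE (leib_sum _ γ rfl)
  · rw [setInt_test (hφ.pderivI i).2.2, setInt_test hφ.2.2]
    simp only [leib_succ]
    exact PS_ibp hp hB hγ hD hE i hφ _ (leib_sum _ γ rfl)
  · exact ne_top_of_le_ne_top (ENNReal.mul_ne_top hCt (ENNReal.mul_ne_top hD.2.2 hE.2.2)) hN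
  · simp [leib_zero, PS]

lemma kI_eq {d : ℕ} {a p : ℝ} (hp : 1 ≤ p) (D : (Fin d → ℕ) → Ed d → ℝ) (α : Fin d → ℕ) (x : Ed d) :
    ENNReal.ofReal (kIntegrand d (rhoModel d 0) a p α (D α) x) = ENNReal.ofReal (Gw d a D α x) ^ p := by
  rw [ENNReal.ofReal_rpow_of_nonneg Gw_nonneg (by linarith)]
  rfl

lemma Nrm_of_KMem {d m : ℕ} {a p : ℝ} (hp : 1 ≤ p) {u : Ed d → ℝ} {D : (Fin d → ℕ) → Ed d → ℝ}
    (h : KMemData d (ModelDomain d 0) (rhoModel d 0) m a p u D) :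
    Nrm d m a p {0}ᶜ D = ENNReal.ofReal (KnormM d 0 m a p u ^ p) := by
  have hp0 : 0 < p := by linarith
  have h0 : 0 ≤ ∑ α ∈ multiIdx d m, ∫ x in ModelDomain d 0, kIntegrand d (rhoModel d 0) a p α (D α) x :=
    Finset.sum_nonneg fun α _ => integral_nonneg fun x => kIntegrand_nonneg rhoModel_nonneg a p α _ x
  rw [KnormM_eq h]
  unfold KnormP
  rw [← Real.rpow_mul h0, one_div, inv_mul_cancel₀ hp0.ne', Real.rpow_one,
    ENNReal.ofReal_sum_of_nonneg fun α _ => integral_nonneg fun x => kIntegrand_nonneg rhoModel_nonneg a p α _ x]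
  unfold Nrm
  refine Finset.sum_congr rfl fun α hα => ?_
  rw [ofReal_integral_eq_lintegral_ofReal (h.2 α hα)
    (Eventually.of_forall fun x => kIntegrand_nonneg rhoModel_nonneg a p α _ x), modelDomain_eq]
  refine lintegral_congr fun x => (kI_eq hp D α x).symm

lemma good_of_KMem {d m : ℕ} {a p : ℝ} (hp : 1 ≤ p) {u : Ed d → ℝ}
    (h : MemKM d 0 m a p u) :
    ∃ D, Good d m a p D ∧ D 0 =ᵐ[volume.restrict {0}ᶜ] u ∧
      Nrm d m a p {0}ᶜ D = ENNReal.ofReal (KnormM d 0 m a p u ^ p) := by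
  classical
  obtain ⟨D, hD⟩ := h
  have hsm : ∀ α, ∑ i, α i ≤ m → AEStronglyMeasurable (D α) (volume.restrict (ModelDomain d 0)) := fun α hα =>
    (hD.1 α (mem_multiIdx.2 hα)).2.1.aestronglyMeasurable
  let D' : (Fin d → ℕ) → Ed d → ℝ := fun α => if h : ∑ i, α i ≤ m then (hsm α h).mk (D α) else 0
  have hD'm : ∀ α, Measurable (D' α) := by
    intro α
    by_cases h : ∑ i, α i ≤ m
    · simp only [D', h, dif_pos]
      exact (hsm α h).stronglyMeasurable_mk.measurable
    · simp only [D', h, dif_neg, not_false_iff]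
      exact measurable_const
  have hae : ∀ α, ∑ i, α i ≤ m → D α =ᵐ[volume.restrict (ModelDomain d 0)] D' α := by
    intro α h
    simp only [D', h, dif_pos]
    exact (hsm α h).ae_eq_mk
  have hK : KMemData d (ModelDomain d 0) (rhoModel d 0) m a p u D' := by
    refine ⟨fun α hα => ⟨(hD.1 α hα).1, ?_, fun φ hφ => ?_⟩, fun α hα => ?_⟩
    · exact (hD.1 α hα).2.1.congr (hae α (mem_multiIdx.1 hα))
    · rw [(hD.1 α hα).2.2 φ hφ]
      congr 1
      apply integral_congr_ae
      filter_upwards [hae α (mem_multiIdx.1 hα)] with x hx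
      rw [hx]
    · refine (hD.2 α hα).congr ?_
      filter_upwards [hae α (mem_multiIdx.1 hα)] with x hx
      unfold kIntegrand
      rw [hx]
  have hN := Nrm_of_KMem hp hK
  have hw := wchain_of_family isOpen_model hK.1
  rw [modelDomain_eq] at hw
  exact ⟨D', ⟨hw.1, hD'm, by rw [hN]; exact ENNReal.ofReal_ne_top⟩, hw.2, hN⟩

lemma KMem_of_good {d m : ℕ} {a p : ℝ} (hp : 1 ≤ p) {u : Ed d → ℝ} {D : (Fin d → ℕ) → Ed d → ℝ}
    (hD : Good d m a p D) (h0 : D 0 =ᵐ[volume.restrict {0}ᶜ] u) :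
    KMemData d (ModelDomain d 0) (rhoModel d 0) m a p u D := by
  have hl : LocallyIntegrableOn u {0}ᶜ volume := (hD.1.1 0 (by simp)).congr h0
  rw [modelDomain_eq]
  refine ⟨family_of_wchain hD.1 h0 hl, fun α hα => ?_⟩
  have hm : Measurable (kIntegrand d (rhoModel d 0) a p α (D α)) := (Gw_meas (a := a) (hD.2.1 α)).pow_const p
  refine ⟨hm.aestronglyMeasurable, ?_⟩
  rw [hasFiniteIntegral_iff_ofReal (Eventually.of_forall fun x =>
    kIntegrand_nonneg rhoModel_nonneg a p α _ x)]
  simp only [kI_eq hp]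
  exact lt_of_le_of_lt (Nrm_term_le (mem_multiIdx.1 hα)) hD.2.2.lt_top

lemma sufficiency {d m : ℕ} {a p : ℝ} (hp : 1 ≤ p)
    (hB : ∀ β κ : Fin d → ℕ, ∑ i, β i + ∑ i, κ i ≤ m → EBound d m a p β κ) :
    (∀ u v : Ed d → ℝ, MemKM d 0 m a p u → MemKM d 0 m a p v → MemKM d 0 m a p (u * v)) ∧
      ∃ c : ℝ, 0 < c ∧ ∀ u v : Ed d → ℝ, MemKM d 0 m a p u → MemKM d 0 m a p v →
        KnormM d 0 m a p (u * v) ≤ c * KnormM d 0 m a p u * KnormM d 0 m a p v := by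
  have hp0 : 0 < p := by linarith
  obtain ⟨C, hC, h⟩ := prod_good hp hB
  have key : ∀ u v : Ed d → ℝ, MemKM d 0 m a p u → MemKM d 0 m a p v →
      ∃ P, KMemData d (ModelDomain d 0) (rhoModel d 0) m a p (u * v) P ∧
        Nrm d m a p {0}ᶜ P ≤ C * (ENNReal.ofReal (KnormM d 0 m a p u ^ p) *
          ENNReal.ofReal (KnormM d 0 m a p v ^ p)) := by
    intro u v hu hv
    obtain ⟨D, hD, hD0, hDN⟩ := good_of_KMem hp hu
    obtain ⟨E, hE, hE0, hEN⟩ := good_of_KMem hp hv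
    obtain ⟨P, hP, hP0, hPN⟩ := h D E hD hE
    rw [hDN, hEN] at hPN
    refine ⟨P, KMem_of_good hp hP ?_, hPN⟩
    filter_upwards [hD0, hE0] with x h1 h2
    rw [hP0, h1, h2]
    rfl
  refine ⟨fun u v hu hv => ?_, (C.toReal + 1) ^ (1 / p), by positivity, fun u v hu hv => ?_⟩
  · obtain ⟨P, hP, _⟩ := key u v hu hv
    exact ⟨P, hP⟩
  · obtain ⟨P, hP, hN⟩ := key u v hu hv
    have hu0 : 0 ≤ KnormM d 0 m a p u := KnormM_nonneg hu
    have hv0 : 0 ≤ KnormM d 0 m a p v := KnormM_nonneg hv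
    have huv0 : 0 ≤ KnormM d 0 m a p (u * v) := KnormM_nonneg ⟨P, hP⟩
    rw [Nrm_of_KMem hp hP, ← ENNReal.ofReal_mul (by positivity), ← ENNReal.ofReal_toReal hC,
      ← ENNReal.ofReal_mul ENNReal.toReal_nonneg, ENNReal.ofReal_le_ofReal_iff (by positivity)] at hN
    rw [← Real.rpow_le_rpow_iff huv0 (by positivity) hp0, Real.mul_rpow (by positivity) hv0,
      Real.mul_rpow (by positivity) hu0, ← Real.rpow_mul (by positivity), one_div, inv_mul_cancel₀ hp0.ne',
      Real.rpow_one, mul_assoc]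
    refine hN.trans (mul_le_mul_of_nonneg_right (by linarith) (by positivity))

/-- Corollary `mult11`(ii): for `ℓ = 0` the Kondratiev space `𝒦^m_{a,p}(ℝ^d, ℝ⁰_*)`
is an algebra with respect to pointwise multiplication if and only if `a ≥ d/p` and
either `1 < p < ∞` and `m > d/p`, or `p = 1` and `m ≥ d`. -/
theorem statement11 (d m : ℕ) (hd : 2 ≤ d) (hm : 1 ≤ m) (a p : ℝ) (hp : 1 ≤ p) :
    ((∀ u v : Ed d → ℝ, MemKM d 0 m a p u → MemKM d 0 m a p v → MemKM d 0 m a p (u * v)) ∧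
      ∃ c : ℝ, 0 < c ∧ ∀ u v : Ed d → ℝ, MemKM d 0 m a p u → MemKM d 0 m a p v →
        KnormM d 0 m a p (u * v) ≤ c * KnormM d 0 m a p u * KnormM d 0 m a p v) ↔
      ((d : ℝ) / p ≤ a ∧ ((1 < p ∧ (d : ℝ) / p < m) ∨ (p = 1 ∧ d ≤ m))) := by
  constructor
  · rintro ⟨h1, c, hc, h2⟩
    exact necessity hd hp h1 hc h2
  · rintro ⟨ha, h⟩
    apply sufficiency hp
    intro β κ hβκ
    rcases h with ⟨hp1, hm'⟩ | ⟨rfl, hm'⟩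
    · exact E1 hd hp hm' ha hβκ
    · exact E2 hd hm' ha hβκ

end
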